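/- Let M, N, P be integers with M, N, P ≥ 4, and suppose it is not the case that two of M, N, P equal 4 while the third is odd (i.e. no permutation of (M,N,P) has the form (2m+1,4,4)). Then the Artin group A_{MNP} is residually finite. -/

import Mathlib

/-- The alternating word (a,b)_M = abab⋯ of length M in the free group. -/
def altWord {V : Type} (a b : V) (M : ℕ) : FreeGroup V :=
  ((List.range M).map fun i => if i % 2 = 0 then FreeGroup.of a else FreeGroup.of b).prod

/-- The relators of the Artin group A_{MNP} on three generators a = 0, b = 1, c = 2. -/
def artinRels3 (M N P : ℕ) : Set (FreeGroup (Fin 3)) :=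
  {altWord 0 1 M * (altWord 1 0 M)⁻¹,
   altWord 1 2 N * (altWord 2 1 N)⁻¹,
   altWord 2 0 P * (altWord 0 2 P)⁻¹}

/-- The Artin group A_{MNP}. -/
abbrev Artin3 (M N P : ℕ) : Type := PresentedGroup (artinRels3 M N P)

/-- A group is residually finite if every nontrivial element survives in some finite quotient. -/
def ResiduallyFinite (G : Type*) [Group G] : Prop :=
  ∀ g : G, g ≠ 1 → ∃ (Q : Type) (_ : Group Q) (_ : Finite Q) (φ : G →* Q), φ g ≠ 1


lemma exists_perm_of_rel {X : Type*} [Finite X] (R : X → X → Prop)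
    (h1 : ∀ a b c, R a b → R a c → b = c) (h2 : ∀ a b c, R a c → R b c → a = b) :
    ∃ s : Equiv.Perm X, ∀ a b, R a b → s a = b := by
  classical
  have := Fintype.ofFinite X
  let f : {x // ∃ y, R x y} → {y // ∃ x, R x y} := fun x => ⟨x.2.choose, x.1, x.2.choose_spec⟩
  have hf : Function.Bijective f := by
    constructor
    · intro x y hxy
      have h3 : x.2.choose = y.2.choose := congrArg Subtype.val hxy
      have hy := y.2.choose_spec
      rw [← h3] at hy
      exact Subtype.ext (h2 _ _ _ x.2.choose_spec hy)
    · rintro ⟨y, x, hxy⟩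
      refine ⟨⟨x, y, hxy⟩, Subtype.ext ?_⟩
      exact h1 _ _ _ (Exists.choose_spec (⟨y, hxy⟩ : ∃ y, R x y)) hxy
  refine ⟨(Equiv.ofBijective f hf).extendSubtype, fun a b hab => ?_⟩
  rw [Equiv.extendSubtype_apply_of_mem _ a ⟨b, hab⟩]
  exact h1 _ _ _ (Exists.choose_spec (⟨b, hab⟩ : ∃ y, R a y)) hab

theorem freeGroup_rf {α : Type*} (w : FreeGroup α) (hw : w ≠ 1) :
    ∃ (Q : Type) (_ : Group Q) (_ : Finite Q) (φ : FreeGroup α →* Q), φ w ≠ 1 := by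
  classical
  set L := w.toWord with hL
  have hred : FreeGroup.IsReduced L := FreeGroup.isReduced_toWord
  have hne : L ≠ [] := by
    intro h; exact hw (FreeGroup.toWord_eq_nil_iff.mp h)
  have hch : ∀ i (h : i + 1 < L.length), L[i].1 = L[i+1].1 → L[i].2 = L[i+1].2 := by
    intro i h
    exact (List.isChain_iff_getElem.mp hred) i h
  let n := L.length
  let R : α → Fin (n+1) → Fin (n+1) → Prop := fun a j k =>
    (L[k.1]? = some (a, true) ∧ j.1 = k.1 + 1) ∨ (L[j.1]? = some (a, false) ∧ k.1 = j.1 + 1)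
  have key : ∀ (a : α) (i : ℕ) (s : Bool), L[i]? = some (a, s) → L[i+1]? = some (a, !s) → False := by
    intro a i s h1 h2
    obtain ⟨hi, h1⟩ := List.getElem?_eq_some_iff.mp h1
    obtain ⟨hi2, h2⟩ := List.getElem?_eq_some_iff.mp h2
    have := hch i hi2
    rw [h1, h2] at this
    simp at this
  have hR : ∀ a, ∃ s : Equiv.Perm (Fin (n+1)), ∀ j k, R a j k → s j = k := by
    intro a
    apply exists_perm_of_rel
    · rintro x y z (⟨h1, h2⟩ | ⟨h1, h2⟩) (⟨h3, h4⟩ | ⟨h3, h4⟩)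
      · exact Fin.ext (by omega)
      · rw [h2] at h3
        exact (key a _ _ h1 h3).elim
      · rw [h4] at h1
        exact (key a _ _ h3 h1).elim
      · exact Fin.ext (by omega)
    · rintro x y z (⟨h1, h2⟩ | ⟨h1, h2⟩) (⟨h3, h4⟩ | ⟨h3, h4⟩)
      · exact Fin.ext (by omega)
      · rw [h4] at h1
        exact (key a _ _ h3 h1).elim
      · rw [h2] at h3
        exact (key a _ _ h1 h3).elim
      · exact Fin.ext (by omega)
  choose s hs using hR
  refine ⟨Equiv.Perm (Fin (n+1)), inferInstance, inferInstance, FreeGroup.lift s, ?_⟩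
  have main : ∀ (L' : List (α × Bool)) (k : Fin (n + 1)), k.1 + L'.length = n → L' = L.drop k.1 →
      (List.prod (L'.map fun x => cond x.2 (s x.1) (s x.1)⁻¹)) (Fin.last n) = k := by
    intro L'
    induction L' with
    | nil =>
      intro k hk _
      simp at hk
      exact Fin.ext (by simp [hk])
    | cons l L' ih =>
      intro k hk hd
      simp only [List.length_cons] at hk
      have hk' : k.1 < L.length := by change k.1 < n; omega
      rw [List.drop_eq_getElem_cons hk'] at hd
      obtain ⟨h1, h2⟩ := List.cons.inj hd
      have h3 := ih ⟨k.1 + 1, by omega⟩ (by simp; omega) h2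
      have h4 : L[k.1]? = some l := by rw [h1]; exact List.getElem?_eq_getElem hk'
      simp only [List.map_cons, List.prod_cons, Equiv.Perm.mul_apply]
      rw [h3]
      obtain ⟨a, t⟩ := l
      cases t
      · simp only [cond_false]
        rw [Equiv.Perm.inv_eq_iff_eq]
        exact (hs a _ _ (Or.inr ⟨h4, rfl⟩)).symm
      · exact hs a _ _ (Or.inl ⟨h4, rfl⟩)
  intro h
  have h2 := main L 0 (by simp [n]) (by simp)
  rw [← FreeGroup.lift_mk, hL, FreeGroup.mk_toWord, h] at h2
  have : n = 0 := by simpa using congrArg Fin.val h2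
  exact hne (List.length_eq_zero_iff.mp this)

/-- the final permutation -/
lemma final_perm {Pb : Type} [Group Pb] (H : Subgroup Pb) (b : Pb → Pb) (u : Pb) (hu : u ∈ H)
    (hbH : ∀ w ∈ H, b w ∈ H) (hbmul : ∀ v ∈ H, ∀ w ∈ H, b (v * w) = b v * b w)
    (hbb : ∀ w ∈ H, b (b w) = u * w * u⁻¹) (hbu : b u = u) (k : ℕ) (e : ℕ → Pb)
    (he : ∀ j, 0 < j → j < k → e j ∉ H) :
    ∃ g : Equiv.Perm (Pb × Fin (k+1) × Bool), (∀ x, g (g x) = (u * x.1, x.2)) ∧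
      (∀ h ∈ H, ∀ x : Pb × Fin (k+1) × Bool, g (h * x.1, x.2) = (b h * (g x).1, (g x).2)) ∧
      ∀ j (hj : j < k) (t : Bool), g (e j, ⟨j, by omega⟩, t) = (1, ⟨j+1, by omega⟩, t) := by
  classical
  have hb1 : b 1 = 1 := by
    have := hbmul 1 H.one_mem 1 H.one_mem
    simpa using this
  let ρ : Pb → Pb := fun w => Quotient.out (Quotient.mk (QuotientGroup.rightRel H) w)
  have hρ1 : ∀ w, w * (ρ w)⁻¹ ∈ H := by
    intro w
    have := Quotient.exact (Quotient.out_eq (Quotient.mk (QuotientGroup.rightRel H) w))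
    exact QuotientGroup.rightRel_apply.mp this
  have hρ2 : ∀ h ∈ H, ∀ w, ρ (h * w) = ρ w := by
    intro h hh w
    have : Quotient.mk (QuotientGroup.rightRel H) (h * w) = Quotient.mk (QuotientGroup.rightRel H) w := by
      apply Quotient.sound
      apply QuotientGroup.rightRel_apply.mpr
      simpa using hh
    simp only [ρ, this]
  have hρ3 : ∀ w, ρ (ρ w) = ρ w := by
    intro w
    have h1 := hρ2 _ (H.inv_mem (hρ1 w)) w
    simpa using h1
  let G : Pb × Fin (k+1) × Bool → Pb × Fin (k+1) × Bool := fun x =>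
    if x.1 ∈ H ∧ 0 < x.2.1.1 then
      (b x.1 * u * e (x.2.1.1 - 1), ⟨x.2.1.1 - 1, by omega⟩, x.2.2)
    else if hx : x.1 * (e x.2.1.1)⁻¹ ∈ H ∧ x.2.1.1 < k then
      (b (x.1 * (e x.2.1.1)⁻¹), ⟨x.2.1.1 + 1, by omega⟩, x.2.2)
    else if x.2.2 then (b (x.1 * (ρ x.1)⁻¹) * u * ρ x.1, x.2.1, false)
    else (b (x.1 * (ρ x.1)⁻¹) * ρ x.1, x.2.1, true)
  have hG2 : ∀ x, G (G x) = (u * x.1, x.2) := by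
    rintro ⟨w, ⟨j, hj⟩, t⟩
    by_cases h1 : w ∈ H ∧ 0 < j
    · have e1 : G (w, ⟨j, hj⟩, t) = (b w * u * e (j - 1), ⟨j - 1, by omega⟩, t) := by
        simp only [G]; rw [if_pos h1]
      have h2 : b w * u ∈ H := H.mul_mem (hbH _ h1.1) hu
      have h3 : ¬ (b w * u * e (j-1) ∈ H ∧ 0 < j - 1) := by
        rintro ⟨h4, h5⟩
        exact he (j-1) h5 (by omega) ((H.mul_mem_cancel_left h2).mp h4)
      have h4 : b w * u * e (j-1) * (e (j-1))⁻¹ ∈ H ∧ j - 1 < k := by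
        constructor
        · simpa using h2
        · omega
      rw [e1]
      simp only [G]
      rw [if_neg h3, dif_pos h4]
      refine Prod.ext ?_ (Prod.ext (Fin.ext ?_) rfl)
      · simp only [mul_inv_cancel_right]
        rw [hbmul _ (hbH _ h1.1) _ hu, hbb _ h1.1, hbu]; group
      · simp; omega
    · by_cases h2 : w * (e j)⁻¹ ∈ H ∧ j < k
      · have e1 : G (w, ⟨j, hj⟩, t) = (b (w * (e j)⁻¹), ⟨j + 1, by omega⟩, t) := by
          simp only [G]; rw [if_neg h1, dif_pos h2]
        rw [e1]
        simp only [G]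
        rw [if_pos ⟨hbH _ h2.1, by omega⟩, hbb _ h2.1]
        refine Prod.ext ?_ (Prod.ext (Fin.ext ?_) rfl)
        · simp; group
        · simp
      · have hr := hρ1 w
        have hbr := hbH _ hr
        have hwρ : w = (w * (ρ w)⁻¹) * ρ w := by group
        have hm : ∀ s ∈ H, s * ρ w ∈ H ↔ w ∈ H := by
          intro s hs
          rw [H.mul_mem_cancel_left hs]
          conv_rhs => rw [hwρ, H.mul_mem_cancel_left hr]
        have hm2 : ∀ s ∈ H, ∀ v, s * ρ w * v ∈ H ↔ w * v ∈ H := by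
          intro s hs v
          rw [mul_assoc, H.mul_mem_cancel_left hs]
          conv_rhs => rw [hwρ, mul_assoc, H.mul_mem_cancel_left hr]
        have hρw : ∀ s ∈ H, ρ (s * ρ w) = ρ w := fun s hs => by rw [hρ2 s hs, hρ3]
        cases t
        · have e1 : G (w, ⟨j, hj⟩, false) = (b (w * (ρ w)⁻¹) * ρ w, ⟨j, hj⟩, true) := by
            simp only [G]; rw [if_neg h1, dif_neg h2, if_neg (by simp)]
          rw [e1]
          simp only [G]
          rw [hm _ hbr, hρw _ hbr, if_neg h1]
          rw [dif_neg (by rw [hm2 _ hbr]; exact h2)]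
          simp [hbb _ hr]
          group
        · have e1 : G (w, ⟨j, hj⟩, true) = (b (w * (ρ w)⁻¹) * u * ρ w, ⟨j, hj⟩, false) := by
            simp only [G]; rw [if_neg h1, dif_neg h2, if_pos (by simp)]
          rw [e1]
          have hbu2 := H.mul_mem hbr hu
          simp only [G]
          rw [hm _ hbu2, hρw _ hbu2, if_neg h1]
          rw [dif_neg (by rw [hm2 _ hbu2]; exact h2)]
          simp [hbmul _ hbr _ hu, hbb _ hr, hbu]
          group
  have hGe : ∀ h ∈ H, ∀ x : Pb × Fin (k+1) × Bool, G (h * x.1, x.2) = (b h * (G x).1, (G x).2) := by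
    rintro h hh ⟨w, ⟨j, hj⟩, t⟩
    have m1 : h * w ∈ H ↔ w ∈ H := H.mul_mem_cancel_left hh
    have m2 : h * w * (e j)⁻¹ ∈ H ↔ w * (e j)⁻¹ ∈ H := by
      rw [mul_assoc, H.mul_mem_cancel_left hh]
    simp only [G, m1, m2, hρ2 h hh]
    split_ifs with h1 h2 h3
    · simp [hbmul h hh w h1.1, mul_assoc]
    · simp [mul_assoc, hbmul h hh _ h2.1]
    · simp [mul_assoc, hbmul h hh _ (hρ1 w)]
    · simp [mul_assoc, hbmul h hh _ (hρ1 w)]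
  have hGi : Function.Injective G := by
    intro x y hxy
    have := congrArg G hxy
    rw [hG2, hG2] at this
    have h1 := congrArg Prod.fst this
    have h2 := congrArg Prod.snd this
    simp only at h1 h2
    exact Prod.ext (mul_left_cancel h1) h2
  have hGs : Function.Surjective G := by
    rintro ⟨w, s⟩
    refine ⟨G (u⁻¹ * w, s), ?_⟩
    rw [hG2]; simp
  refine ⟨Equiv.ofBijective G ⟨hGi, hGs⟩, hG2, hGe, ?_⟩
  intro j hj t
  change G _ = _
  simp only [G]
  rw [if_neg (fun hh => he j hh.2 hj hh.1), dif_pos ⟨by simp, hj⟩]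
  simp [hb1]

lemma finite_monoidHom_of_fg {A E : Type*} [Group A] [Group E] [Finite E] [Group.FG A] :
    Finite (A →* E) := by
  obtain ⟨S, hS⟩ := Group.fg_def.mp (inferInstance : Group.FG A)
  apply Finite.of_injective (fun f : A →* E => fun s : S => f s)
  intro f f' hff
  apply MonoidHom.eq_of_eqOn_dense hS
  intro s hs
  exact congrFun hff ⟨s, hs⟩

/-- the intersection of the kernels of all homomorphisms from `A0` to `E` -/
def vker {A : Type*} [Group A] (A0 : Subgroup A) (E : Type*) [Group E] : Subgroup A :=
  (⨅ f : A0 →* E, f.ker).map A0.subtype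

lemma mem_vker {A : Type*} [Group A] {A0 : Subgroup A} {E : Type*} [Group E] {a : A} :
    a ∈ vker A0 E ↔ ∃ h : a ∈ A0, ∀ f : A0 →* E, f ⟨a, h⟩ = 1 := by
  simp only [vker, Subgroup.mem_map, Subgroup.mem_iInf, MonoidHom.mem_ker]
  constructor
  · rintro ⟨⟨x, hx⟩, h1, rfl⟩
    exact ⟨hx, h1⟩
  · rintro ⟨h, h1⟩
    exact ⟨⟨a, h⟩, h1, rfl⟩

lemma vker_normal {A : Type*} [Group A] (A0 : Subgroup A) [A0.Normal] (E : Type*) [Group E] :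
    (vker A0 E).Normal := by
  constructor
  intro a ha b
  rw [mem_vker] at ha ⊢
  obtain ⟨h, h1⟩ := ha
  refine ⟨Subgroup.Normal.conj_mem inferInstance _ h _, fun f => ?_⟩
  exact h1 (f.comp (MulAut.conjNormal b).toMonoidHom)

lemma vker_finiteIndex {A : Type*} [Group A] [Group.FG A] (A0 : Subgroup A) [A0.FiniteIndex]
    (E : Type*) [Group E] [Finite E] : (vker A0 E).FiniteIndex := by
  have : Group.FG A0 := inferInstance
  have := finite_monoidHom_of_fg (A := A0) (E := E)
  have h2 : ∀ f : A0 →* E, f.ker.FiniteIndex := fun f => inferInstance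
  have h1 : (⨅ f : A0 →* E, f.ker).FiniteIndex := Subgroup.finiteIndex_iInf h2
  constructor
  rw [vker, Subgroup.index_map_subtype]
  exact mul_ne_zero h1.index_ne_zero Subgroup.FiniteIndex.index_ne_zero

section
variable {A C : Type*} [Group A] [Group C] (i : C →* A) (κ : C →* C) 

/-- good subgroups -/
structure GoodK (K : Subgroup A) : Prop where
  normal : K.Normal
  fin : K.FiniteIndex
  stable : ∀ c, i c ∈ K → i (κ c) ∈ K

lemma GoodK.inf {K L : Subgroup A} (hK : GoodK i κ K) (hL : GoodK i κ L) : GoodK i κ (K ⊓ L) := by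
  have := hK.normal
  have := hL.normal
  have := hK.fin
  have := hL.fin
  exact ⟨inferInstance, inferInstance, fun c hc => ⟨hK.stable c hc.1, hL.stable c hc.2⟩⟩

variable [Group.FG A] (A0 : Subgroup A) [A0.Normal] [A0.FiniteIndex] (r : A0 →* C)

lemma vker_good (hr : ∀ a, i (r a) ∈ A0) (hri : ∀ c (h : i c ∈ A0), r ⟨i c, h⟩ = c)
    (hκ : ∀ c, i c ∈ A0 → i (κ c) ∈ A0)
    (E : Type*) [Group E] [Finite E] : GoodK i κ (vker A0 E) := by
  refine ⟨vker_normal _ _, vker_finiteIndex _ _, ?_⟩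
  intro c hc
  rw [mem_vker] at hc ⊢
  obtain ⟨h, h1⟩ := hc
  refine ⟨hκ c h, fun f => ?_⟩
  let θ : A0 →* A0 := ((i.comp κ).comp r).codRestrict A0 (fun a => hκ _ (hr a))
  have h2 := h1 (f.comp θ)
  have h3 : θ ⟨i c, h⟩ = ⟨i (κ c), hκ c h⟩ := by
    apply Subtype.ext
    change i (κ (r ⟨i c, h⟩)) = _
    rw [hri c h]
  rw [MonoidHom.comp_apply, h3] at h2
  exact h2

lemma good_sep_one (hr : ∀ a, i (r a) ∈ A0) (hri : ∀ c (h : i c ∈ A0), r ⟨i c, h⟩ = c)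
    (hκ : ∀ c, i c ∈ A0 → i (κ c) ∈ A0)
    (hRF : ∀ a : A, a ≠ 1 → ∃ (Q : Type) (_ : Group Q) (_ : Finite Q) (φ : A →* Q), φ a ≠ 1)
    (a : A) (ha : a ≠ 1) : ∃ K, GoodK i κ K ∧ a ∉ K := by
  obtain ⟨Q, _, _, φ, h⟩ := hRF a ha
  refine ⟨vker A0 Q, vker_good i κ A0 r hr hri hκ Q, fun h1 => h ?_⟩
  obtain ⟨h2, h3⟩ := mem_vker.mp h1
  exact h3 (φ.comp A0.subtype)

lemma good_sep (hr : ∀ a, i (r a) ∈ A0) (hri : ∀ c (h : i c ∈ A0), r ⟨i c, h⟩ = c)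
    (hκ : ∀ c, i c ∈ A0 → i (κ c) ∈ A0)
    (hRF : ∀ a : A, a ≠ 1 → ∃ (Q : Type) (_ : Group Q) (_ : Finite Q) (φ : A →* Q), φ a ≠ 1)
    (a : A) (ha : ∀ c, a ≠ i c) : ∃ K, GoodK i κ K ∧ ∀ c, ∀ k ∈ K, a ≠ i c * k := by
  by_cases h0 : ∃ c, ∃ k ∈ A0, a = i c * k
  · obtain ⟨c, a0, h0, rfl⟩ := h0
    have h1 : a0⁻¹ * i (r ⟨a0, h0⟩) ≠ 1 := by
      intro h1
      apply ha (c * r ⟨a0, h0⟩)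
      rw [map_mul, ← inv_mul_eq_one.mp h1]
    obtain ⟨Q, _, _, φ, h⟩ := hRF _ h1
    refine ⟨vker A0 Q, vker_good i κ A0 r hr hri hκ Q, fun c' k hk heq => h ?_⟩
    obtain ⟨hk0, hk1⟩ := mem_vker.mp hk
    have e1 : a0 = i (c⁻¹ * c') * k := by
      rw [map_mul, map_inv, mul_assoc, ← heq]; group
    have e2 : i (c⁻¹ * c') ∈ A0 := by
      have : i (c⁻¹ * c') = a0 * k⁻¹ := by rw [e1]; group
      rw [this]
      exact A0.mul_mem h0 (A0.inv_mem hk0)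
    have e3 : r ⟨a0, h0⟩ = (c⁻¹ * c') * r ⟨k, hk0⟩ := by
      have : (⟨a0, h0⟩ : A0) = ⟨i (c⁻¹ * c'), e2⟩ * ⟨k, hk0⟩ := Subtype.ext e1
      rw [this, map_mul, hri]
    have e4 : φ k = 1 := hk1 (φ.comp A0.subtype)
    have e5 : φ (i (r ⟨k, hk0⟩)) = 1 := hk1 (φ.comp (i.comp r))
    rw [e3, map_mul i, e1]
    simp only [map_mul, map_inv, e4, e5]
    group
  · push Not at h0
    refine ⟨vker A0 Unit, vker_good i κ A0 r hr hri hκ Unit, fun c k hk => h0 c k ?_⟩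
    exact (mem_vker.mp hk).1

lemma good_sep_list (hr : ∀ a, i (r a) ∈ A0) (hri : ∀ c (h : i c ∈ A0), r ⟨i c, h⟩ = c)
    (hκ : ∀ c, i c ∈ A0 → i (κ c) ∈ A0)
    (hRF : ∀ a : A, a ≠ 1 → ∃ (Q : Type) (_ : Group Q) (_ : Finite Q) (φ : A →* Q), φ a ≠ 1)
    (l : List A) (hl : ∀ a ∈ l, ∀ c, a ≠ i c) (a1 : A) :
    ∃ K, GoodK i κ K ∧ (a1 ≠ 1 → a1 ∉ K) ∧ ∀ a ∈ l, ∀ c, ∀ k ∈ K, a ≠ i c * k := by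
  induction l with
  | nil =>
    by_cases ha1 : a1 = 1
    · exact ⟨vker A0 Unit, vker_good i κ A0 r hr hri hκ Unit, fun h => absurd ha1 h, by simp⟩
    · obtain ⟨K, h1, h2⟩ := good_sep_one i κ A0 r hr hri hκ hRF a1 ha1
      exact ⟨K, h1, fun _ => h2, by simp⟩
  | cons a l ih =>
    obtain ⟨K, h1, h2, h3⟩ := ih (fun a ha => hl a (by simp [ha]))
    obtain ⟨L, h4, h5⟩ := good_sep i κ A0 r hr hri hκ hRF a (hl a (by simp))
    refine ⟨K ⊓ L, h1.inf i κ h4, fun h h' => h2 h h'.1, ?_⟩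
    intro a' ha' c k hk
    rcases List.mem_cons.mp ha' with rfl | h
    · exact h5 c k hk.2
    · exact h3 a' h c k hk.1
end

section
variable {A C G : Type} [Group A] [Group C] [Group G] (i : C →* A) (κ : C →* C) (uC : C)
  (j : A →* G) (g : G)

lemma rep_absorb (a0 : A) (s : List A) (d : A) :
    ∃ a0' : A, ∃ s' : List A, s'.length = s.length ∧
      j a0 * (s.map (fun a => g * j a)).prod * j d = j a0' * (s'.map (fun a => g * j a)).prod := by
  rcases List.eq_nil_or_concat s with rfl | ⟨s1, y, rfl⟩
  · exact ⟨a0 * d, [], rfl, by simp⟩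
  · exact ⟨a0, s1 ++ [y * d], by simp, by simp [mul_assoc]⟩

lemma rep_reduced (hg2 : g * g = j (i uC)) (hconj : ∀ c, g * j (i c) = j (i (κ c)) * g) :
    ∀ (n : ℕ) (γ : G) (a0 : A) (l : List A), l.length = n →
      γ = j a0 * (l.map (fun a => g * j a)).prod →
      ∃ (a0 : A) (l : List A), γ = j a0 * (l.map (fun a => g * j a)).prod ∧
        ∀ a ∈ l.dropLast, ∀ c, a ≠ i c := by
  intro n
  induction n using Nat.strong_induction_on with
  | _ n ih =>
  intro γ a0 l hl hγ
  by_cases h : ∀ a ∈ l.dropLast, ∀ c, a ≠ i c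
  · exact ⟨a0, l, hγ, h⟩
  · push Not at h
    obtain ⟨a, ha, c, rfl⟩ := h
    obtain ⟨s, t, hst⟩ := List.append_of_mem ha
    have hne : l ≠ [] := by rintro rfl; simp at ha
    have hl2 := List.dropLast_append_getLast hne
    rw [hst] at hl2
    obtain ⟨b, t', ht'⟩ : ∃ b t', t ++ [l.getLast hne] = b :: t' := by
      cases t with
      | nil => exact ⟨_, _, rfl⟩
      | cons b t => exact ⟨b, t ++ [l.getLast hne], rfl⟩
    have hl3 : l = s ++ i c :: b :: t' := by
      rw [← hl2, ← ht']; simp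
    obtain ⟨a0', s', hs', he⟩ := rep_absorb j g a0 s (i (κ c) * i uC * b)
    have hlen : (s' ++ t').length < n := by
      rw [← hl, hl3]; simp [hs']
    refine ih _ hlen γ a0' (s' ++ t') rfl ?_
    rw [hγ, hl3]
    simp only [List.map_append, List.prod_append, List.map_cons, List.prod_cons]
    rw [← mul_assoc (j a0'), ← he, hconj]
    simp only [map_mul, ← hg2, mul_assoc]

theorem theoremX (hκκ : ∀ c, κ (κ c) = uC * c * uC⁻¹) (hκu : κ uC = uC)
    (hg2 : g * g = j (i uC)) (hconj : ∀ c, g * j (i c) = j (i (κ c)) * g)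
    (huniv : ∀ (H : Type) [Group H] (f : A →* H) (h : H), h * h = f (i uC) →
      (∀ c, h * f (i c) = f (i (κ c)) * h) → ∃ F : G →* H, (∀ a, F (j a) = f a) ∧ F g = h)
    (hgen : ∀ γ : G, ∃ (a0 : A) (l : List A), γ = j a0 * (l.map (fun a => g * j a)).prod)
    [Group.FG A] (A0 : Subgroup A) [A0.Normal] [A0.FiniteIndex] (r : A0 →* C)
    (hr : ∀ a, i (r a) ∈ A0) (hri : ∀ c (h : i c ∈ A0), r ⟨i c, h⟩ = c)
    (hκ : ∀ c, i c ∈ A0 → i (κ c) ∈ A0)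
    (hRF : ∀ a : A, a ≠ 1 → ∃ (Q : Type) (_ : Group Q) (_ : Finite Q) (φ : A →* Q), φ a ≠ 1) :
    ResiduallyFinite G := by
  classical
  intro γ hγ1
  obtain ⟨a0, l, hγ⟩ := hgen γ
  obtain ⟨a0, l, hγ, hl⟩ := rep_reduced i κ uC j g hg2 hconj _ γ a0 l rfl hγ
  obtain ⟨K, hK, hKa, hKl⟩ := good_sep_list i κ A0 r hr hri hκ hRF l.dropLast hl a0
  have hKn := hK.normal
  have hKf := hK.fin
  let mk : A →* A ⧸ K := QuotientGroup.mk' K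
  let H : Subgroup (A ⧸ K) := (mk.comp i).range
  let b : A ⧸ K → A ⧸ K := fun w => if h : ∃ c, mk (i c) = w then mk (i (κ h.choose)) else 1
  have hb : ∀ c, b (mk (i c)) = mk (i (κ c)) := by
    intro c
    have h : ∃ c', mk (i c') = mk (i c) := ⟨c, rfl⟩
    simp only [b, dif_pos h]
    have h1 := h.choose_spec
    set c' := h.choose
    have h2 : i (c'⁻¹ * c) ∈ K := by
      rw [map_mul, map_inv]; exact QuotientGroup.eq.mp h1
    have h3 := hK.stable _ h2
    apply QuotientGroup.eq.mpr
    simpa using h3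
  have hmem : ∀ w, w ∈ H ↔ ∃ c, mk (i c) = w := fun w => Iff.rfl
  have hbH : ∀ w ∈ H, b w ∈ H := by
    rintro _ ⟨c, rfl⟩
    exact ⟨κ c, (hb c).symm⟩
  have hbmul : ∀ v ∈ H, ∀ w ∈ H, b (v * w) = b v * b w := by
    rintro _ ⟨c, rfl⟩ _ ⟨d, rfl⟩
    change b (mk (i c) * mk (i d)) = b (mk (i c)) * b (mk (i d))
    rw [← map_mul, ← map_mul, hb, hb, hb]; simp
  have hbb : ∀ w ∈ H, b (b w) = mk (i uC) * w * (mk (i uC))⁻¹ := by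
    rintro _ ⟨c, rfl⟩
    change b (b (mk (i c))) = mk (i uC) * mk (i c) * _
    rw [hb, hb, hκκ]; simp
  let k := l.length
  let e : ℕ → A ⧸ K := fun n => mk (l.reverse[n]?.getD 1)
  have he : ∀ n, 0 < n → n < k → e n ∉ H := by
    intro n hn hnk ⟨c, hc⟩
    have hn1 : n < l.reverse.length := by simpa using hnk
    have h1 : e n = mk (l.reverse[n]) := by simp only [e]; rw [List.getElem?_eq_getElem hn1]; rfl
    have hk : k = l.length := rfl
    have h2 : l.reverse[n] ∈ l.dropLast := by
      rw [List.getElem_reverse, List.mem_iff_getElem]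
      refine ⟨l.length - 1 - n, by simp; omega, ?_⟩
      rw [List.getElem_dropLast]
    rw [h1] at hc
    refine hKl _ h2 c ((i c)⁻¹ * l.reverse[n]) (QuotientGroup.eq.mp hc) (by group)
  obtain ⟨p, hp1, hp2, hp3⟩ := final_perm H b (mk (i uC)) ⟨uC, rfl⟩ hbH hbmul hbb
    (by rw [hb, hκu]) k e he
  let f : A →* Equiv.Perm ((A ⧸ K) × Fin (k+1) × Bool) :=
    { toFun := fun a => ⟨fun x => (mk a * x.1, x.2), fun x => ((mk a)⁻¹ * x.1, x.2),
        fun x => by simp, fun x => by simp⟩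
      map_one' := by ext x <;> simp
      map_mul' := fun a b => by ext x <;> simp [mul_assoc] }
  have hf : ∀ a x, f a x = (mk a * x.1, x.2) := fun a x => rfl
  obtain ⟨F, hF1, hF2⟩ := huniv _ f p (by
      apply Equiv.ext; intro x
      rw [Equiv.Perm.mul_apply, hp1]; rfl) (by
      intro c
      apply Equiv.ext; intro x
      rw [Equiv.Perm.mul_apply, Equiv.Perm.mul_apply, hf, hf, hp2 (mk (i c)) ⟨c, rfl⟩, hb])
  refine ⟨Equiv.Perm ((A ⧸ K) × Fin (k+1) × Bool), inferInstance, ?_, F, ?_⟩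
  · have : Finite (A ⧸ K) := Subgroup.finite_quotient_of_finiteIndex
    infer_instance
  have main : ∀ l' : List A, ∀ hl' : l' <:+ l,
      F ((l'.map (fun a => g * j a)).prod) (1, 0, false) =
        (1, ⟨l'.length, Nat.lt_succ_of_le hl'.length_le⟩, false) := by
    intro l'
    induction l' with
    | nil => intro _; simp
    | cons a l'' ih =>
      intro hl'
      have h1 := ih ((List.suffix_cons a l'').trans hl')
      have hlt : l''.length < k := hl'.length_le
      simp only [List.map_cons, List.prod_cons, map_mul, Equiv.Perm.mul_apply] at h1 ⊢
      rw [h1, hF1, hF2, hf]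
      have h2 : e l''.length = mk a := by
        obtain ⟨t, ht⟩ := hl'
        simp only [e, ← ht]
        congr 1
        simp
      rw [mul_one]
      dsimp only
      rw [← h2]
      exact hp3 _ hlt false
  intro hF
  have h1 := main l List.suffix_rfl
  have h2 : F γ (1, 0, false) = (mk a0, ⟨l.length, by omega⟩, false) := by
    rw [hγ, map_mul, Equiv.Perm.mul_apply, h1, hF1, hf]; simp
  rw [hF] at h2
  simp only [Equiv.Perm.coe_one, id_eq, Prod.mk.injEq] at h2
  have h3 : l = [] := by
    apply List.length_eq_zero_iff.mp
    have := congrArg Fin.val h2.2.1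
    simpa using this.symm
  have h4 : a0 ∈ K := (QuotientGroup.eq_one_iff a0).mp h2.1.symm
  have h5 : a0 ≠ 1 := by
    rintro rfl
    apply hγ1
    rw [hγ, h3]; simp
  exact hKa h5 h4
end

/-- braid relation of length `M` -/
def Br {H : Type*} [Group H] (a b : H) (M : ℕ) : Prop :=
  if M % 2 = 0 then (a * b) ^ (M / 2) = (b * a) ^ (M / 2)
  else (a * b) ^ (M / 2) * a = (b * a) ^ (M / 2) * b

lemma lift_altWord {V : Type} {H : Type*} [Group H] (f : V → H) (i j : V) (M : ℕ) :
    FreeGroup.lift f (altWord i j M) =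
      if M % 2 = 0 then (f i * f j) ^ (M / 2) else (f i * f j) ^ (M / 2) * f i := by
  induction M with
  | zero => simp [altWord]
  | succ n ih =>
    have h1 : altWord i j (n+1) = altWord i j n *
        (if n % 2 = 0 then FreeGroup.of i else FreeGroup.of j) := by
      simp [altWord, List.range_succ]
    rw [h1, map_mul, ih]
    rcases Nat.mod_two_eq_zero_or_one n with h | h
    · have h2 : (n + 1) % 2 = 1 := by omega
      have h3 : (n + 1) / 2 = n / 2 := by omega
      simp [h, h2, h3]
    · have h2 : (n + 1) % 2 = 0 := by omega
      have h3 : (n + 1) / 2 = n / 2 + 1 := by omega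
      simp [h, h2, h3, pow_succ, mul_assoc]

lemma lift_rel_iff {V : Type} {H : Type*} [Group H] (f : V → H) (i j : V) (M : ℕ) :
    FreeGroup.lift f (altWord i j M * (altWord j i M)⁻¹) = 1 ↔ Br (f i) (f j) M := by
  rw [map_mul, map_inv, mul_inv_eq_one, lift_altWord, lift_altWord, Br]
  split_ifs <;> rfl

lemma Br_even {H : Type*} [Group H] {a b : H} {M : ℕ} (h : M % 2 = 0) :
    Br a b M ↔ (b * a) ^ (M / 2) * b = b * (b * a) ^ (M / 2) := by
  rw [Br, if_pos h, mul_pow_mul, mul_right_inj]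

lemma Br_even' {H : Type*} [Group H] {a b : H} {M : ℕ} (h : M % 2 = 0) :
    Br a b M ↔ (b * a) ^ (M / 2) * a = a * (b * a) ^ (M / 2) := by
  rw [Br, if_pos h, ← mul_pow_mul, mul_left_inj]; exact eq_comm

lemma Br_odd {H : Type*} [Group H] {a b : H} {M : ℕ} (h : M % 2 = 1) :
    Br a b M ↔ (b * a) ^ (M / 2 + 1) = b * (b * a) ^ (M / 2) * b := by
  have h1 : (b * a) ^ (M / 2 + 1) = b * ((a * b) ^ (M / 2) * a) := by
    rw [pow_succ, ← mul_assoc, mul_pow_mul, mul_assoc]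
  rw [Br, if_neg (by omega), h1, mul_assoc b, mul_right_inj]

lemma Br_odd' {H : Type*} [Group H] {a b : H} {M : ℕ} (h : M % 2 = 1) :
    Br a b M ↔ (b * a) ^ (M / 2 + 1) = a * (b * a) ^ (M / 2) * a := by
  rw [Br, if_neg (by omega), pow_succ, ← mul_assoc, ← mul_pow_mul, mul_left_inj]; exact eq_comm

lemma Br.map {H H' : Type*} [Group H] [Group H'] {a b : H} {M : ℕ} (h : Br a b M) (f : H →* H') :
    Br (f a) (f b) M := by
  unfold Br at *
  split_ifs with h0
  · rw [if_pos h0] at h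
    rw [← map_mul, ← map_mul, ← map_pow, ← map_pow, h]
  · rw [if_neg h0] at h
    rw [← map_mul, ← map_mul, ← map_pow, ← map_pow, ← map_mul, h, map_mul]

lemma Br.symm {H : Type*} [Group H] {a b : H} {M : ℕ} (h : Br a b M) : Br b a M := by
  unfold Br at *
  split_ifs at * <;> exact _root_.Eq.symm h

section
variable {M N P : ℕ}
/-- generator a -/
def ga (M N P : ℕ) : Artin3 M N P := PresentedGroup.of 0
/-- generator b -/
def gb (M N P : ℕ) : Artin3 M N P := PresentedGroup.of 1
/-- generator c -/
def gc (M N P : ℕ) : Artin3 M N P := PresentedGroup.of 2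

lemma artin_rel_aux (i j : Fin 3) (K : ℕ) (h : altWord i j K * (altWord j i K)⁻¹ ∈ artinRels3 M N P) :
    Br (PresentedGroup.of i : Artin3 M N P) (PresentedGroup.of j) K := by
  rw [← lift_rel_iff (fun i => (PresentedGroup.of i : Artin3 M N P))]
  have h1 : (FreeGroup.lift fun i => (PresentedGroup.of i : Artin3 M N P)) =
      PresentedGroup.mk (artinRels3 M N P) := by
    ext x; simp [PresentedGroup.of]
  rw [h1]
  exact PresentedGroup.one_of_mem h

lemma artin_ab : Br (ga M N P) (gb M N P) M := artin_rel_aux _ _ _ (by simp [artinRels3])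
lemma artin_bc : Br (gb M N P) (gc M N P) N := artin_rel_aux _ _ _ (by simp [artinRels3])
lemma artin_ca : Br (gc M N P) (ga M N P) P := artin_rel_aux _ _ _ (by simp [artinRels3])

lemma artin_lift {H : Type*} [Group H] (a b c : H) (h1 : Br a b M) (h2 : Br b c N) (h3 : Br c a P) :
    ∃ F : Artin3 M N P →* H, F (ga M N P) = a ∧ F (gb M N P) = b ∧ F (gc M N P) = c := by
  have h : ∀ r ∈ artinRels3 M N P, FreeGroup.lift ![a, b, c] r = 1 := by
    intro r hr
    simp only [artinRels3, Set.mem_insert_iff, Set.mem_singleton_iff] at hr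
    rcases hr with rfl | rfl | rfl
    · rw [lift_rel_iff]; exact h1
    · rw [lift_rel_iff]; exact h2
    · rw [lift_rel_iff]; exact h3
  exact ⟨PresentedGroup.toGroup h, PresentedGroup.toGroup.of h, PresentedGroup.toGroup.of h,
    PresentedGroup.toGroup.of h⟩

lemma artin_closure : Subgroup.closure {ga M N P, gb M N P, gc M N P} = ⊤ := by
  rw [← PresentedGroup.closure_range_of (artinRels3 M N P)]
  congr 1
  ext x
  simp only [Set.mem_insert_iff, Set.mem_singleton_iff, Set.mem_range]
  constructor
  · rintro (rfl | rfl | rfl)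
    · exact ⟨0, rfl⟩
    · exact ⟨1, rfl⟩
    · exact ⟨2, rfl⟩
  · rintro ⟨y, rfl⟩
    fin_cases y
    · exact Or.inl rfl
    · exact Or.inr (Or.inl rfl)
    · exact Or.inr (Or.inr rfl)
end

/-- the free group on x, y, z -/
abbrev FA := FreeGroup (Fin 3)
/-- the free group on g, ξ, η, ζ -/
abbrev FB := FreeGroup (Fin 4)
/-- x -/
def fX : FA := FreeGroup.of 0
/-- y -/
def fY : FA := FreeGroup.of 1
/-- z -/
def fZ : FA := FreeGroup.of 2
/-- g -/
def fG : FB := FreeGroup.of 0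
/-- ξ -/
def fx : FB := FreeGroup.of 1
/-- η -/
def fy : FB := FreeGroup.of 2
/-- ζ -/
def fz : FB := FreeGroup.of 3

/-- element of the wreath product with given entries -/
def wr (v1 v2 : FA) (s : ℤˣ) : RegularWreathProduct FA ℤˣ := ⟨fun e => if e = 1 then v1 else v2, s⟩

/-- the homomorphism to the wreath product -/
def Th (M N P : ℕ) : FB →* RegularWreathProduct FA ℤˣ := FreeGroup.lift
  ![wr 1 (fZ * fX * fY) (-1),
    if M % 2 = 0 then wr (fX ^ (M/2)) (fZ * fX ^ (M/2) * fZ⁻¹) 1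
      else wr (fX ^ (M/2) * fZ⁻¹) (fZ * fX ^ (M/2+1)) (-1),
    if N % 2 = 0 then wr (fY ^ (N/2)) (fZ * fY ^ (N/2) * fZ⁻¹) 1
      else wr (fY ^ (N/2) * fZ⁻¹) (fZ * fY ^ (N/2+1)) (-1),
    if P % 2 = 0 then wr (fY⁻¹ * fZ ^ (P/2) * fY) (fZ ^ (P/2)) 1
      else wr (fY⁻¹ * fZ ^ (P/2)) (fZ ^ (P/2+1) * fX⁻¹ * fZ⁻¹) 1]

lemma Th_g (M N P : ℕ) : Th M N P fG = wr 1 (fZ * fX * fY) (-1) := by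
  simp [Th, fG]
lemma Th_x0 {M N P : ℕ} (h : M % 2 = 0) :
    Th M N P fx = wr (fX ^ (M/2)) (fZ * fX ^ (M/2) * fZ⁻¹) 1 := by
  simp [Th, fx, h]
lemma Th_x1 {M N P : ℕ} (h : M % 2 = 1) :
    Th M N P fx = wr (fX ^ (M/2) * fZ⁻¹) (fZ * fX ^ (M/2+1)) (-1) := by
  simp [Th, fx, h]
lemma Th_y0 {M N P : ℕ} (h : N % 2 = 0) :
    Th M N P fy = wr (fY ^ (N/2)) (fZ * fY ^ (N/2) * fZ⁻¹) 1 := by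
  simp [Th, fy, h]
lemma Th_y1 {M N P : ℕ} (h : N % 2 = 1) :
    Th M N P fy = wr (fY ^ (N/2) * fZ⁻¹) (fZ * fY ^ (N/2+1)) (-1) := by
  simp [Th, fy, h]
lemma Th_z0 {M N P : ℕ} (h : P % 2 = 0) :
    Th M N P fz = wr (fY⁻¹ * fZ ^ (P/2) * fY) (fZ ^ (P/2)) 1 := by
  simp [Th, fz, h]
lemma Th_z1 {M N P : ℕ} (h : P % 2 = 1) :
    Th M N P fz = wr (fY⁻¹ * fZ ^ (P/2)) (fZ ^ (P/2+1) * fX⁻¹ * fZ⁻¹) 1 := by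
  simp [Th, fz, h]

/-- a B-equivariant triple of families of points in an A-set -/
structure Tri (M N P : ℕ) {Ω : Type*} (ψ : FA →* Equiv.Perm Ω) (p q r : FB → Ω) : Prop where
  hy : ∀ β, ψ fY (p β) = r β
  hx : ∀ β, ψ fX (r β) = q (fG * β)
  hz : ∀ β, ψ fZ (q β) = p (fG * β)
  x1 : M % 2 = 1 → ∀ β, (ψ fX ^ (M/2)) (q β) = p (fx * β)
  x1' : M % 2 = 1 → ∀ β, (ψ fX ^ (M/2+1)) (p β) = q (fx * β)
  x0 : M % 2 = 0 → ∀ β, (ψ fX ^ (M/2)) (p β) = p (fx * β)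
  x0' : M % 2 = 0 → ∀ β, (ψ fX ^ (M/2)) (q β) = q (fx * β)
  y1 : N % 2 = 1 → ∀ β, (ψ fY ^ (N/2)) (q β) = p (fy * β)
  y1' : N % 2 = 1 → ∀ β, (ψ fY ^ (N/2+1)) (p β) = q (fy * β)
  y0 : N % 2 = 0 → ∀ β, (ψ fY ^ (N/2)) (p β) = p (fy * β)
  y0' : N % 2 = 0 → ∀ β, (ψ fY ^ (N/2)) (q β) = q (fy * β)
  z1 : P % 2 = 1 → ∀ β, (ψ fZ ^ (P/2)) (p β) = r (fz * β)
  z1' : P % 2 = 1 → ∀ β, (ψ fZ ^ (P/2+1)) (r β) = p (fG * (fz * (fG * β)))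
  z0 : P % 2 = 0 → ∀ β, (ψ fZ ^ (P/2)) (r β) = r (fz * β)
  z0' : P % 2 = 0 → ∀ β, (ψ fZ ^ (P/2)) (q β) = q (fz * β)

/-- the points of the wreath product action -/
def Jp {Ω : Type*} (p : FB → Ω) (e : ℤˣ) (β : FB) : Ω := if e = 1 then p β else p (fG * β)

lemma tri_J {M N P : ℕ} {Ω : Type*} {ψ : FA →* Equiv.Perm Ω} {p q r : FB → Ω}
    (h : Tri M N P ψ p q r) (w : FB) : ∀ (e : ℤˣ) (β : FB),
      ψ ((Th M N P w).left ((Th M N P w).right * e)) (Jp p e β) =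
        Jp p ((Th M N P w).right * e) (w * β) := by
  have hz' : ∀ β, (Equiv.symm (ψ fZ)) (p (fG * β)) = q β := fun β => by
    rw [Equiv.symm_apply_eq]; exact (h.hz β).symm
  have hy' : ∀ β, (Equiv.symm (ψ fY)) (r β) = p β := fun β => by
    rw [Equiv.symm_apply_eq]; exact (h.hy β).symm
  have hx' : ∀ β, (Equiv.symm (ψ fX)) (q β) = r (fG⁻¹ * β) := fun β => by
    rw [Equiv.symm_apply_eq, h.hx]; simp
  have hne : ((-1 : ℤˣ) = 1) = False := by simp
  have gen : ∀ k : Fin 4, ∀ (e : ℤˣ) (β : FB),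
      ψ ((Th M N P (FreeGroup.of k)).left ((Th M N P (FreeGroup.of k)).right * e)) (Jp p e β) =
        Jp p ((Th M N P (FreeGroup.of k)).right * e) (FreeGroup.of k * β) := by
    intro k e β
    fin_cases k
    · change ψ ((Th M N P fG).left ((Th M N P fG).right * e)) (Jp p e β) =
        Jp p ((Th M N P fG).right * e) (fG * β)
      rw [Th_g]
      rcases Int.units_eq_one_or e with rfl | rfl <;>
        simp [wr, Jp, h.hy, h.hx, h.hz, hne]
    · change ψ ((Th M N P fx).left ((Th M N P fx).right * e)) (Jp p e β) =
        Jp p ((Th M N P fx).right * e) (fx * β)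
      rcases Nat.mod_two_eq_zero_or_one M with hM | hM
      · rw [Th_x0 hM]
        rcases Int.units_eq_one_or e with rfl | rfl <;>
          simp [wr, Jp, h.hz, hne, hz', h.x0 hM, h.x0' hM]
      · rw [Th_x1 hM]
        rcases Int.units_eq_one_or e with rfl | rfl <;>
          simp [wr, Jp, h.hz, hne, hz', h.x1 hM, h.x1' hM]
    · change ψ ((Th M N P fy).left ((Th M N P fy).right * e)) (Jp p e β) =
        Jp p ((Th M N P fy).right * e) (fy * β)
      rcases Nat.mod_two_eq_zero_or_one N with hM | hM
      · rw [Th_y0 hM]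
        rcases Int.units_eq_one_or e with rfl | rfl <;>
          simp [wr, Jp, h.hz, hne, hz', h.y0 hM, h.y0' hM]
      · rw [Th_y1 hM]
        rcases Int.units_eq_one_or e with rfl | rfl <;>
          simp [wr, Jp, h.hz, hne, hz', h.y1 hM, h.y1' hM]
    · change ψ ((Th M N P fz).left ((Th M N P fz).right * e)) (Jp p e β) =
        Jp p ((Th M N P fz).right * e) (fz * β)
      rcases Nat.mod_two_eq_zero_or_one P with hM | hM
      · rw [Th_z0 hM]
        rcases Int.units_eq_one_or e with rfl | rfl
        · simp [wr, Jp, h.hy, hy', h.z0 hM]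
        · simp only [wr, Jp, one_mul, hne, if_false]
          rw [← h.hz, ← h.hz, ← h.z0' hM, map_pow, ← Equiv.Perm.mul_apply, ← Equiv.Perm.mul_apply,
            ← pow_succ, ← pow_succ']
      · rw [Th_z1 hM]
        rcases Int.units_eq_one_or e with rfl | rfl <;>
          simp [wr, Jp, hne, hz', hy', hx', h.z1 hM, h.z1' hM]
  induction w using FreeGroup.induction_on with
  | C1 => intro e β; simp
  | of k => exact gen k
  | inv_of k hk =>
    intro e β
    have h1 := gen k ((Th M N P (FreeGroup.of k)).right⁻¹ * e) ((FreeGroup.of k)⁻¹ * β)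
    rw [mul_inv_cancel_left, mul_inv_cancel_left] at h1
    rw [← h1, map_inv, RegularWreathProduct.inv_left, RegularWreathProduct.inv_right]
    simp only [Pi.inv_apply, mul_inv_cancel_left, map_inv]
    exact Equiv.symm_apply_apply _ _
  | mul x y hx hy =>
    intro e β
    have h1 := hy e β
    have h2 := hx ((Th M N P y).right * e) (y * β)
    rw [← h1] at h2
    simp only [map_mul, RegularWreathProduct.mul_left, RegularWreathProduct.mul_right, Pi.mul_apply,
      Equiv.Perm.mul_apply] at *
    rw [mul_assoc, inv_mul_cancel_left, h2, mul_assoc]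

/-- parity -/
def par (M N P : ℕ) : FB →* ℤˣ := RegularWreathProduct.rightHom.comp (Th M N P)

lemma par_eq {M N P : ℕ} (w : FB) : par M N P w = (Th M N P w).right := rfl
lemma par_g {M N P : ℕ} : par M N P fG = -1 := by rw [par_eq, Th_g]; rfl

/-- the subgroup C -/
abbrev CC (M N P : ℕ) : Subgroup FB := (par M N P).ker

/-- the map C → A -/
def iC (M N P : ℕ) : CC M N P →* FA where
  toFun c := (Th M N P c).left 1
  map_one' := by simp
  map_mul' := fun c d => by
    have h : (Th M N P c).right = 1 := c.2
    simp [h]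

/-- conjugation by g -/
def kC (M N P : ℕ) : CC M N P →* CC M N P := (MulAut.conjNormal fG).toMonoidHom

lemma kC_coe {M N P : ℕ} (c : CC M N P) : (kC M N P c : FB) = fG * c * fG⁻¹ := rfl

lemma iC_k {M N P : ℕ} (c : CC M N P) : iC M N P (kC M N P c) = (Th M N P c).left (-1) := by
  have h : (Th M N P c).right = 1 := c.2
  change (Th M N P (kC M N P c : FB)).left 1 = _
  rw [kC_coe, map_mul, map_mul, map_inv, Th_g]
  simp [wr, h]

/-- the element g² -/
def uC (M N P : ℕ) : CC M N P := ⟨fG * fG, by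
  change par M N P _ = 1
  rw [map_mul, par_g]; rfl⟩

lemma iC_u {M N P : ℕ} : iC M N P (uC M N P) = fZ * fX * fY := by
  change (Th M N P (fG * fG)).left 1 = _
  rw [map_mul, Th_g]
  simp [wr]

lemma kC_u {M N P : ℕ} : kC M N P (uC M N P) = uC M N P := by
  apply Subtype.ext
  rw [kC_coe]; simp [uC, mul_assoc]

lemma kC_k {M N P : ℕ} (c) : kC M N P (kC M N P c) = uC M N P * c * (uC M N P)⁻¹ := by
  apply Subtype.ext
  rw [kC_coe, kC_coe]; simp [uC, mul_assoc]

lemma tri_i {M N P : ℕ} {Ω : Type*} {ψ : FA →* Equiv.Perm Ω} {p q r : FB → Ω}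
    (h : Tri M N P ψ p q r) (c : CC M N P) (β : FB) : ψ (iC M N P c) (p β) = p (c * β) := by
  have h1 := tri_J h c 1 β
  have h2 : (Th M N P c).right = 1 := c.2
  rw [h2] at h1
  simpa [Jp, iC] using h1

section
variable {H : Type*} [Group H] 

/-- the map from A -/
def jA (a b c : H) : FA →* H := FreeGroup.lift ![b * a, c * b, a * c]
/-- the map from B -/
def phB (M N P : ℕ) (a b c : H) : FB →* H := FreeGroup.lift ![a * c * b,
  if M % 2 = 0 then (b * a) ^ (M / 2) else (b * a) ^ (M / 2) * b,
  if N % 2 = 0 then (c * b) ^ (N / 2) else (c * b) ^ (N / 2) * b,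
  if P % 2 = 0 then (c * b)⁻¹ * (a * c) ^ (P / 2) * (c * b) else (c * b)⁻¹ * (a * c) ^ (P / 2)]

variable {M N P : ℕ} (a b c : H)
lemma jA_x : jA a b c fX = b * a := by simp [jA, fX]
lemma jA_y : jA a b c fY = c * b := by simp [jA, fY]
lemma jA_z : jA a b c fZ = a * c := by simp [jA, fZ]
lemma phB_g : phB M N P a b c fG = a * c * b := by simp [phB, fG]
lemma phB_x : phB M N P a b c fx =
    if M % 2 = 0 then (b * a) ^ (M / 2) else (b * a) ^ (M / 2) * b := by simp [phB, fx]
lemma phB_y : phB M N P a b c fy =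
    if N % 2 = 0 then (c * b) ^ (N / 2) else (c * b) ^ (N / 2) * b := by simp [phB, fy]
lemma phB_z : phB M N P a b c fz =
    if P % 2 = 0 then (c * b)⁻¹ * (a * c) ^ (P / 2) * (c * b) else (c * b)⁻¹ * (a * c) ^ (P / 2) := by
  simp [phB, fz]

/-- left multiplication action of A on H -/
def lmA : FA →* Equiv.Perm H := (MulAction.toPermHom H H).comp (jA a b c)

lemma lmA_apply (w : FA) (h : H) : lmA a b c w h = jA a b c w * h := rfl

lemma lmA_pow_apply (w : FA) (n : ℕ) (h : H) : (lmA a b c w ^ n) h = jA a b c w ^ n * h := by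
  rw [← map_pow, lmA_apply, map_pow]

lemma tri_group (h1 : Br a b M) (h2 : Br b c N) (h3 : Br c a P) :
    Tri M N P (lmA a b c) (fun β => phB M N P a b c β) (fun β => b * phB M N P a b c β)
      (fun β => c * b * phB M N P a b c β) := by
  constructor
  · intro β; rw [lmA_apply, jA_y]
  · intro β; rw [lmA_apply, jA_x, map_mul, phB_g]; group
  · intro β; rw [lmA_apply, jA_z, map_mul, phB_g]; group
  · intro h β
    rw [lmA_pow_apply, jA_x, map_mul, phB_x, if_neg (by omega), mul_assoc]
  · intro h β
    rw [lmA_pow_apply, jA_x, map_mul, phB_x, if_neg (by omega), (Br_odd h).mp h1]; simp [mul_assoc]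
  · intro h β
    rw [lmA_pow_apply, jA_x, map_mul, phB_x, if_pos h]
  · intro h β
    rw [lmA_pow_apply, jA_x, map_mul, phB_x, if_pos h, ← mul_assoc, (Br_even h).mp h1, mul_assoc]
  · intro h β
    rw [lmA_pow_apply, jA_y, map_mul, phB_y, if_neg (by omega), mul_assoc]
  · intro h β
    rw [lmA_pow_apply, jA_y, map_mul, phB_y, if_neg (by omega), (Br_odd' h).mp h2]; simp [mul_assoc]
  · intro h β
    rw [lmA_pow_apply, jA_y, map_mul, phB_y, if_pos h]
  · intro h β
    rw [lmA_pow_apply, jA_y, map_mul, phB_y, if_pos h, ← mul_assoc, (Br_even' h).mp h2, mul_assoc]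
  · intro h β
    rw [lmA_pow_apply, jA_z, map_mul, phB_z, if_neg (by omega)]; simp [mul_assoc]
  · intro h β
    rw [lmA_pow_apply, jA_z, map_mul, map_mul, map_mul, phB_z, phB_g, if_neg (by omega),
      (Br_odd h).mp h3]; simp [mul_assoc]
  · intro h β
    rw [lmA_pow_apply, jA_z, map_mul, phB_z, if_pos h]; simp [mul_assoc]
  · intro h β
    rw [lmA_pow_apply, jA_z, map_mul, phB_z, if_pos h]
    have := (Br_even' h).mp h3
    have h4 : (a * c) ^ (P / 2) = c⁻¹ * ((a * c) ^ (P/2) * c) := by rw [this]; group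
    generalize (a * c) ^ (P / 2) = t at *
    conv_lhs => rw [h4]
    simp [mul_assoc]

lemma jA_i (h1 : Br a b M) (h2 : Br b c N) (h3 : Br c a P) (w : CC M N P) :
    jA a b c (iC M N P w) = phB M N P a b c w := by
  have := tri_i (tri_group a b c h1 h2 h3) w 1
  simpa [lmA_apply] using this

lemma conj_i (h1 : Br a b M) (h2 : Br b c N) (h3 : Br c a P) (w : CC M N P) :
    a * c * b * jA a b c (iC M N P w) = jA a b c (iC M N P (kC M N P w)) * (a * c * b) := by
  rw [jA_i a b c h1 h2 h3, jA_i a b c h1 h2 h3, kC_coe, map_mul, map_mul, map_inv, phB_g]; group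

lemma sq_i : a * c * b * (a * c * b) = jA a b c (iC M N P (uC M N P)) := by
  rw [iC_u, map_mul, map_mul, jA_x, jA_y, jA_z]; group

/-- the converse: recovering the braid relations -/
lemma br_of_conj (a b c : H) (h : ∀ w : CC M N P,
    a * c * b * jA a b c (iC M N P w) = jA a b c (iC M N P (kC M N P w)) * (a * c * b)) :
    Br a b M ∧ Br b c N ∧ Br c a P := by
  have hL : ∀ v : FB, ∀ hv : (Th M N P v).right = 1,
      a * c * b * jA a b c ((Th M N P v).left 1) = jA a b c ((Th M N P v).left (-1)) * (a * c * b) := by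
    intro v hv
    have := h ⟨v, hv⟩
    rwa [iC_k] at this
  refine ⟨?_, ?_, ?_⟩
  · rcases Nat.mod_two_eq_zero_or_one M with hM | hM
    · have h1 := hL fx (by rw [Th_x0 hM]; rfl)
      rw [Th_x0 hM, Br_even hM] at *
      simp [wr, jA_x, jA_z, mul_assoc] at h1 ⊢
      exact h1.symm
    · have h1 := hL (fG⁻¹ * fx) (by rw [map_mul, map_inv, Th_g, Th_x1 hM]; rfl)
      rw [map_mul, map_inv, Th_x1 hM, Th_g, Br_odd hM] at *
      simp [wr, jA_x, jA_y, jA_z, mul_assoc] at h1 ⊢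
      rw [← h1, mul_inv_cancel_left]
  · rcases Nat.mod_two_eq_zero_or_one N with hM | hM
    · have h1 := hL fy (by rw [Th_y0 hM]; rfl)
      rw [Th_y0 hM, Br_even' hM] at *
      simp [wr, jA_y, jA_z, mul_assoc] at h1 ⊢
      exact h1.symm
    · have h1 := hL (fG⁻¹ * fy) (by rw [map_mul, map_inv, Th_g, Th_y1 hM]; rfl)
      rw [map_mul, map_inv, Th_y1 hM, Th_g, Br_odd' hM] at *
      simp [wr, jA_x, jA_y, jA_z, mul_assoc] at h1 ⊢
      rw [← h1, mul_inv_cancel_left]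
  · rcases Nat.mod_two_eq_zero_or_one P with hM | hM
    · have h1 := hL fz (by rw [Th_z0 hM]; rfl)
      rw [Th_z0 hM, Br_even hM] at *
      simp [wr, jA_y, jA_z, mul_assoc] at h1 ⊢
      rw [← mul_assoc, ← mul_assoc _ a, mul_left_inj] at h1; exact h1.symm
    · have h1 := hL fz (by rw [Th_z1 hM]; rfl)
      rw [Th_z1 hM, Br_odd hM] at *
      simp [wr, jA_x, jA_y, jA_z, mul_assoc] at h1 ⊢
      rw [← mul_assoc, h1, inv_mul_cancel_right]
end

section
variable {M N P : ℕ}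

lemma artin_univ (H : Type) [Group H] (f : FA →* H) (h : H) (h2 : h * h = f (iC M N P (uC M N P)))
    (hc : ∀ w, h * f (iC M N P w) = f (iC M N P (kC M N P w)) * h) :
    ∃ F : Artin3 M N P →* H,
      (∀ w, F (jA (ga M N P) (gb M N P) (gc M N P) w) = f w) ∧
      F (ga M N P * gc M N P * gb M N P) = h := by
  obtain ⟨b, hb⟩ : ∃ b, b = (f fZ)⁻¹ * h := ⟨_, rfl⟩
  obtain ⟨a, ha⟩ : ∃ a, a = b⁻¹ * f fX := ⟨_, rfl⟩
  obtain ⟨c, hc'⟩ : ∃ c, c = f fY * b⁻¹ := ⟨_, rfl⟩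
  have hx : f fX = b * a := by rw [ha]; group
  have hy : f fY = c * b := by rw [hc']; group
  have hz' : f fZ = h * b⁻¹ := by rw [hb]; group
  rw [iC_u, map_mul, map_mul] at h2
  have hz : f fZ = a * c := by
    rw [ha, hc']
    have h3 : f fX * f fY = (f fZ)⁻¹ * (h * h) := by rw [h2]; group
    have h4 : b⁻¹ * f fX * (f fY * b⁻¹) = b⁻¹ * (f fX * f fY) * b⁻¹ := by group
    rw [h4, h3, hz']; group
  have hh : h = a * c * b := by rw [← hz, hb]; group
  have hf : f = jA a b c := by
    ext k
    fin_cases k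
    · exact hx.trans (jA_x a b c).symm
    · exact hy.trans (jA_y a b c).symm
    · exact hz.trans (jA_z a b c).symm
  obtain ⟨r1, r2, r3⟩ := br_of_conj (M := M) (N := N) (P := P) a b c (by
    intro w
    rw [← hf, ← hh]; exact hc w)
  obtain ⟨F, f1, f2, f3⟩ := artin_lift a b c r1 r2 r3
  refine ⟨F, ?_, by rw [map_mul, map_mul, f1, f2, f3, hh]⟩
  intro w
  have : F.comp (jA (ga M N P) (gb M N P) (gc M N P)) = f := by
    rw [hf]
    ext k
    fin_cases k
    · change F (jA _ _ _ fX) = jA _ _ _ fX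
      rw [jA_x, jA_x, map_mul, f1, f2]
    · change F (jA _ _ _ fY) = jA _ _ _ fY
      rw [jA_y, jA_y, map_mul, f2, f3]
    · change F (jA _ _ _ fZ) = jA _ _ _ fZ
      rw [jA_z, jA_z, map_mul, f1, f3]
  rw [← this]; rfl

lemma artin_gen (γ : Artin3 M N P) : ∃ (a0 : FA) (l : List FA),
    γ = jA (ga M N P) (gb M N P) (gc M N P) a0 *
      (l.map (fun w => (ga M N P * gc M N P * gb M N P) *
        jA (ga M N P) (gb M N P) (gc M N P) w)).prod := by
  set j := jA (ga M N P) (gb M N P) (gc M N P) with hj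
  set g := ga M N P * gc M N P * gb M N P with hg
  let S : Set (Artin3 M N P) := {γ | ∃ (a0 : FA) (l : List FA), γ = j a0 * (l.map (fun w => g * j w)).prod}
  change γ ∈ S
  have s1 : ∀ (w : FA) (γ), γ ∈ S → j w * γ ∈ S := by
    rintro w γ ⟨a0, l, rfl⟩
    exact ⟨w * a0, l, by simp [mul_assoc]⟩
  have s2 : ∀ γ, γ ∈ S → g * γ ∈ S := by
    rintro γ ⟨a0, l, rfl⟩
    exact ⟨1, a0 :: l, by simp [mul_assoc]⟩
  have hu : g * g = j (fZ * fX * fY) := by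
    have := sq_i (M := M) (N := N) (P := P) (ga M N P) (gb M N P) (gc M N P)
    rw [iC_u] at this; exact this
  have s3 : ∀ γ, γ ∈ S → g⁻¹ * γ ∈ S := by
    intro γ h
    have : g⁻¹ = j ((fZ * fX * fY)⁻¹) * g := by rw [map_inv, ← hu]; group
    rw [this, mul_assoc]
    exact s1 _ _ (s2 _ h)
  have eb : gb M N P = j fZ⁻¹ * g := by rw [map_inv, hj, jA_z, hg]; group
  have ebi : (gb M N P)⁻¹ = g⁻¹ * j fZ := by rw [hj, jA_z, hg]; group
  have sb : ∀ γ, γ ∈ S → gb M N P * γ ∈ S := fun γ h => by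
    rw [eb, mul_assoc]; exact s1 _ _ (s2 _ h)
  have sbi : ∀ γ, γ ∈ S → (gb M N P)⁻¹ * γ ∈ S := fun γ h => by
    rw [ebi, mul_assoc]; exact s3 _ (s1 _ _ h)
  have ea : ga M N P = (gb M N P)⁻¹ * j fX := by rw [hj, jA_x]; group
  have ec : gc M N P = j fY * (gb M N P)⁻¹ := by rw [hj, jA_y]; group
  have eai : (ga M N P)⁻¹ = j fX⁻¹ * gb M N P := by rw [map_inv, hj, jA_x]; group
  have eci : (gc M N P)⁻¹ = gb M N P * j fY⁻¹ := by rw [map_inv, hj, jA_y]; group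
  have hγ : γ ∈ Subgroup.closure {ga M N P, gb M N P, gc M N P} := by
    rw [artin_closure]; trivial
  induction hγ using Subgroup.closure_induction_left with
  | one => exact ⟨1, [], by simp⟩
  | mul_left x hx y _ ih =>
    simp only [Set.mem_insert_iff, Set.mem_singleton_iff] at hx
    rcases hx with rfl | rfl | rfl
    · rw [ea, mul_assoc]; exact sbi _ (s1 _ _ ih)
    · exact sb _ ih
    · rw [ec, mul_assoc]; exact s1 _ _ (sbi _ ih)
  | inv_mul_cancel x hx y _ ih =>
    simp only [Set.mem_insert_iff, Set.mem_singleton_iff] at hx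
    rcases hx with rfl | rfl | rfl
    · rw [eai, mul_assoc]; exact s1 _ _ (sb _ ih)
    · exact sbi _ ih
    · rw [eci, mul_assoc]; exact sb _ (s1 _ _ ih)

theorem theoremY (A0 : Subgroup FA) [A0.Normal] [A0.FiniteIndex] (r : A0 →* CC M N P)
    (hr : ∀ a, iC M N P (r a) ∈ A0) (hri : ∀ c (h : iC M N P c ∈ A0), r ⟨iC M N P c, h⟩ = c)
    (hκ : ∀ c, iC M N P c ∈ A0 → iC M N P (kC M N P c) ∈ A0) :
    ResiduallyFinite (Artin3 M N P) := by
  have : Group.FG FA := inferInstance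
  exact theoremX (iC M N P) (kC M N P) (uC M N P) (jA (ga M N P) (gb M N P) (gc M N P))
    (ga M N P * gc M N P * gb M N P) kC_k kC_u (sq_i _ _ _)
    (conj_i _ _ _ artin_ab artin_bc artin_ca)
    (fun H _ f h h2 hc => artin_univ H f h h2 hc) artin_gen A0 r hr hri hκ
    (fun a ha => freeGroup_rf a ha)
end

section
variable {B T : Type*} [Group B] [Group T] (π : B →* T)

lemma exists_sec : ∃ s : T → B, s 1 = 1 ∧ ∀ t ∈ π.range, π (s t) = t := by
  classical
  refine ⟨fun t => if h : t ≠ 1 ∧ t ∈ π.range then h.2.choose else 1, by simp, ?_⟩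
  intro t ht
  by_cases h : t = 1
  · subst h; simp
  · simp only [ne_eq, h, not_false_eq_true, ht, and_self, dite_true]
    exact Exists.choose_spec (p := fun x => π x = t) ht

open Classical in
/-- the cocycle -/
noncomputable def coc (s : T → B) (hs : ∀ t ∈ π.range, π (s t) = t) (m : Fin 3 → T)
    (val : Fin 3 → B) (t : T) : π.ker :=
  if h : ∃ τ, (m τ)⁻¹ * t ∈ π.range then
    ⟨(s (π (val h.choose) * ((m h.choose)⁻¹ * t)))⁻¹ * val h.choose * s ((m h.choose)⁻¹ * t), by
      have h1 := h.choose_spec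
      rw [MonoidHom.mem_ker, map_mul, map_mul, map_inv, hs _ h1,
        hs _ (mul_mem ⟨_, rfl⟩ h1)]
      group⟩
  else 1

variable (s : T → B) (hs : ∀ t ∈ π.range, π (s t) = t) (m : Fin 3 → T)

lemma coc_of_not {val : Fin 3 → B} {t : T} (h : ∀ τ, (m τ)⁻¹ * t ∉ π.range) :
    coc π s hs m val t = 1 := by
  rw [coc, dif_neg]; push Not; exact h

lemma coc_of {val : Fin 3 → B} {t : T} (hm : ∀ τ τ', (m τ)⁻¹ * m τ' ∈ π.range → τ = τ')
    (τ : Fin 3) (h : (m τ)⁻¹ * t ∈ π.range) :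
    (coc π s hs m val t : B) = (s (π (val τ) * ((m τ)⁻¹ * t)))⁻¹ * val τ * s ((m τ)⁻¹ * t) := by
  have h0 : ∃ τ, (m τ)⁻¹ * t ∈ π.range := ⟨τ, h⟩
  have h1 : h0.choose = τ := by
    apply hm
    have := mul_mem h0.choose_spec (inv_mem h)
    have e : (m h0.choose)⁻¹ * t * ((m τ)⁻¹ * t)⁻¹ = (m h0.choose)⁻¹ * m τ := by group
    rwa [e] at this
  rw [coc, dif_pos h0]
  simp only [h1]

/-- the permutation attached to a letter -/
noncomputable def cE (L : T) (val : Fin 3 → B) : Equiv.Perm (T × π.ker) where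
  toFun x := (L * x.1, coc π s hs m val x.1 * x.2)
  invFun x := (L⁻¹ * x.1, (coc π s hs m val (L⁻¹ * x.1))⁻¹ * x.2)
  left_inv x := by simp
  right_inv x := by simp

lemma cE_apply (L : T) (val : Fin 3 → B) (x : T × π.ker) :
    cE π s hs m L val x = (L * x.1, coc π s hs m val x.1 * x.2) := rfl

/-- the points -/
noncomputable def cpt (τ : Fin 3) (β : B) : T × π.ker :=
  (m τ * π β, ⟨(s (π β))⁻¹ * β, by
    rw [MonoidHom.mem_ker, map_mul, map_inv, hs _ ⟨_, rfl⟩, inv_mul_cancel]⟩)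

lemma cE_arc (hm : ∀ τ τ', (m τ)⁻¹ * m τ' ∈ π.range → τ = τ') (L : T) (val : Fin 3 → B)
    (τ τ' : Fin 3) (d : ℕ) (hd : 0 < d) (h : L ^ d * m τ = m τ' * π (val τ))
    (hn : ∀ i, 0 < i → i < d → ∀ σ, (m σ)⁻¹ * (L ^ i * m τ) ∉ π.range) (β : B) :
    (cE π s hs m L val ^ d) (cpt π s hs m τ β) = cpt π s hs m τ' (val τ * β) := by
  have key : ∀ i, i + 1 ≤ d → (cE π s hs m L val ^ (i + 1)) (cpt π s hs m τ β) =
      (L ^ (i + 1) * (m τ * π β), coc π s hs m val (m τ * π β) * (cpt π s hs m τ β).2) := by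
    intro i
    induction i with
    | zero => intro _; rw [zero_add, pow_one, pow_one]; rfl
    | succ i ih =>
      intro hi
      rw [pow_succ', Equiv.Perm.mul_apply, ih (by omega), cE_apply]
      have hc : coc π s hs m val (L ^ (i + 1) * (m τ * π β)) = 1 := by
        apply coc_of_not
        intro σ hσ
        apply hn (i + 1) (by omega) (by omega) σ
        have := mul_mem hσ (inv_mem (⟨β, rfl⟩ : π β ∈ π.range))
        convert this using 1
        group
      simp only [hc]
      simp [pow_succ' _ (i+1), mul_assoc]
  obtain ⟨e, rfl⟩ : ∃ e, d = e + 1 := ⟨d - 1, by omega⟩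
  rw [key e le_rfl]
  apply Prod.ext
  · simp only [cpt]
    rw [← mul_assoc, h, map_mul, mul_assoc]
  · apply Subtype.ext
    have h0 : (m τ)⁻¹ * (m τ * π β) ∈ π.range := by rw [inv_mul_cancel_left]; exact ⟨_, rfl⟩
    simp only [Subgroup.coe_mul, coc_of π s hs m hm τ h0, cpt, inv_mul_cancel_left, map_mul]
    group

/-- the action of A -/
noncomputable def cpsi (L : Fin 3 → T) (val : Fin 3 → Fin 3 → B) : FA →* Equiv.Perm (T × π.ker) :=
  FreeGroup.lift (fun k => cE π s hs m (L k) (val k))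

lemma cpsi_apply (L : Fin 3 → T) (val : Fin 3 → Fin 3 → B) (w : FA) : ∀ (t : T) (ν : π.ker),
    cpsi π s hs m L val w (t, ν) =
      (FreeGroup.lift L w * t, (cpsi π s hs m L val w (t, 1)).2 * ν) := by
  induction w using FreeGroup.induction_on with
  | C1 => intro t ν; simp
  | of k => intro t ν; simp [cpsi, cE_apply]
  | inv_of k hk =>
    intro t ν
    simp only [cpsi, map_inv, FreeGroup.lift_apply_of]
    simp [cE, Equiv.Perm.inv_def, Equiv.symm]
  | mul x y hx hy =>
    intro t ν
    simp only [map_mul, Equiv.Perm.mul_apply]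
    rw [hy, hx, hy t 1]
    rw [hx _ (_ * 1)]
    simp [mul_assoc]

theorem retr_exists (L : Fin 3 → T) (val : Fin 3 → Fin 3 → B) :
    ∃ r : (FreeGroup.lift L).ker →* π.ker,
      ∀ a : (FreeGroup.lift L).ker, cpsi π s hs m L val a (1, 1) = (1, r a) := by
  have h0 : ∀ a : (FreeGroup.lift L).ker,
      cpsi π s hs m L val a (1, 1) = (1, (cpsi π s hs m L val a (1, 1)).2) := by
    intro a
    have := cpsi_apply π s hs m L val a 1 1
    rw [a.2, one_mul, mul_one] at this
    exact this
  refine ⟨MonoidHom.mk' (fun a => (cpsi π s hs m L val a (1, 1)).2) ?_, h0⟩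
  intro a b
  rw [Subgroup.coe_mul, map_mul, Equiv.Perm.mul_apply, h0 b, cpsi_apply]
end

/-- the first-return condition for a dihedral pair -/
def Ret {F : Type*} (x : Equiv.Perm F) (p q r : F) (M : ℕ) : Prop :=
  (M % 2 = 1 → (x ^ (M/2)) q = p ∧ ∀ i, 0 < i → i < M/2 →
    ((x ^ i) p ≠ p ∧ (x ^ i) p ≠ q ∧ (x ^ i) p ≠ r) ∧
    ((x ^ i) q ≠ p ∧ (x ^ i) q ≠ q ∧ (x ^ i) q ≠ r)) ∧
  (M % 2 = 0 → (x ^ (M/2)) p = p ∧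
    (∀ i, 0 < i → i < M/2 → ((x ^ i) p ≠ p ∧ (x ^ i) p ≠ q ∧ (x ^ i) p ≠ r)) ∧
    (∀ i, 0 < i → i < M/2 - 1 → ((x ^ i) q ≠ p ∧ (x ^ i) q ≠ q ∧ (x ^ i) q ≠ r)))

/-- the values of the cocycle -/
def vals (M P : ℕ) : Fin 3 → Fin 3 → FB :=
  ![![if M % 2 = 1 then fG⁻¹ * fx else fx, if M % 2 = 1 then fx else fG⁻¹ * fx, fG],
    ![1, fy, fy],
    ![if P % 2 = 1 then fz else fz * fG⁻¹, fG, if P % 2 = 1 then fz * fG else fz]]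

lemma par_of_ker {F : Type*} {M N P : ℕ} (a b c : Equiv.Perm F) (w : FB) :
    (phB M N P (a, (-1 : ℤˣ)) (b, -1) (c, -1) w).2 = par M N P w := by
  have : (MonoidHom.snd _ _).comp (phB M N P (a, (-1 : ℤˣ)) (b, -1) (c, -1)) = par M N P := by
    apply FreeGroup.ext_hom
    intro k
    fin_cases k
    · change (phB M N P (a, (-1 : ℤˣ)) (b, -1) (c, -1) fG).2 = par M N P fG
      rw [phB_g, par_eq, Th_g]; rfl
    · change (phB M N P (a, (-1 : ℤˣ)) (b, -1) (c, -1) fx).2 = par M N P fx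
      rw [phB_x, par_eq]
      rcases Nat.mod_two_eq_zero_or_one M with hM | hM
      · rw [Th_x0 hM, if_pos hM]; simp [wr]
      · rw [Th_x1 hM, if_neg (by omega)]; simp [wr]
    · change (phB M N P (a, (-1 : ℤˣ)) (b, -1) (c, -1) fy).2 = par M N P fy
      rw [phB_y, par_eq]
      rcases Nat.mod_two_eq_zero_or_one N with hM | hM
      · rw [Th_y0 hM, if_pos hM]; simp [wr]
      · rw [Th_y1 hM, if_neg (by omega)]; simp [wr]
    · change (phB M N P (a, (-1 : ℤˣ)) (b, -1) (c, -1) fz).2 = par M N P fz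
      rw [phB_z, par_eq]
      rcases Nat.mod_two_eq_zero_or_one P with hM | hM
      · rw [Th_z0 hM, if_pos hM]; simp [wr]
      · rw [Th_z1 hM, if_neg (by omega)]; simp [wr]
  exact DFunLike.congr_fun this w

lemma Br_prod {F : Type*} {M : ℕ} {a b : Equiv.Perm F} (h : Br a b M) :
    Br (a, (-1 : ℤˣ)) (b, -1) M := by
  unfold Br at *
  split_ifs at * with h0 <;> apply Prod.ext
  · simpa using h
  · simp
  · simpa using h
  · simp

section
variable {H : Type*} [Group H] {M : ℕ} {a b : H}
lemma ev1 (h : Br a b M) (hM : M % 2 = 0) (hM4 : 4 ≤ M) :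
    (b * a) ^ (M/2 - 1) * b = a⁻¹ * (b * a) ^ (M/2) := by
  have h1 := (Br_even' hM).mp h
  obtain ⟨k, hk⟩ : ∃ k, M / 2 = k + 1 := ⟨M/2 - 1, by omega⟩
  rw [hk] at h1 ⊢
  rw [eq_inv_mul_iff_mul_eq, Nat.add_sub_cancel]
  rw [pow_succ] at h1
  have : (b * a) ^ k * b * a * a = a * ((b * a) ^ k * b) * a := by
    simpa [mul_assoc] using h1
  rw [mul_left_inj] at this
  rw [← this, pow_succ, mul_assoc]
lemma od1 (h : Br a b M) (hM : M % 2 = 1) :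
    a * (b * a) ^ (M/2) = (b * a) ^ (M/2) * b := by
  have h1 := (Br_odd' hM).mp h
  rw [pow_succ, ← mul_assoc, mul_left_inj] at h1; exact h1.symm
lemma od2 (h : Br a b M) (hM : M % 2 = 1) :
    b * (b * a) ^ (M/2) * b = (b * a) ^ (M/2) * b * a := by
  rw [← (Br_odd hM).mp h, pow_succ, mul_assoc]
end

theorem good_rf {F : Type*} [Finite F] {M N P : ℕ} (hM : 4 ≤ M) (hN : 4 ≤ N) (hP : 4 ≤ P)
    (a b c : Equiv.Perm F) (h1 : Br a b M) (h2 : Br b c N) (h3 : Br c a P)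
    (p q r : F) (hpq : p ≠ q) (hqr : q ≠ r) (hpr : p ≠ r) (hb : b p = q) (hc : c q = r) (ha : a r = p)
    (r1 : Ret (b * a) p q r M) (r2 : Ret (c * b) q r p N) (r3 : Ret (a * c) r p q P) :
    ResiduallyFinite (Artin3 M N P) := by
  set A : Equiv.Perm F × ℤˣ := (a, -1) with hA
  set B : Equiv.Perm F × ℤˣ := (b, -1) with hB
  set C : Equiv.Perm F × ℤˣ := (c, -1) with hC
  have H1 : Br A B M := Br_prod h1
  have H2 : Br B C N := Br_prod h2
  have H3 : Br C A P := Br_prod h3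
  set π := phB M N P A B C with hπ
  -- the range fixes p
  have hb' : b.symm q = p := by rw [Equiv.symm_apply_eq, hb]
  have fixp : ∀ t ∈ π.range, t.1 p = p := by
    rintro _ ⟨w, rfl⟩
    have key : ∀ k : Fin 4, (π (FreeGroup.of k)).1 p = p := by
      intro k
      fin_cases k
      · change (π fG).1 p = p
        rw [hπ, phB_g]; simp [hA, hB, hC, hb, hc, ha]
      · change (π fx).1 p = p
        rw [hπ, phB_x]
        rcases Nat.mod_two_eq_zero_or_one M with h | h
        · rw [if_pos h]; simpa [hA, hB] using (r1.2 h).1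
        · rw [if_neg (by omega)]; simpa [hA, hB, hb] using (r1.1 h).1
      · change (π fy).1 p = p
        rw [hπ, phB_y]
        rcases Nat.mod_two_eq_zero_or_one N with h | h
        · rw [if_pos h]
          have e1 := (Br_even' h).mp h2
          have e2 := (r2.2 h).1
          have e3 := congrArg (fun f => f p) e1
          simp only [Equiv.Perm.mul_apply, hb, e2] at e3
          simpa [hC, hB] using (b.injective (e3.symm.trans hb.symm))
        · rw [if_neg (by omega)]
          have e1 := od1 h2 h
          have e2 := (r2.1 h).1
          have e3 := congrArg (fun f => f q) e1
          simp only [Equiv.Perm.mul_apply, hc, e2] at e3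
          simpa [hC, hB, hb] using (b.injective (e3.trans hb.symm))
      · change (π fz).1 p = p
        rw [hπ, phB_z]
        rcases Nat.mod_two_eq_zero_or_one P with h | h
        · rw [if_pos h]
          have e2 := (r3.2 h).1
          simp [hA, hB, hC, hb, hc, e2, Equiv.symm_apply_eq]
        · rw [if_neg (by omega)]
          have e2 := (r3.1 h).1
          simp [hA, hB, hC, hb, hc, e2, Equiv.symm_apply_eq]
    induction w using FreeGroup.induction_on with
    | C1 => simp
    | of k => exact key k
    | inv_of k hk =>
      rw [map_inv]; simp only [Prod.fst_inv, Equiv.Perm.inv_def]; rw [Equiv.symm_apply_eq, key k]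
    | mul x y hx hy => rw [map_mul]; simp [hx, hy]
  set m : Fin 3 → Equiv.Perm F × ℤˣ := ![1, B, C * B] with hm
  set pt : Fin 3 → F := ![p, q, r] with hpt
  have mp : ∀ τ, (m τ).1 p = pt τ := by
    intro τ; fin_cases τ <;> simp [hm, hpt, hB, hC, hb, hc]
  have ptinj : ∀ τ τ', pt τ = pt τ' → τ = τ' := by
    intro τ τ' h
    fin_cases τ <;> fin_cases τ' <;> simp [hpt] at h ⊢ <;>
      first | exact hpq h | exact hpr h | exact hqr h | exact hpq h.symm | exact hpr h.symm | exact hqr h.symm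
  have memS : ∀ τ t, (m τ)⁻¹ * t ∈ π.range → t.1 p = pt τ := by
    intro τ t h
    have := fixp _ h
    simp only [Prod.fst_mul, Prod.fst_inv, Equiv.Perm.mul_apply, Equiv.Perm.inv_def] at this
    rw [Equiv.symm_apply_eq, mp] at this
    exact this
  have hmu : ∀ τ τ', (m τ)⁻¹ * m τ' ∈ π.range → τ = τ' := by
    intro τ τ' h
    have := memS _ _ h
    rw [mp] at this
    exact ptinj _ _ this.symm
  obtain ⟨s, s1, hs⟩ := exists_sec π
  set L : Fin 3 → Equiv.Perm F × ℤˣ := ![B * A, C * B, A * C] with hL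
  have hjA : jA A B C = FreeGroup.lift L := rfl
  have arc : ∀ (k τ τ' : Fin 3) (d : ℕ) (v : FB), v = vals M P k τ → 0 < d →
      (L k ^ d * m τ = m τ' * π v) →
      (∀ i, 0 < i → i < d → ∀ σ, ((L k).1 ^ i) (pt τ) ≠ pt σ) → ∀ β,
      (cE π s hs m (L k) (vals M P k) ^ d) (cpt π s hs m τ β) = cpt π s hs m τ' (v * β) := by
    rintro k τ τ' d v rfl hd h hn β
    refine cE_arc π s hs m hmu _ _ τ τ' d hd h ?_ β
    intro i hi hid σ hσ
    have := memS _ _ hσ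
    apply hn i hi hid σ
    simpa [mp] using this
  have p3 : ∀ f : F, (∀ σ, f ≠ pt σ) ↔ f ≠ p ∧ f ≠ q ∧ f ≠ r := by
    intro f; rw [Fin.forall_fin_succ, Fin.forall_fin_succ, Fin.forall_fin_succ]; simp [hpt]
  have triv : ∀ (k τ : Fin 3), ∀ i, 0 < i → i < 1 → ∀ σ, ((L k).1 ^ i) (pt τ) ≠ pt σ := by
    intro k τ i; omega
  set ψ := cpsi π s hs m L (vals M P) with hψ
  have ψX : ψ fX = cE π s hs m (L 0) (vals M P 0) := by simp [hψ, cpsi, fX]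
  have ψY : ψ fY = cE π s hs m (L 1) (vals M P 1) := by simp [hψ, cpsi, fY]
  have ψZ : ψ fZ = cE π s hs m (L 2) (vals M P 2) := by simp [hψ, cpsi, fZ]
  have L0 : L 0 = B * A := rfl
  have L1 : L 1 = C * B := rfl
  have L2 : L 2 = A * C := rfl
  have m0 : m 0 = 1 := rfl
  have m1 : m 1 = B := rfl
  have m2 : m 2 = C * B := rfl
  have v0 : pt 0 = p := rfl
  have v1 : pt 1 = q := rfl
  have v2 : pt 2 = r := rfl
  -- letter x
  have xRQ : ∀ β, ψ fX (cpt π s hs m 2 β) = cpt π s hs m 1 (fG * β) := by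
    intro β
    have := arc 0 2 1 1 fG rfl one_pos (by
      rw [L0, m2, m1, hπ, phB_g]; group) (triv _ _) β
    rwa [pow_one, ← ψX] at this
  have xQP1 : M % 2 = 1 → ∀ β, (ψ fX ^ (M/2)) (cpt π s hs m 1 β) = cpt π s hs m 0 (fx * β) := by
    intro h β
    rw [ψX]
    refine arc 0 1 0 (M/2) fx (by simp [vals, h]) (by omega) ?_ ?_ β
    · rw [L0, m0, m1, hπ, phB_x, if_neg (by omega), one_mul]
    · intro i hi hid
      rw [p3, v1, L0]; exact ((r1.1 h).2 i hi hid).2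
  have xPR1 : M % 2 = 1 → ∀ β, (ψ fX ^ (M/2)) (cpt π s hs m 0 β) =
      cpt π s hs m 2 (fG⁻¹ * fx * β) := by
    intro h β
    rw [ψX]
    refine arc 0 0 2 (M/2) (fG⁻¹ * fx) (by simp [vals, h]) (by omega) ?_ ?_ β
    · rw [L0, m0, m2, hπ, map_mul, map_inv, phB_x, phB_g, if_neg (by omega), ← od1 H1 h]
      group
    · intro i hi hid
      rw [p3, v0, L0]; exact ((r1.1 h).2 i hi hid).1
  have xQR0 : M % 2 = 0 → ∀ β, (ψ fX ^ (M/2 - 1)) (cpt π s hs m 1 β) =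
      cpt π s hs m 2 (fG⁻¹ * fx * β) := by
    intro h β
    rw [ψX]
    refine arc 0 1 2 (M/2-1) (fG⁻¹ * fx) (by simp [vals, h]) (by omega) ?_ ?_ β
    · rw [L0, m1, m2, hπ, map_mul, map_inv, phB_x, phB_g, if_pos (by omega), ev1 H1 h hM]
      group
    · intro i hi hid
      rw [p3, v1, L0]; exact (r1.2 h).2.2 i hi hid
  have xPP0 : M % 2 = 0 → ∀ β, (ψ fX ^ (M/2)) (cpt π s hs m 0 β) = cpt π s hs m 0 (fx * β) := by
    intro h β
    rw [ψX]
    refine arc 0 0 0 (M/2) fx (by simp [vals, h]) (by omega) ?_ ?_ β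
    · rw [L0, m0, hπ, phB_x, if_pos h]; group
    · intro i hi hid
      rw [p3, v0, L0]; exact (r1.2 h).2.1 i hi hid
  -- letter y
  have yPR : ∀ β, ψ fY (cpt π s hs m 0 β) = cpt π s hs m 2 β := by
    intro β
    have := arc 1 0 2 1 1 rfl one_pos (by
      rw [L1, m2, m0, map_one]; group) (triv _ _) β
    rwa [pow_one, ← ψY, one_mul] at this
  have yRQ1 : N % 2 = 1 → ∀ β, (ψ fY ^ (N/2)) (cpt π s hs m 2 β) = cpt π s hs m 1 (fy * β) := by
    intro h β
    rw [ψY]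
    refine arc 1 2 1 (N/2) fy (by simp [vals]) (by omega) ?_ ?_ β
    · rw [L1, m2, m1, hπ, phB_y, if_neg (by omega), ← mul_assoc, ← od1 H2 h, mul_assoc]
    · intro i hi hid
      have := ((r2.1 h).2 i hi hid).2
      rw [p3, v2, L1]; exact ⟨this.2.2, this.1, this.2.1⟩
  have yQP1 : N % 2 = 1 → ∀ β, (ψ fY ^ (N/2)) (cpt π s hs m 1 β) = cpt π s hs m 0 (fy * β) := by
    intro h β
    rw [ψY]
    refine arc 1 1 0 (N/2) fy (by simp [vals]) (by omega) ?_ ?_ β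
    · rw [L1, m0, m1, hπ, phB_y, if_neg (by omega), one_mul]
    · intro i hi hid
      have := ((r2.1 h).2 i hi hid).1
      rw [p3, v1, L1]; exact ⟨this.2.2, this.1, this.2.1⟩
  have yRP0 : N % 2 = 0 → ∀ β, (ψ fY ^ (N/2-1)) (cpt π s hs m 2 β) = cpt π s hs m 0 (fy * β) := by
    intro h β
    rw [ψY]
    refine arc 1 2 0 (N/2-1) fy (by simp [vals]) (by omega) ?_ ?_ β
    · rw [L1, m2, m0, hπ, phB_y, if_pos (by omega), ← pow_succ, one_mul]
      congr 1; omega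
    · intro i hi hid
      have := (r2.2 h).2.2 i hi hid
      rw [p3, v2, L1]; exact ⟨this.2.2, this.1, this.2.1⟩
  have yQQ0 : N % 2 = 0 → ∀ β, (ψ fY ^ (N/2)) (cpt π s hs m 1 β) = cpt π s hs m 1 (fy * β) := by
    intro h β
    rw [ψY]
    refine arc 1 1 1 (N/2) fy (by simp [vals]) (by omega) ?_ ?_ β
    · rw [L1, m1, hπ, phB_y, if_pos (by omega), (Br_even' h).mp H2]
    · intro i hi hid
      have := (r2.2 h).2.1 i hi hid
      rw [p3, v1, L1]; exact ⟨this.2.2, this.1, this.2.1⟩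
  -- letter z
  have zQP : ∀ β, ψ fZ (cpt π s hs m 1 β) = cpt π s hs m 0 (fG * β) := by
    intro β
    have := arc 2 1 0 1 fG rfl one_pos (by
      rw [L2, m1, m0, hπ, phB_g]; group) (triv _ _) β
    rwa [pow_one, ← ψZ] at this
  have zPR1 : P % 2 = 1 → ∀ β, (ψ fZ ^ (P/2)) (cpt π s hs m 0 β) = cpt π s hs m 2 (fz * β) := by
    intro h β
    rw [ψZ]
    refine arc 2 0 2 (P/2) fz (by simp [vals, h]) (by omega) ?_ ?_ β
    · rw [L2, m2, m0, hπ, phB_z, if_neg (by omega)]; group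
    · intro i hi hid
      have := ((r3.1 h).2 i hi hid).2
      rw [p3, v0, L2]; exact ⟨this.2.1, this.2.2, this.1⟩
  have zRQ1 : P % 2 = 1 → ∀ β, (ψ fZ ^ (P/2)) (cpt π s hs m 2 β) =
      cpt π s hs m 1 (fz * fG * β) := by
    intro h β
    rw [ψZ]
    refine arc 2 2 1 (P/2) (fz * fG) (by simp [vals, h]) (by omega) ?_ ?_ β
    · rw [L2, m2, m1, hπ, map_mul, phB_z, phB_g, if_neg (by omega)]
      have e := od1 H3 h
      have e' : (A * C) ^ (P/2) * C = C⁻¹ * ((A * C) ^ (P/2) * A * C) := by rw [← e]; group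
      rw [← mul_assoc, e']; group
    · intro i hi hid
      have := ((r3.1 h).2 i hi hid).1
      rw [p3, v2, L2]; exact ⟨this.2.1, this.2.2, this.1⟩
  have zPQ0 : P % 2 = 0 → ∀ β, (ψ fZ ^ (P/2-1)) (cpt π s hs m 0 β) =
      cpt π s hs m 1 (fz * fG⁻¹ * β) := by
    intro h β
    rw [ψZ]
    refine arc 2 0 1 (P/2-1) (fz * fG⁻¹) (by simp [vals, h]) (by omega) ?_ ?_ β
    · rw [L2, m0, m1, hπ, map_mul, map_inv, phB_z, phB_g, if_pos (by omega)]
      have e := ev1 H3 h hP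
      have e' : (A * C) ^ (P/2-1) = C⁻¹ * (A * C) ^ (P/2) * A⁻¹ := by rw [← e]; group
      rw [e']; group
    · intro i hi hid
      have := (r3.2 h).2.2 i hi hid
      rw [p3, v0, L2]; exact ⟨this.2.1, this.2.2, this.1⟩
  have zRR0 : P % 2 = 0 → ∀ β, (ψ fZ ^ (P/2)) (cpt π s hs m 2 β) = cpt π s hs m 2 (fz * β) := by
    intro h β
    rw [ψZ]
    refine arc 2 2 2 (P/2) fz (by simp [vals, h]) (by omega) ?_ ?_ β
    · rw [L2, m2, hπ, phB_z, if_pos (by omega)]; group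
    · intro i hi hid
      have := (r3.2 h).2.1 i hi hid
      rw [p3, v2, L2]; exact ⟨this.2.1, this.2.2, this.1⟩
  have tri : Tri M N P ψ (cpt π s hs m 0) (cpt π s hs m 1) (cpt π s hs m 2) := by
    refine ⟨yPR, xRQ, zQP, xQP1, ?_, xPP0, ?_, yQP1, ?_, ?_, yQQ0, zPR1, ?_, zRR0, ?_⟩
    · intro h β
      rw [pow_succ', Equiv.Perm.mul_apply, xPR1 h, xRQ]; simp [mul_assoc]
    · intro h β
      rw [show M / 2 = (M / 2 - 1) + 1 by omega, pow_succ', Equiv.Perm.mul_apply, xQR0 h, xRQ]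
      simp [mul_assoc]
    · intro h β
      rw [pow_succ, Equiv.Perm.mul_apply, yPR, yRQ1 h]
    · intro h β
      rw [show N / 2 = (N / 2 - 1) + 1 by omega, pow_succ, Equiv.Perm.mul_apply, yPR, yRP0 h]
    · intro h β
      rw [pow_succ', Equiv.Perm.mul_apply, zRQ1 h, zQP]; simp [mul_assoc]
    · intro h β
      rw [show P / 2 = (P / 2 - 1) + 1 by omega, pow_succ, Equiv.Perm.mul_apply, zQP, zPQ0 h]
      simp [mul_assoc]
  obtain ⟨ρ, hρ⟩ := retr_exists π s hs m L (vals M P)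
  have hle : π.ker ≤ CC M N P := by
    intro w hw
    change par M N P w = 1
    rw [← par_of_ker a b c w]
    have : π w = 1 := hw
    change (π w).2 = 1
    rw [this]; rfl
  have hmem : ∀ w : CC M N P, iC M N P w ∈ (FreeGroup.lift L).ker ↔ (w : FB) ∈ π.ker := by
    intro w
    rw [MonoidHom.mem_ker, ← hjA, jA_i A B C H1 H2 H3, MonoidHom.mem_ker]
  have : Finite (Equiv.Perm F × ℤˣ) := inferInstance
  have : (FreeGroup.lift L).ker.FiniteIndex := Subgroup.finiteIndex_ker _
  refine theoremY (FreeGroup.lift L).ker ((Subgroup.inclusion hle).comp ρ) ?_ ?_ ?_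
  · intro w
    rw [hmem]
    exact (ρ w).2
  · intro w hw
    apply Subtype.ext
    have e1 := hρ ⟨_, hw⟩
    have e2 := tri_i tri w 1
    have e3 : cpt π s hs m 0 1 = (1, 1) := by
      simp [cpt, m0, s1]
    have e4 : π (w : FB) = 1 := (hmem w).mp hw
    rw [e3] at e2
    change ψ _ _ = _ at e1
    simp only [] at e1
    rw [e2] at e1
    have e5 := congrArg (fun x => ((Prod.snd x : π.ker) : FB)) e1
    simp [cpt, e4, s1] at e5
    exact e5.symm
  · intro w hw
    rw [hmem] at hw ⊢
    rw [kC_coe]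
    exact (MonoidHom.normal_ker π).conj_mem _ hw _

lemma rf_transport {G H : Type*} [Group G] [Group H] (f : G →* H) (k : H →* G)
    (h : ∀ g, k (f g) = g) (hH : ResiduallyFinite H) : ResiduallyFinite G := by
  intro g hg
  have : f g ≠ 1 := fun h1 => hg (by rw [← h g, h1, map_one])
  obtain ⟨Q, i1, i2, φ, hφ⟩ := hH _ this
  exact ⟨Q, i1, i2, φ.comp f, hφ⟩

lemma artin_id {M N P : ℕ} (f : Artin3 M N P →* Artin3 M N P) (h1 : f (ga M N P) = ga M N P)
    (h2 : f (gb M N P) = gb M N P) (h3 : f (gc M N P) = gc M N P) (g : Artin3 M N P) : f g = g := by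
  have hs : Set.EqOn f (MonoidHom.id _) {ga M N P, gb M N P, gc M N P} := by
    rintro x (rfl | rfl | rfl) <;> assumption
  have := MonoidHom.eq_of_eqOn_dense (artin_closure (M := M) (N := N) (P := P)) hs
  rw [this]; rfl

lemma rf_rot {M N P : ℕ} (h : ResiduallyFinite (Artin3 N P M)) : ResiduallyFinite (Artin3 M N P) := by
  obtain ⟨F, f1, f2, f3⟩ := artin_lift (M := M) (N := N) (P := P) (gc N P M) (ga N P M) (gb N P M)
    artin_ca artin_ab artin_bc
  obtain ⟨K, k1, k2, k3⟩ := artin_lift (M := N) (N := P) (P := M) (gb M N P) (gc M N P) (ga M N P)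
    artin_bc artin_ca artin_ab
  exact rf_transport F K (artin_id (K.comp F) (by simp [f1, k3]) (by simp [f2, k1])
    (by simp [f3, k2])) h

lemma rf_swap {M N P : ℕ} (h : ResiduallyFinite (Artin3 M P N)) : ResiduallyFinite (Artin3 M N P) := by
  obtain ⟨F, f1, f2, f3⟩ := artin_lift (M := M) (N := N) (P := P) (gb M P N) (ga M P N) (gc M P N)
    artin_ab.symm artin_ca.symm artin_bc.symm
  obtain ⟨K, k1, k2, k3⟩ := artin_lift (M := M) (N := P) (P := N) (gb M N P) (ga M N P) (gc M N P)
    artin_ab.symm artin_ca.symm artin_bc.symm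
  exact rf_transport F K (artin_id (K.comp F) (by simp [f1, k2]) (by simp [f2, k1])
    (by simp [f3, k3])) h

lemma exists_field (k B : ℕ) (hk : k ≠ 0) : ∃ l : ℕ, l.Prime ∧ B < l ∧ ∃ ω : ZMod l, IsPrimitiveRoot ω k := by
  obtain ⟨l, hl, hB, hm⟩ := Nat.exists_prime_gt_modEq_one B hk
  refine ⟨l, hl, hB, ?_⟩
  have : Fact l.Prime := ⟨hl⟩
  have hd : k ∣ l - 1 := (Nat.modEq_iff_dvd' hl.one_lt.le).mp hm.symm
  obtain ⟨d, hd⟩ := hd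
  obtain ⟨g, hg⟩ := IsCyclic.exists_generator (α := (ZMod l)ˣ)
  have ho : orderOf g = l - 1 := by
    rw [orderOf_eq_card_of_forall_mem_zpowers hg, Nat.card_eq_fintype_card, ZMod.card_units]
  have h1 : IsPrimitiveRoot g (l - 1) := ho ▸ IsPrimitiveRoot.orderOf g
  have h2 : IsPrimitiveRoot (g ^ d) k := h1.pow (by have := hl.two_le; omega) (by rw [hd]; ring)
  exact ⟨((g ^ d : (ZMod l)ˣ) : ZMod l), IsPrimitiveRoot.coe_units_iff.mpr h2⟩

lemma exists_avoid {K ι : Type*} [Field K] [Fintype K] (I : Finset ι) (α β : ι → K)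
    (h : I.card < Fintype.card K) : ∃ t : K, ∀ x ∈ I, (α x ≠ 0 ∨ β x ≠ 0) → α x * t ≠ β x := by
  classical
  have : ∃ t, t ∉ I.image (fun x => β x / α x) := by
    by_contra! hc
    have h1 : I.image (fun x => β x / α x) = Finset.univ := Finset.eq_univ_iff_forall.mpr hc
    have h2 := Finset.card_image_le (s := I) (f := fun x => β x / α x)
    rw [h1, Finset.card_univ] at h2
    omega
  obtain ⟨t, ht⟩ := this
  refine ⟨t, fun x hx h0 he => ?_⟩
  by_cases hα : α x = 0
  · rw [hα, zero_mul] at he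
    exact h0.elim (fun h => h hα) (fun h => h he.symm)
  · apply ht
    rw [Finset.mem_image]
    exact ⟨x, hx, by rw [← he]; field_simp⟩

section
variable {K : Type*} [Field K]
/-- affine permutation -/
def affP (u : Kˣ) (v : K) : Equiv.Perm K where
  toFun w := u * w + v
  invFun w := (u⁻¹ : Kˣ) * (w - v)
  left_inv w := by simp
  right_inv w := by simp

lemma affP_apply (u : Kˣ) (v w : K) : affP u v w = u * w + v := rfl

lemma affP_pow (u : Kˣ) (v w : K) (i : ℕ) :
    (affP u v ^ i) w = u ^ i * w + v * ∑ k ∈ Finset.range i, (u : K) ^ k := by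
  induction i with
  | zero => simp
  | succ i ih =>
    rw [pow_succ', Equiv.Perm.mul_apply, ih, affP_apply, geom_sum_succ]; ring
end

lemma geom_ne {K : Type*} [Field K] {u : K} {n i : ℕ} (h : IsPrimitiveRoot u n) (h0 : 0 < i) (h1 : i < n) :
    ∑ k ∈ Finset.range i, u ^ k ≠ 0 := by
  intro hs
  have := geom_sum_mul u i
  rw [hs, zero_mul] at this
  exact h.pow_ne_one_of_pos_of_lt h0.ne' h1 (sub_eq_zero.mp this.symm)

lemma geom_zero {K : Type*} [Field K] {u : K} {n : ℕ} (h : IsPrimitiveRoot u n) (h1 : 1 < n) :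
    ∑ k ∈ Finset.range n, u ^ k = 0 := h.geom_sum_eq_zero h1

theorem caseV {N P : ℕ} (hN : 4 ≤ N) (hP : 4 ≤ P) (hN2 : N % 2 = 0) (hP2 : P % 2 = 0) :
    ResiduallyFinite (Artin3 4 N P) := by
  set n := N / 2 with hn
  set p' := P / 2 with hp'
  have n2 : 2 ≤ n := by omega
  have p2 : 2 ≤ p' := by omega
  obtain ⟨l, hl, hB, ω, hω⟩ := exists_field (4 * n * p') (20 * (n + p' + 1)) (by positivity)
  have : Fact l.Prime := ⟨hl⟩
  have hω0 : ω ≠ 0 := hω.ne_zero (by positivity)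
  set W : (ZMod l)ˣ := Units.mk0 ω hω0 with hW
  have hWω : ((W : (ZMod l)ˣ) : ZMod l) = ω := rfl
  have hWp : IsPrimitiveRoot W (4 * n * p') := IsPrimitiveRoot.coe_units_iff.mp hω
  have hy : IsPrimitiveRoot (W ^ (4 * p')) n := hWp.pow (by positivity) (by ring)
  have hz : IsPrimitiveRoot (W ^ (4 * n)) p' := hWp.pow (by positivity) (by ring)
  have hm : IsPrimitiveRoot (W ^ (2 * n * p')) 2 := hWp.pow (by positivity) (by ring)
  have hm1 : W ^ (2 * n * p') = -1 := by
    apply Units.ext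
    exact (IsPrimitiveRoot.coe_units_iff.mpr hm).eq_neg_one_of_two_right
  set Y := W ^ (4 * p') with hY
  set Z := W ^ (4 * n) with hZ
  set G := W ^ (n * p' + 2 * p' + 2 * n) with hG
  have hGG : (G : ZMod l) * G = - (Y * Z) := by
    have : G * G = W ^ (2 * n * p') * (Y * Z) := by
      rw [hG, hY, hZ, ← pow_add, ← pow_add, ← pow_add]; congr 1; ring
    rw [hm1] at this
    have := congrArg (Units.val) this
    push_cast at this
    rw [this]; ring
  have hy' : IsPrimitiveRoot (Y : ZMod l) n := IsPrimitiveRoot.coe_units_iff.mpr hy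
  have hz' : IsPrimitiveRoot (Z : ZMod l) p' := IsPrimitiveRoot.coe_units_iff.mpr hz
  let S : ℕ → ZMod l := fun i => ∑ k ∈ Finset.range i, (Y : ZMod l) ^ k
  let S' : ℕ → ZMod l := fun i => ∑ k ∈ Finset.range i, (Z : ZMod l) ^ k
  have Ssucc : ∀ i, S (i+1) = Y * S i + 1 := fun i => geom_sum_succ
  have S'succ : ∀ i, S' (i+1) = Z * S' i + 1 := fun i => geom_sum_succ
  obtain ⟨t, ht⟩ := exists_avoid (K := ZMod l)
    (Finset.range (n + p' + 1) ×ˢ (Finset.univ : Finset (Fin 11)))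
    (fun x => (![S x.1, S x.1, S x.1 - 1, S (x.1+1), Z ^ x.1 - 1, Z ^ x.1, Z ^ x.1, 1, 1, 1, 1] :
      Fin 11 → ZMod l) x.2)
    (fun x => (![1 - Y ^ x.1, - Y ^ x.1, - Y ^ x.1, 1, Z * S' x.1, Z * S' x.1, 1 + Z * S' x.1,
      - Z * S' x.1, 0, -1, 1] :
      Fin 11 → ZMod l) x.2) (by
      rw [Finset.card_product, Finset.card_range, Finset.card_univ, Fintype.card_fin, ZMod.card]
      omega)
  have T : ∀ (i : ℕ) (j : Fin 11), i < n + p' + 1 → _ := fun i j hi => ht (i, j) (by simp [hi])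
  have Yne : ∀ i, 0 < i → i < n → (Y : ZMod l) ^ i ≠ 1 := fun i h0 h1 =>
    hy'.pow_ne_one_of_pos_of_lt h0.ne' h1
  have Zne : ∀ i, 0 < i → i < p' → (Z : ZMod l) ^ i ≠ 1 := fun i h0 h1 =>
    hz'.pow_ne_one_of_pos_of_lt h0.ne' h1
  have T0 : ∀ i, 0 < i → i < n → S i * t ≠ 1 - Y ^ i := fun i h0 h1 =>
    T i 0 (by omega) (Or.inr (sub_ne_zero.mpr (Yne i h0 h1).symm))
  have T1 : ∀ i, i < n → S i * t ≠ - Y ^ i := fun i h1 =>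
    T i 1 (by omega) (Or.inr (by simp))
  have T2 : ∀ i, i < n → (S i - 1) * t ≠ - Y ^ i := fun i h1 =>
    T i 2 (by omega) (Or.inr (by simp))
  have T3 : ∀ i, i < n → S (i+1) * t ≠ 1 := fun i h1 =>
    T i 3 (by omega) (Or.inr (by simp))
  have T4 : ∀ i, 0 < i → i < p' → (Z ^ i - 1) * t ≠ Z * S' i := fun i h0 h1 =>
    T i 4 (by omega) (Or.inl (sub_ne_zero.mpr (Zne i h0 h1)))
  have T5 : ∀ i, i < p' → Z ^ i * t ≠ Z * S' i := fun i h1 =>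
    T i 5 (by omega) (Or.inl (by simp))
  have T6 : ∀ i, i < p' → Z ^ i * t ≠ 1 + Z * S' i := fun i h1 =>
    T i 6 (by omega) (Or.inl (by simp))
  have T7 : ∀ i, i < p' → 1 * t ≠ - Z * S' i := fun i h1 =>
    T i 7 (by omega) (Or.inl (by simp))
  have T8 : 1 * t ≠ 0 := T 0 8 (by omega) (Or.inl (by simp))
  have T9 : 1 * t ≠ -1 := T 0 9 (by omega) (Or.inl (by simp))
  have T10 : 1 * t ≠ 1 := T 0 10 (by omega) (Or.inl (by simp))
  rw [one_mul] at T8 T9 T10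
  set x := affP (-1 : (ZMod l)ˣ) (1 + t) with hx
  set y := affP Y t with hyy
  set z := affP Z (-(Z : ZMod l)) with hzz
  set g := affP G 0 with hg
  have hu : g * g = z * x * y := by
    refine Equiv.ext fun w => ?_
    simp only [Equiv.Perm.mul_apply, hg, hx, hyy, hzz, affP_apply]
    push_cast
    linear_combination w * hGG
  have hxx : x ^ 2 = 1 := by
    ext w
    rw [affP_pow]; simp [Finset.sum_range_succ]
  have hyn : y ^ n = 1 := by
    ext w
    rw [affP_pow, hy'.geom_sum_eq_zero (by omega), hy'.pow_eq_one]; simp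
  have hzp : z ^ p' = 1 := by
    ext w
    rw [affP_pow, hz'.geom_sum_eq_zero (by omega), hz'.pow_eq_one]; simp
  set b := z⁻¹ * g with hb
  have e1 : b * (b⁻¹ * x) = x := by group
  have e2 : y * b⁻¹ * b = y := by group
  have e3 : b⁻¹ * x * (y * b⁻¹) = z := by
    have : b⁻¹ * x * (y * b⁻¹) = g⁻¹ * (z * x * y) * g⁻¹ * z := by rw [hb]; group
    rw [this, ← hu]; group
  have zq : z 1 = 0 := by simp [hzz, affP_apply]
  have yp : y 0 = t := by simp [hyy, affP_apply]
  have xr : x t = 1 := by simp [hx, affP_apply]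
  have bp : b 0 = 1 := by
    have : g 0 = 0 := by simp [hg, affP_apply]
    rw [hb, Equiv.Perm.mul_apply, this, Equiv.Perm.inv_def, Equiv.symm_apply_eq, zq]
  have bi : b⁻¹ 1 = 0 := by rw [Equiv.Perm.inv_def, Equiv.symm_apply_eq, bp]
  have x1 : x 0 = 1 + t := by simp [hx, affP_apply]
  refine good_rf (F := ZMod l) (by norm_num) hN hP (b⁻¹ * x) b (y * b⁻¹) ?_ ?_ ?_ 0 1 t
    zero_ne_one T10.symm T8.symm bp ?_ ?_ ?_ ?_ ?_
  · rw [Br_even (by norm_num), e1]; simp [hxx]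
  · rw [Br_even hN2, e2, ← hn, hyn]; simp
  · rw [Br_even hP2, e3, ← hp', hzp]; simp
  · rw [Equiv.Perm.mul_apply, bi, yp]
  · rw [Equiv.Perm.mul_apply, xr, bi]
  · rw [e1]
    refine ⟨fun h => by norm_num at h, fun _ => ⟨by simp [hxx], ?_, by intro i h0 h1; omega⟩⟩
    intro i h0 h1
    obtain rfl : i = 1 := by omega
    rw [pow_one, x1]
    refine ⟨fun h => T9 (by linear_combination h), fun h => T8 (by linear_combination h), fun h => ?_⟩
    exact one_ne_zero (α := ZMod l) (by linear_combination h)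
  · rw [e2]
    refine ⟨fun h => by omega, fun _ => ⟨by rw [← hn, hyn]; rfl, ?_, ?_⟩⟩
    · intro i h0 h1
      rw [affP_pow]
      change _ * 1 + t * S i ≠ _ ∧ _ * 1 + t * S i ≠ _ ∧ _ * 1 + t * S i ≠ _
      refine ⟨fun h => T0 i h0 h1 ?_, fun h => T2 i h1 ?_, fun h => T1 i h1 ?_⟩ <;>
        linear_combination h
    · intro i h0 h1
      have e : (y ^ i) t = t * S (i+1) := by
        rw [show (y ^ i) t = (y ^ i) (y 0) by rw [yp], ← Equiv.Perm.mul_apply, ← pow_succ, affP_pow,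
          mul_zero, zero_add]
      rw [e]
      refine ⟨fun h => T3 i (by omega) (by linear_combination h), fun h => ?_, fun h => ?_⟩
      · rw [Ssucc] at h
        have h2 : t * (Y * S i) = 0 := by linear_combination h
        have h3 := geom_ne hy' h0 (by omega : i < n)
        exact mul_ne_zero T8 (mul_ne_zero (Units.ne_zero _) h3) h2
      · exact mul_ne_zero T8 (geom_ne hy' (by omega) (by omega : i + 1 < n)) h
  · rw [e3]
    refine ⟨fun h => by omega, fun _ => ⟨by rw [← hp', hzp]; rfl, ?_, ?_⟩⟩
    · intro i h0 h1
      rw [affP_pow]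
      change _ * t + - Z * S' i ≠ _ ∧ _ * t + - Z * S' i ≠ _ ∧ _ * t + - Z * S' i ≠ _
      refine ⟨fun h => T4 i h0 h1 ?_, fun h => T5 i h1 ?_, fun h => T6 i h1 ?_⟩ <;>
        linear_combination h
    · intro i h0 h1
      rw [affP_pow]
      change _ * 0 + - Z * S' i ≠ _ ∧ _ * 0 + - Z * S' i ≠ _ ∧ _ * 0 + - Z * S' i ≠ _
      refine ⟨fun h => T7 i (by omega) (by linear_combination -h), fun h => ?_, fun h => ?_⟩
      · have h3 := geom_ne hz' h0 (by omega : i < p')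
        exact mul_ne_zero (Units.ne_zero Z) h3 (by linear_combination -h)
      · have h3 := geom_ne hz' (i.succ_pos) (by omega : i + 1 < p')
        apply h3
        change S' (i+1) = 0
        rw [S'succ]; linear_combination -h

section
variable {R : Type*} [Ring R]
/-- conjugation -/
def cj : Rˣ →* Equiv.Perm R where
  toFun u := ⟨fun m => u * m * (u⁻¹ : Rˣ), fun m => (u⁻¹ : Rˣ) * m * u,
    fun m => by simp [mul_assoc], fun m => by simp [mul_assoc]⟩
  map_one' := by ext m; simp
  map_mul' u v := by ext m; simp [mul_assoc]

lemma cj_apply (u : Rˣ) (m : R) : cj u m = u * m * (u⁻¹ : Rˣ) := rfl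
lemma cj_eq_iff (u : Rˣ) (m m' : R) : cj u m = m' ↔ u * m = m' * u := by
  rw [cj_apply, Units.mul_inv_eq_iff_eq_mul]

/-- negated conjugation -/
def ncj (u : Rˣ) : Equiv.Perm R := Equiv.neg R * cj u
lemma ncj_apply (u : Rˣ) (m : R) : ncj u m = - (u * m * (u⁻¹ : Rˣ)) := rfl
lemma ncj_eq_iff (u : Rˣ) (m m' : R) : ncj u m = m' ↔ u * m = - m' * u := by
  rw [ncj_apply, ← Units.mul_inv_eq_iff_eq_mul, neg_eq_iff_eq_neg]
lemma ncj_mul_ncj (u v : Rˣ) : ncj u * ncj v = cj (u * v) := by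
  ext m; simp [ncj_apply, cj_apply, mul_assoc]
lemma ncj_mul_cj (u v : Rˣ) : ncj u * cj v = ncj (u * v) := by
  ext m; simp [ncj_apply, cj_apply, mul_assoc]
lemma cj_mul_ncj (u v : Rˣ) : cj u * ncj v = ncj (u * v) := by
  ext m; simp [ncj_apply, cj_apply, mul_assoc]
lemma ncj_inv (u : Rˣ) : (ncj u)⁻¹ = ncj u⁻¹ := by
  rw [inv_eq_iff_mul_eq_one, ncj_mul_ncj]; simp
end

section
variable {K : Type*} [Field K]
abbrev M2 (K : Type*) := Matrix (Fin 2) (Fin 2) K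

lemma cj_smul (u v : (M2 K)ˣ) (c : K) (h : (u : M2 K) = c • (v : M2 K)) : cj u = cj v := by
  ext1 m
  rw [cj_eq_iff, cj_apply, h]
  simp [mul_assoc]

lemma cj_scalar (u : (M2 K)ˣ) (c : K) (h : (u : M2 K) = c • (1 : M2 K)) : cj u = 1 := by
  rw [cj_smul u 1 c (by simpa using h), map_one]

lemma exists_unit (m : M2 K) (h : m 0 0 * m 1 1 - m 0 1 * m 1 0 ≠ 0) : ∃ u : (M2 K)ˣ, (u : M2 K) = m := by
  have : IsUnit m := by
    rw [Matrix.isUnit_iff_isUnit_det, Matrix.det_fin_two]; exact h.isUnit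
  exact this

lemma zpow_formula (z : M2 K) (κ ω : K) (h : z * z = (κ * (1 + ω)) • z - (κ ^ 2 * ω) • (1 : M2 K)) (i : ℕ) :
    z ^ (i + 1) = (κ ^ i * ∑ k ∈ Finset.range (i+1), ω ^ k) • z -
      (κ ^ (i+1) * ω * ∑ k ∈ Finset.range i, ω ^ k) • (1 : M2 K) := by
  induction i with
  | zero => simp
  | succ i ih =>
    rw [pow_succ, ih, sub_mul, smul_mul_assoc, h, smul_mul_assoc, one_mul]
    have e : ∑ k ∈ Finset.range (i+1+1), ω ^ k = ω ^ (i+1) + ∑ k ∈ Finset.range (i+1), ω ^ k := by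
      rw [Finset.sum_range_succ]; ring
    have e' : ∑ k ∈ Finset.range (i+1), ω ^ k = ω ^ i + ∑ k ∈ Finset.range i, ω ^ k := by
      rw [Finset.sum_range_succ]; ring
    rw [e, e']
    ext a b
    simp only [Matrix.sub_apply, Matrix.smul_apply, smul_eq_mul]
    ring
end

theorem caseIV {N P : ℕ} (hN : 5 ≤ N) (hP : 6 ≤ P) (hN2 : N % 2 = 1) (hP2 : P % 2 = 0) :
    ResiduallyFinite (Artin3 4 N P) := by
  set n := N / 2 with hn
  set p' := P / 2 with hp'
  have hNn : N = 2 * n + 1 := by omega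
  have hN0 : 0 < N := by omega
  have hp0 : 0 < p' := by omega
  obtain ⟨l, hl, hB, ρ, hρ⟩ := exists_field (N * p') 5 (by positivity)
  have : Fact l.Prime := ⟨hl⟩
  have h2 : (2 : ZMod l) ≠ 0 := by
    intro h
    have : ((2 : ℕ) : ZMod l) = 0 := by exact_mod_cast h
    rw [ZMod.natCast_eq_zero_iff] at this
    exact absurd (Nat.le_of_dvd (by norm_num) this) (by omega)
  have h3 : (3 : ZMod l) ≠ 0 := by
    intro h
    have : ((3 : ℕ) : ZMod l) = 0 := by exact_mod_cast h
    rw [ZMod.natCast_eq_zero_iff] at this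
    exact absurd (Nat.le_of_dvd (by norm_num) this) (by omega)
  have hs0 : IsPrimitiveRoot (ρ ^ p') N := hρ.pow (by positivity) (by ring)
  have hω : IsPrimitiveRoot (ρ ^ N) p' := hρ.pow (by positivity) (by ring)
  set ω := ρ ^ N with hωd
  obtain ⟨s, hs, hsω, hsω'⟩ : ∃ s : ZMod l, IsPrimitiveRoot s N ∧ ω + s ^ 2 ≠ 0 ∧ ω * s ^ 2 + 1 ≠ 0 := by
    generalize ρ ^ p' = σ at hs0
    have hσ0 : σ ≠ 0 := hs0.ne_zero (by omega)
    have n1 : ∀ i, 0 < i → i < 5 → σ ^ i ≠ 1 := fun i h0 h1 => hs0.pow_ne_one_of_pos_of_lt h0.ne' (by omega)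
    have n6 : σ ^ 6 ≠ 1 := by
      intro h
      have := (hs0.pow_eq_one_iff_dvd 6).mp h
      have := Nat.le_of_dvd (by norm_num) this
      interval_cases N <;> omega
    by_cases h : ω + σ ^ 2 ≠ 0 ∧ ω * σ ^ 2 + 1 ≠ 0
    · exact ⟨σ, hs0, h.1, h.2⟩
    · refine ⟨σ ^ 2, hs0.pow_of_coprime 2 ?_, ?_, ?_⟩
      · rw [Nat.coprime_two_left, Nat.odd_iff]; exact hN2
      · intro h4
        rw [not_and_or, not_ne_iff, not_ne_iff] at h
        rcases h with h | h
        · have : σ ^ 2 * (σ ^ 2 - 1) = 0 := by linear_combination h4 - h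
          rcases mul_eq_zero.mp this with h5 | h5
          · exact hσ0 (pow_eq_zero_iff (by norm_num) |>.mp h5)
          · exact n1 2 (by norm_num) (by norm_num) (by linear_combination h5)
        · exact n6 (by linear_combination σ ^ 2 * h4 - h)
      · intro h4
        rw [not_and_or, not_ne_iff, not_ne_iff] at h
        rcases h with h | h
        · exact n6 (by linear_combination - h4 + σ ^ 4 * h)
        · exact n1 2 (by norm_num) (by norm_num) (by linear_combination - h4 + σ ^ 2 * h)
  have sne : s ≠ 0 := hs.ne_zero (by omega)
  have spow : ∀ i, 0 < i → i < N → s ^ i ≠ 1 := fun i h0 h1 => hs.pow_ne_one_of_pos_of_lt h0.ne' h1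
  have sN : s ^ N = 1 := hs.pow_eq_one
  have s1 : s - 1 ≠ 0 := by have := spow 1 (by omega) (by omega); rw [pow_one] at this; exact sub_ne_zero.mpr this
  have s2 : s ^ 2 - 1 ≠ 0 := sub_ne_zero.mpr (spow 2 (by omega) (by omega))
  have s3 : s ^ 3 - 1 ≠ 0 := sub_ne_zero.mpr (spow 3 (by omega) (by omega))
  have s4 : s ^ 4 - 1 ≠ 0 := sub_ne_zero.mpr (spow 4 (by omega) (by omega))
  have sp1 : 1 + s ≠ 0 := fun h => s2 (by linear_combination (s - 1) * h)
  have ωne : ω ≠ 0 := hω.ne_zero (by omega)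
  have ωp1 : 1 + ω ≠ 0 := by
    intro h
    have := hω.pow_ne_one_of_pos_of_lt (l := 2) (by norm_num) (by omega)
    exact this (by linear_combination (ω - 1) * h)
  -- the parameter e
  obtain ⟨κ, hκ⟩ : ∃ κ, κ = 2 * (s - s⁻¹) / (1 + ω) := ⟨_, rfl⟩
  obtain ⟨e, he⟩ : ∃ e, e = (-4 - κ ^ 2 * ω) * s / (1 + s) ^ 2 := ⟨_, rfl⟩
  have hκ' : κ * (1 + ω) = 2 * (s - s⁻¹) := by rw [hκ]; field_simp
  have he' : e * (1 + s) ^ 2 = (-4 - κ ^ 2 * ω) * s := by rw [he]; field_simp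
  have κne : κ ≠ 0 := by
    intro h
    rw [h, zero_mul] at hκ'
    have : 2 * (s ^ 2 - 1) = 0 := by
      have : s * (2 * (s - s⁻¹)) = 0 := by rw [← hκ', mul_zero]
      field_simp at this
      linear_combination this
    exact mul_ne_zero h2 s2 this
  have ene : e ≠ 0 := by
    intro h
    rw [h, zero_mul] at he'
    have h4 : -4 - κ ^ 2 * ω = 0 := by
      rcases mul_eq_zero.mp he'.symm with h | h
      · exact h
      · exact absurd h sne
    have h5 : (κ * (1 + ω)) ^ 2 * ω = -4 * (1 + ω) ^ 2 := by linear_combination - (1 + ω) ^ 2 * h4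
    rw [hκ'] at h5
    have h6 : (2 * 2) * ((ω + s ^ 2) * (ω * s ^ 2 + 1)) = 0 := by
      field_simp at h5
      linear_combination h5
    exact mul_ne_zero (mul_ne_zero h2 h2) (mul_ne_zero hsω hsω') h6
  -- matrices
  let q : M2 (ZMod l) := !![1, 1; e, -1]
  let r : M2 (ZMod l) := !![1, s; e * s⁻¹, -1]
  let p : M2 (ZMod l) := !![1, s⁻¹; e * s, -1]
  let z : M2 (ZMod l) := !![-2 * s⁻¹, -(1 + s) * s⁻¹; -(1 + s) * e, 2 * s]
  obtain ⟨ub, hub⟩ := exists_unit (!![0, 1; -e * s, 0] : M2 (ZMod l)) (by simp [ene, sne])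
  obtain ⟨uc, huc⟩ := exists_unit (!![0, s; -e, 0] : M2 (ZMod l)) (by simp [ene, sne])
  obtain ⟨ux, hux⟩ := exists_unit (q + r) (by
    simp only [q, r, Matrix.add_apply, Matrix.of_apply, Matrix.cons_val', Matrix.cons_val_zero,
      Matrix.cons_val_one, Matrix.cons_val_fin_one]
    intro h
    have : κ ^ 2 * ω * s = 0 := by
      field_simp at h
      linear_combination he' + h
    exact mul_ne_zero (mul_ne_zero (pow_ne_zero _ κne) ωne) sne this)
  obtain ⟨uD, huD⟩ := exists_unit (!![s ^ 2, 0; 0, 1] : M2 (ZMod l)) (by simp [sne])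
  have mext : ∀ A B : M2 (ZMod l), A 0 0 = B 0 0 → A 0 1 = B 0 1 → A 1 0 = B 1 0 → A 1 1 = B 1 1 → A = B := by
    intro A B h1 h2 h3 h4
    ext i j
    fin_cases i <;> fin_cases j <;> assumption
  have hz : ((ub⁻¹ * ux * uc : (M2 (ZMod l))ˣ) : M2 (ZMod l)) = z := by
    rw [Units.val_mul, Units.val_mul, mul_assoc, Units.inv_mul_eq_iff_eq_mul, hux, hub, huc]
    apply mext <;> simp [q, r, z, Matrix.mul_apply, Fin.sum_univ_two] <;> field_simp <;> ring_nf <;> simp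
  have hyD : cj (uc * ub) = cj uD := by
    apply cj_smul _ _ (-e)
    rw [Units.val_mul, huc, hub, huD]
    apply mext <;> simp [Matrix.mul_apply, Fin.sum_univ_two] <;> ring
  have hD : ∀ i, ((uD ^ i : (M2 (ZMod l))ˣ) : M2 (ZMod l)) = !![s ^ (2 * i), 0; 0, 1] := by
    intro i
    induction i with
    | zero => simp [Matrix.one_fin_two]
    | succ i ih =>
      rw [pow_succ, Units.val_mul, ih, huD]
      apply mext <;> simp [Matrix.mul_apply, Fin.sum_univ_two] <;> ring
  have hxx : cj ux ^ 2 = 1 := by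
    rw [← map_pow]
    apply cj_scalar _ (4 + e * (1 + s) ^ 2 * s⁻¹)
    rw [pow_two, Units.val_mul, hux]
    apply mext <;> simp [q, r, Matrix.mul_apply, Fin.sum_univ_two] <;> field_simp <;> ring
  -- z
  have hzz : z * z = (κ * (1 + ω)) • z - (κ ^ 2 * ω) • (1 : M2 (ZMod l)) := by
    rw [hκ']
    have e1 : κ ^ 2 * ω = -4 - e * (1 + s) ^ 2 * s⁻¹ := by
      rw [he']; field_simp; ring
    rw [e1]
    apply mext <;> simp [z, Matrix.mul_apply, Fin.sum_univ_two] <;> field_simp <;> ring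
  have hzi := zpow_formula z κ ω hzz
  have hzp : cj (ub⁻¹ * ux * uc) ^ p' = 1 := by
    obtain ⟨k, hk⟩ : ∃ k, p' = k + 1 := ⟨p' - 1, by omega⟩
    rw [← map_pow, hk]
    apply cj_scalar _ (-(κ ^ (k+1) * ω * ∑ j ∈ Finset.range k, ω ^ j))
    rw [Units.val_pow_eq_pow_val, hz, hzi k, ← hk, hω.geom_sum_eq_zero (by omega)]
    simp
  have zne : ∀ i, 0 < i → i < p' → ∀ A B : M2 (ZMod l),
      (∃ c : ZMod l, ∃ a b, A a b = B a b ∧ (z * A - B * z) a b ≠ 0) →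
      (cj (ub⁻¹ * ux * uc) ^ i) A ≠ B := by
    rintro i h0 h1 A B ⟨-, a, b, hab, hne⟩ h
    obtain ⟨k, rfl⟩ : ∃ k, i = k + 1 := ⟨i - 1, by omega⟩
    rw [← map_pow, cj_eq_iff, Units.val_pow_eq_pow_val, hz, hzi k] at h
    have h4 := geom_ne hω h0 h1
    have h5 := congrFun (congrFun h a) b
    simp only [sub_mul, mul_sub, smul_mul_assoc, mul_smul_comm, one_mul, mul_one, Matrix.sub_apply,
      Matrix.smul_apply, smul_eq_mul] at h5 hne
    rw [hab] at h5
    have h6 : (κ ^ k * ∑ j ∈ Finset.range (k+1), ω ^ j) * ((z * A) a b - (B * z) a b) = 0 := by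
      linear_combination h5
    exact mul_ne_zero (mul_ne_zero (pow_ne_zero _ κne) h4) hne h6
  have zr : ∀ i, 0 < i → i < p' → (cj (ub⁻¹ * ux * uc) ^ i) r ≠ r := by
    intro i h0 h1
    refine zne i h0 h1 r r ⟨0, 0, 0, rfl, ?_⟩
    simp [z, r, Matrix.mul_apply, Fin.sum_univ_two]
    intro h
    field_simp at h
    exact mul_ne_zero (mul_ne_zero ene sp1) s3 (by linear_combination h)
  have zq : ∀ i, 0 < i → i < p' → (cj (ub⁻¹ * ux * uc) ^ i) q ≠ q := by
    intro i h0 h1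
    refine zne i h0 h1 q q ⟨0, 0, 0, rfl, ?_⟩
    simp [z, q, Matrix.mul_apply, Fin.sum_univ_two]
    intro h
    field_simp at h
    exact mul_ne_zero (mul_ne_zero ene sp1) s1 (by linear_combination h)
  have zqr : ∀ i, 0 < i → i < p' → (cj (ub⁻¹ * ux * uc) ^ i) q ≠ r := by
    intro i h0 h1
    refine zne i h0 h1 q r ⟨0, 0, 0, rfl, ?_⟩
    simp [z, q, r, Matrix.mul_apply, Fin.sum_univ_two]
    intro h
    field_simp at h
    exact mul_ne_zero (mul_ne_zero ene sp1) s2 (by linear_combination h)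
  have bp : ncj ub p = q := by
    rw [ncj_eq_iff, hub]
    apply mext <;> simp [p, q, Matrix.mul_apply, Fin.sum_univ_two] <;> field_simp
  have cq : ncj uc q = r := by
    rw [ncj_eq_iff, huc]
    apply mext <;> simp [r, q, Matrix.mul_apply, Fin.sum_univ_two] <;> field_simp
  have xr : cj ux r = q := by
    rw [cj_eq_iff, hux]
    apply mext <;> simp [r, q, Matrix.mul_apply, Fin.sum_univ_two] <;> field_simp <;> ring
  have xq : cj ux q = r := by
    have := congrArg (fun f => f r) hxx
    simp only [pow_two, Equiv.Perm.mul_apply, xr] at this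
    exact this
  have e1 : ncj ub * ((ncj ub)⁻¹ * cj ux) = cj ux := by group
  have e2 : ncj uc * ncj ub = cj uD := by rw [ncj_mul_ncj, hyD]
  have e3 : (ncj ub)⁻¹ * cj ux * ncj uc = cj (ub⁻¹ * ux * uc) := by
    rw [ncj_inv, ncj_mul_cj, ncj_mul_ncj]
  have ar : ((ncj ub)⁻¹ * cj ux) r = p := by
    rw [Equiv.Perm.mul_apply, xr, Equiv.Perm.inv_def, Equiv.symm_apply_eq, bp]
  have q01 : q 0 1 = 1 := rfl
  have r01 : r 0 1 = s := rfl
  have p01 : p 0 1 = s⁻¹ := rfl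
  have hpq : p ≠ q := fun h => by
    have := congrFun (congrFun h 0) 1
    rw [p01, q01] at this
    field_simp at this
    exact s1 (by linear_combination - this)
  have hqr : q ≠ r := fun h => by
    have := congrFun (congrFun h 0) 1
    rw [r01, q01] at this
    exact s1 (by linear_combination - this)
  have hpr : p ≠ r := fun h => by
    have := congrFun (congrFun h 0) 1
    rw [r01, p01] at this
    field_simp at this
    exact s2 (by linear_combination - this)
  have zq1 : cj (ub⁻¹ * ux * uc) q = p := by
    rw [← e3, Equiv.Perm.mul_apply, cq, ar]
  have hyn : cj uD ^ n * ncj uc = ncj ub * cj uD ^ n := by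
    rw [← map_pow, cj_mul_ncj, ncj_mul_cj]
    congr 1
    apply Units.ext
    rw [Units.val_mul, Units.val_mul, hD, hub, huc]
    have : s ^ (2 * n) * s = 1 := by rw [← pow_succ, ← hNn, sN]
    apply mext <;> simp [Matrix.mul_apply, Fin.sum_univ_two]
    · exact this
    · linear_combination (-e) * this
  have hynr : (cj uD ^ n) r = q := by
    rw [← map_pow, cj_eq_iff, hD]
    have h1 : s ^ (2 * n) * s = 1 := by rw [← pow_succ, ← hNn, sN]
    have h2 : s ^ (2 * n) = s⁻¹ := by field_simp; exact h1
    rw [h2]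
    apply mext <;> simp [r, q, Matrix.mul_apply, Fin.sum_univ_two, sne]
  have yne : ∀ (i : ℕ) (A B : M2 (ZMod l)), s ^ (2 * i) * A 0 1 ≠ B 0 1 → (cj uD ^ i) A ≠ B := by
    intro i A B hAB h
    rw [← map_pow, cj_eq_iff, hD] at h
    have h5 := congrFun (congrFun h 0) 1
    simp [Matrix.mul_apply, Fin.sum_univ_two] at h5
    exact hAB h5
  refine good_rf (F := M2 (ZMod l)) (by norm_num) (by omega) (by omega) ((ncj ub)⁻¹ * cj ux) (ncj ub) (ncj uc)
    ?_ ?_ ?_ p q r hpq hqr hpr bp cq ar ?_ ?_ ?_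
  · rw [Br_even (by norm_num), e1]; simp [hxx]
  · rw [Br_odd' hN2, pow_succ, e2, ← hn, ← e2, ← mul_assoc, e2, hyn]
  · rw [Br_even hP2, e3, ← hp', hzp]; simp
  · rw [e1]
    refine ⟨fun h => by norm_num at h, fun _ => ⟨by simp [hxx], ?_, by intro i h0 h1; omega⟩⟩
    intro i h0 h1
    obtain rfl : i = 1 := by omega
    rw [pow_one]
    refine ⟨fun h => ?_, fun h => ?_, fun h => ?_⟩
    · rw [cj_eq_iff, hux] at h
      have h5 := congrFun (congrFun h 0) 1
      have h6 := congrFun (congrFun h 1) 0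
      simp [p, q, r, Matrix.mul_apply, Fin.sum_univ_two] at h5 h6
      field_simp at h5 h6
      have h7 : 3 * (2 * (s ^ 2 - 1)) = 0 := by linear_combination - h5 - h6
      exact mul_ne_zero h3 (mul_ne_zero h2 s2) h7
    · exact hpr ((cj ux).injective (h.trans xr.symm))
    · exact hpq ((cj ux).injective (h.trans xq.symm))
  · rw [e2]
    refine ⟨fun _ => ⟨hynr, ?_⟩, fun h => by omega⟩
    intro i h0 h1
    have a1 := spow (2 * i) (by omega) (by omega)
    have a2 := spow (2 * i + 1) (by omega) (by omega)
    have a3 := spow (2 * i + 2) (by omega) (by omega)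
    have a4 := spow (2 * i - 1) (by omega) (by omega)
    have a5 : s ^ (2 * i) = s ^ (2 * i - 1) * s := by rw [← pow_succ]; congr 1; omega
    refine ⟨⟨yne _ _ _ ?_, yne _ _ _ ?_, yne _ _ _ ?_⟩, ⟨yne _ _ _ ?_, yne _ _ _ ?_, yne _ _ _ ?_⟩⟩ <;>
      simp only [q01, r01, p01] <;> intro h
    · exact a1 (by linear_combination h)
    · rw [a5] at h
      exact a4 (mul_right_cancel₀ sne (by linear_combination h))
    · field_simp at h; exact a2 (by linear_combination h)
    · exact a2 (by linear_combination h)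
    · exact a1 (mul_right_cancel₀ sne (by linear_combination h))
    · field_simp at h; exact a3 (by linear_combination h)
  · rw [e3]
    refine ⟨fun h => by omega, fun _ => ⟨by rw [← hp', hzp]; rfl, ?_, ?_⟩⟩
    · have key : ∀ i, i < p' → (cj (ub⁻¹ * ux * uc) ^ i) r ≠ q := by
        intro i h1 h
        rcases Nat.eq_zero_or_pos i with rfl | h0
        · exact hqr h.symm
        · apply zqr (p' - i) (by omega) (by omega)
          rw [← h, ← Equiv.Perm.mul_apply, ← pow_add, show p' - i + i = p' by omega, hzp]; rfl
      intro i h0 h1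
      refine ⟨zr i h0 h1, fun h => ?_, key i h1⟩
      apply key (i - 1) (by omega)
      apply (cj (ub⁻¹ * ux * uc)).injective
      rw [zq1, ← Equiv.Perm.mul_apply, ← pow_succ', show i - 1 + 1 = i by omega, h]
    · intro i h0 h1
      have ei : (cj (ub⁻¹ * ux * uc) ^ i) p = (cj (ub⁻¹ * ux * uc) ^ (i+1)) q := by
        rw [pow_succ, Equiv.Perm.mul_apply, zq1]
      refine ⟨ei ▸ zqr _ (by omega) (by omega), ?_, ei ▸ zq _ (by omega) (by omega)⟩
      intro h
      apply zq i h0 (by omega)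
      apply (cj (ub⁻¹ * ux * uc)).injective
      rw [← Equiv.Perm.mul_apply, ← pow_succ', ← ei, h, zq1]

/-- a permutation from two tables -/
def mkP {n : ℕ} (f g : Fin n → Fin n) (h : ∀ i, g (f i) = i) (h' : ∀ i, f (g i) = i) :
    Equiv.Perm (Fin n) := ⟨f, g, h, h'⟩

/-- pieces for the groups (4,5,P) -/
structure Pc {Ω : Type} (c β γ : Equiv.Perm Ω) : Prop where
  b2 : ∀ i, β (β i) = i
  g2 : ∀ i, γ (γ i) = i
  y5 : ∀ i, c (β (c (β (c (β (c (β (c (β i))))))))) = i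
  rel : ∀ i, c (γ (c.symm (β (c (β (c (γ (c (γ (c.symm (β (c (β (c (γ i))))))))))))))) =
    γ (c.symm (β (c (β (c (γ (c (γ (c.symm (β (c (β (c (γ (c i))))))))))))))) 
  tr : ∀ i j, ∃ n : ℕ, ((c * γ) ^ n) i = j

/-- handle -/
def Hd {Ω : Type} (c β γ : Equiv.Perm Ω) (h : Ω) : Prop := γ h = h ∧ c (β (c h)) = β (c h)

/-- base point -/
structure Bs {Ω : Type} (c β γ : Equiv.Perm Ω) (q : Ω) : Prop where
  bq : β q = q
  gq : γ q = q
  cq : c q ≠ q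
  yp : c (β (c (γ (c q)))) = q
  xq : β (c (β (c (γ (c (γ (c.symm q))))))) = c q
  xp : β (c (β (c (γ (c (c q)))))) ≠ c (γ (c q))

def Sf {Ω : Type} (c γ : Equiv.Perm Ω) (q h : Ω) : Prop :=
  h ≠ q ∧ h ≠ c q ∧ h ≠ c.symm q ∧ h ≠ c (γ (c.symm q))

def FIN (n : ℕ) : Prop := ∃ (Ω : Type) (_ : Finite Ω), Nat.card Ω = n ∧ ∃ c β γ : Equiv.Perm Ω,
  Pc c β γ ∧ ∃ q, Bs c β γ q
def HPc (n : ℕ) : Prop := ∃ (Ω : Type) (_ : Finite Ω), Nat.card Ω = n ∧ ∃ c β γ : Equiv.Perm Ω,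
  Pc c β γ ∧ ∃ q h, Bs c β γ q ∧ Hd c β γ h ∧ Sf c γ q h
def EN (n : ℕ) : Prop := ∃ (Ω : Type) (_ : Finite Ω), Nat.card Ω = n ∧ ∃ c β γ : Equiv.Perm Ω,
  Pc c β γ ∧ ∃ h, Hd c β γ h
def DU (n : ℕ) : Prop := ∃ (Ω : Type) (_ : Finite Ω), Nat.card Ω = n ∧ ∃ c β γ : Equiv.Perm Ω,
  Pc c β γ ∧ ∃ h k, h ≠ k ∧ Hd c β γ h ∧ Hd c β γ k

lemma tr_fin {n : ℕ} [NeZero n] (Z : Equiv.Perm (Fin n)) (h : ∀ i, Z i = i + 1) :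
    ∀ i j, ∃ k : ℕ, (Z ^ k) i = j := by
  have h1 : ∀ (k : ℕ) i, ((Z ^ k) i).val = (i.val + k) % n := by
    intro k
    induction k with
    | zero => intro i; simp [Nat.mod_eq_of_lt i.2]
    | succ k ih =>
      intro i
      rw [pow_succ', Equiv.Perm.mul_apply, h, Fin.val_add, ih, Fin.val_one', ← Nat.add_mod, add_assoc]
  intro i j
  refine ⟨j.val + (n - i.val), Fin.ext ?_⟩
  rw [h1]
  have := i.2
  have e : i.val + (j.val + (n - i.val)) = j.val + n := by omega
  rw [e, Nat.add_mod_right, Nat.mod_eq_of_lt j.2]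

lemma finP5 : FIN 5 := by
  refine ⟨Fin 5, inferInstance, Nat.card_fin _, (mkP ![1, 0, 4, 3, 2] ![1, 0, 4, 3, 2] (by decide) (by decide)),
    (mkP ![0, 2, 1, 4, 3] ![0, 2, 1, 4, 3] (by decide) (by decide)),
    (mkP ![0, 4, 3, 2, 1] ![0, 4, 3, 2, 1] (by decide) (by decide)), ⟨?_, ?_, ?_, ?_, tr_fin _ ?_⟩,
    0, ⟨?_, ?_, ?_, ?_, ?_, ?_⟩⟩ <;> decide

lemma finP7 : FIN 7 := by
  refine ⟨Fin 7, inferInstance, Nat.card_fin _, (mkP ![1, 2, 0, 5, 4, 6, 3] ![2, 0, 1, 6, 4, 3, 5] (by decide) (by decide)),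
    (mkP ![3, 2, 1, 0, 4, 5, 6] ![3, 2, 1, 0, 4, 5, 6] (by decide) (by decide)),
    (mkP ![0, 1, 6, 4, 3, 5, 2] ![0, 1, 6, 4, 3, 5, 2] (by decide) (by decide)), ⟨?_, ?_, ?_, ?_, tr_fin _ ?_⟩,
    5, ⟨?_, ?_, ?_, ?_, ?_, ?_⟩⟩ <;> decide

lemma finP9 : FIN 9 := by
  refine ⟨Fin 9, inferInstance, Nat.card_fin _, (mkP ![1, 2, 5, 4, 3, 0, 7, 8, 6] ![5, 0, 1, 4, 3, 2, 8, 6, 7] (by decide) (by decide)),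
    (mkP ![0, 6, 5, 4, 3, 2, 1, 8, 7] ![0, 6, 5, 4, 3, 2, 1, 8, 7] (by decide) (by decide)),
    (mkP ![0, 1, 4, 3, 2, 8, 6, 7, 5] ![0, 1, 4, 3, 2, 8, 6, 7, 5] (by decide) (by decide)), ⟨?_, ?_, ?_, ?_, tr_fin _ ?_⟩,
    0, ⟨?_, ?_, ?_, ?_, ?_, ?_⟩⟩ <;> decide

lemma hpA10 : HPc 10 := by
  refine ⟨Fin 10, inferInstance, Nat.card_fin _, (mkP ![1, 2, 4, 3, 0, 7, 6, 8, 9, 5] ![4, 0, 1, 3, 2, 9, 6, 5, 7, 8] (by decide) (by decide)),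
    (mkP ![7, 3, 2, 1, 5, 4, 9, 0, 8, 6] ![7, 3, 2, 1, 5, 4, 9, 0, 8, 6] (by decide) (by decide)),
    (mkP ![0, 1, 3, 2, 9, 6, 5, 7, 8, 4] ![0, 1, 3, 2, 9, 6, 5, 7, 8, 4] (by decide) (by decide)), ⟨?_, ?_, ?_, ?_, tr_fin _ ?_⟩,
    8, 0, ⟨?_, ?_, ?_, ?_, ?_, ?_⟩, ⟨?_, ?_⟩, ?_, ?_, ?_, ?_⟩ <;> decide

lemma hpA12 : HPc 12 := by
  refine ⟨Fin 12, inferInstance, Nat.card_fin _, (mkP ![1, 2, 4, 3, 5, 6, 0, 11, 10, 9, 8, 7] ![6, 0, 1, 3, 2, 4, 5, 11, 10, 9, 8, 7] (by decide) (by decide)),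
    (mkP ![11, 3, 2, 1, 7, 5, 9, 4, 10, 6, 8, 0] ![11, 3, 2, 1, 7, 5, 9, 4, 10, 6, 8, 0] (by decide) (by decide)),
    (mkP ![0, 1, 3, 2, 4, 5, 11, 10, 9, 8, 7, 6] ![0, 1, 3, 2, 4, 5, 11, 10, 9, 8, 7, 6] (by decide) (by decide)), ⟨?_, ?_, ?_, ?_, tr_fin _ ?_⟩,
    5, 0, ⟨?_, ?_, ?_, ?_, ?_, ?_⟩, ⟨?_, ?_⟩, ?_, ?_, ?_, ?_⟩ <;> decide

lemma hpA13 : HPc 13 := by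
  refine ⟨Fin 13, inferInstance, Nat.card_fin _, (mkP ![1, 2, 3, 5, 4, 6, 7, 0, 12, 11, 10, 9, 8] ![7, 0, 1, 2, 4, 3, 5, 6, 12, 11, 10, 9, 8] (by decide) (by decide)),
    (mkP ![12, 4, 3, 2, 1, 8, 6, 10, 5, 11, 7, 9, 0] ![12, 4, 3, 2, 1, 8, 6, 10, 5, 11, 7, 9, 0] (by decide) (by decide)),
    (mkP ![0, 1, 2, 4, 3, 5, 6, 12, 11, 10, 9, 8, 7] ![0, 1, 2, 4, 3, 5, 6, 12, 11, 10, 9, 8, 7] (by decide) (by decide)), ⟨?_, ?_, ?_, ?_, tr_fin _ ?_⟩,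
    6, 0, ⟨?_, ?_, ?_, ?_, ?_, ?_⟩, ⟨?_, ?_⟩, ?_, ?_, ?_, ?_⟩ <;> decide

lemma duD10 : DU 10 := by
  refine ⟨Fin 10, inferInstance, Nat.card_fin _, (mkP ![1, 2, 4, 3, 5, 0, 8, 7, 9, 6] ![5, 0, 1, 3, 2, 4, 9, 7, 6, 8] (by decide) (by decide)),
    (mkP ![8, 3, 2, 1, 6, 5, 4, 9, 0, 7] ![8, 3, 2, 1, 6, 5, 4, 9, 0, 7] (by decide) (by decide)),
    (mkP ![0, 1, 3, 2, 4, 9, 7, 6, 8, 5] ![0, 1, 3, 2, 4, 9, 7, 6, 8, 5] (by decide) (by decide)), ⟨?_, ?_, ?_, ?_, tr_fin _ ?_⟩,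
    0, 8, ?_, ⟨?_, ?_⟩, ?_, ?_⟩ <;> decide

lemma enE1 : EN 1 := by
  refine ⟨Fin 1, inferInstance, Nat.card_fin _, (mkP ![0] ![0] (by decide) (by decide)),
    (mkP ![0] ![0] (by decide) (by decide)),
    (mkP ![0] ![0] (by decide) (by decide)), ⟨?_, ?_, ?_, ?_, tr_fin _ ?_⟩,
    0, ?_, ?_⟩ <;> decide

lemma enE5 : EN 5 := by
  refine ⟨Fin 5, inferInstance, Nat.card_fin _, (mkP ![1, 3, 2, 0, 4] ![3, 0, 2, 1, 4] (by decide) (by decide)),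
    (mkP ![0, 2, 1, 4, 3] ![0, 2, 1, 4, 3] (by decide) (by decide)),
    (mkP ![0, 2, 1, 4, 3] ![0, 2, 1, 4, 3] (by decide) (by decide)), ⟨?_, ?_, ?_, ?_, tr_fin _ ?_⟩,
    0, ?_, ?_⟩ <;> decide

lemma enE6 : EN 6 := by
  refine ⟨Fin 6, inferInstance, Nat.card_fin _, (mkP ![1, 2, 4, 3, 0, 5] ![4, 0, 1, 3, 2, 5] (by decide) (by decide)),
    (mkP ![1, 0, 5, 4, 3, 2] ![1, 0, 5, 4, 3, 2] (by decide) (by decide)),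
    (mkP ![0, 1, 3, 2, 5, 4] ![0, 1, 3, 2, 5, 4] (by decide) (by decide)), ⟨?_, ?_, ?_, ?_, tr_fin _ ?_⟩,
    1, ?_, ?_⟩ <;> decide

lemma join_tr {A B : Type} (Z1 : Equiv.Perm A) (Z2 : Equiv.Perm B) (i : A) (j : B)
    (h1 : ∀ x y, ∃ n : ℕ, (Z1 ^ n) x = y) (h2 : ∀ x y, ∃ n : ℕ, (Z2 ^ n) x = y)
    (Z : Equiv.Perm (A ⊕ B)) (hA : ∀ x, x ≠ i → Z (Sum.inl x) = Sum.inl (Z1 x))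
    (hB : ∀ x, x ≠ j → Z (Sum.inr x) = Sum.inr (Z2 x))
    (hi : Z (Sum.inl i) = Sum.inr (Z2 j)) (hj : Z (Sum.inr j) = Sum.inl (Z1 i)) [Finite A] [Finite B] :
    ∀ x y, ∃ n : ℕ, (Z ^ n) x = y := by
  have hst : ∀ x, Z.SameCycle x (Z x) := fun x => ⟨1, by simp⟩
  have kA : ∀ n : ℕ, Z.SameCycle (Sum.inl ((Z1 ^ n) (Z1 i))) (Sum.inl (Z1 i)) := by
    intro n
    induction n with
    | zero => exact Equiv.Perm.SameCycle.refl _ _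
    | succ n ih =>
      rw [pow_succ', Equiv.Perm.mul_apply]
      by_cases h : (Z1 ^ n) (Z1 i) = i
      · rw [h]
      · rw [← hA _ h]
        exact (hst _).symm.trans ih
  have kB : ∀ n : ℕ, Z.SameCycle (Sum.inr ((Z2 ^ n) (Z2 j))) (Sum.inr (Z2 j)) := by
    intro n
    induction n with
    | zero => exact Equiv.Perm.SameCycle.refl _ _
    | succ n ih =>
      rw [pow_succ', Equiv.Perm.mul_apply]
      by_cases h : (Z2 ^ n) (Z2 j) = j
      · rw [h]
      · rw [← hB _ h]
        exact (hst _).symm.trans ih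
  have lA : ∀ x, Z.SameCycle (Sum.inl x) (Sum.inl (Z1 i)) := by
    intro x
    obtain ⟨n, hn⟩ := h1 (Z1 i) x
    rw [← hn]; exact kA n
  have lB : ∀ x, Z.SameCycle (Sum.inr x) (Sum.inl (Z1 i)) := by
    intro x
    obtain ⟨n, hn⟩ := h2 (Z2 j) x
    rw [← hn]
    refine (kB n).trans ?_
    rw [← hi]
    exact (hst _).symm.trans (lA i)
  have l : ∀ x, Z.SameCycle x (Sum.inl (Z1 i)) := by
    rintro (x | x)
    · exact lA x
    · exact lB x
  intro x y
  obtain ⟨n, -, hn⟩ := ((l x).trans (l y).symm).exists_pow_eq'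
  exact ⟨n, hn⟩

lemma join_swap {A B : Type} [DecidableEq (A ⊕ B)] (g1 : Equiv.Perm A) (g2 : Equiv.Perm B) (i : A) (j : B) :
    (∀ x, x ≠ i → (Equiv.sumCongr g1 g2 * Equiv.swap (Sum.inl i) (Sum.inr j) : Equiv.Perm (A ⊕ B)) (Sum.inl x) = Sum.inl (g1 x)) ∧
    (∀ x, x ≠ j → (Equiv.sumCongr g1 g2 * Equiv.swap (Sum.inl i) (Sum.inr j) : Equiv.Perm (A ⊕ B)) (Sum.inr x) = Sum.inr (g2 x)) ∧
    (Equiv.sumCongr g1 g2 * Equiv.swap (Sum.inl i) (Sum.inr j) : Equiv.Perm (A ⊕ B)) (Sum.inl i) = Sum.inr (g2 j) ∧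
    (Equiv.sumCongr g1 g2 * Equiv.swap (Sum.inl i) (Sum.inr j) : Equiv.Perm (A ⊕ B)) (Sum.inr j) = Sum.inl (g1 i) := by
  refine ⟨fun x hx => ?_, fun x hx => ?_, ?_, ?_⟩
  · rw [Equiv.Perm.mul_apply, Equiv.swap_apply_of_ne_of_ne (by simpa using hx) (by simp)]; rfl
  · rw [Equiv.Perm.mul_apply, Equiv.swap_apply_of_ne_of_ne (by simp) (by simpa using hx)]; rfl
  · simp
  · simp

lemma join_Pc {A B : Type} [Finite A] [Finite B] {c1 b1 g1 : Equiv.Perm A} {c2 b2 g2 : Equiv.Perm B}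
    (h1 : Pc c1 b1 g1) (h2 : Pc c2 b2 g2) {i : A} {j : B} (hi : Hd c1 b1 g1 i) (hj : Hd c2 b2 g2 j)
    (γ : Equiv.Perm (A ⊕ B))
    (sA : ∀ x, x ≠ i → γ (Sum.inl x) = Sum.inl (g1 x)) (sB : ∀ x, x ≠ j → γ (Sum.inr x) = Sum.inr (g2 x))
    (si : γ (Sum.inl i) = Sum.inr j) (sj : γ (Sum.inr j) = Sum.inl i) :
    Pc (Equiv.sumCongr c1 c2) (Equiv.sumCongr b1 b2) γ := by
  have gi := hi.1
  have gj := hj.1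
  have ni : ∀ x, x ≠ i → g1 x ≠ i := fun x hx h => hx (g1.injective (h.trans gi.symm))
  have nj : ∀ x, x ≠ j → g2 x ≠ j := fun x hx h => hx (g2.injective (h.trans gj.symm))
  have ti : ∀ x, c1.symm (b1 (c1 (b1 (c1 x)))) = i ↔ x = i := by
    intro x
    have e : c1.symm (b1 (c1 (b1 (c1 i)))) = i := by rw [hi.2, h1.b2, Equiv.symm_apply_apply]
    constructor
    · intro h
      have := h.trans e.symm
      simpa using this
    · rintro rfl; exact e
  have tj : ∀ x, c2.symm (b2 (c2 (b2 (c2 x)))) = j ↔ x = j := by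
    intro x
    have e : c2.symm (b2 (c2 (b2 (c2 j)))) = j := by rw [hj.2, h2.b2, Equiv.symm_apply_apply]
    constructor
    · intro h
      have := h.trans e.symm
      simpa using this
    · rintro rfl; exact e
  have kA : ∀ x, γ (Sum.inl (c1.symm (b1 (c1 (b1 (c1 (g1 x))))))) = Sum.inl (g1 (c1.symm (b1 (c1 (b1 (c1 (g1 x)))))))
      ∨ x = i := by
    intro x
    by_cases hx : x = i
    · exact Or.inr hx
    · left
      exact sA _ (fun h => ni x hx ((ti _).1 h))
  have kB : ∀ x, γ (Sum.inr (c2.symm (b2 (c2 (b2 (c2 (g2 x))))))) = Sum.inr (g2 (c2.symm (b2 (c2 (b2 (c2 (g2 x)))))))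
      ∨ x = j := by
    intro x
    by_cases hx : x = j
    · exact Or.inr hx
    · left
      exact sB _ (fun h => nj x hx ((tj _).1 h))
  have KA : ∀ x, γ ((Equiv.sumCongr c1 c2).symm (Equiv.sumCongr b1 b2 (Equiv.sumCongr c1 c2 (Equiv.sumCongr b1 b2 (Equiv.sumCongr c1 c2 (γ (Sum.inl x)))))))
      = Sum.inl (g1 (c1.symm (b1 (c1 (b1 (c1 (g1 x))))))) := by
    intro x
    by_cases hx : x = i
    · subst hx
      rw [si, gi, (ti x).2 rfl, gi, ← sj]
      congr 1
      show Sum.inr (c2.symm (b2 (c2 (b2 (c2 j))))) = _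
      rw [(tj j).2 rfl]
    · rw [sA _ hx]
      exact (kA x).resolve_right hx
  have KB : ∀ x, γ ((Equiv.sumCongr c1 c2).symm (Equiv.sumCongr b1 b2 (Equiv.sumCongr c1 c2 (Equiv.sumCongr b1 b2 (Equiv.sumCongr c1 c2 (γ (Sum.inr x)))))))
      = Sum.inr (g2 (c2.symm (b2 (c2 (b2 (c2 (g2 x))))))) := by
    intro x
    by_cases hx : x = j
    · subst hx
      rw [sj, gj, (tj x).2 rfl, gj, ← si]
      congr 1
      show Sum.inl (c1.symm (b1 (c1 (b1 (c1 i))))) = _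
      rw [(ti i).2 rfl]
    · rw [sB _ hx]
      exact (kB x).resolve_right hx
  have CA : ∀ x, Equiv.sumCongr c1 c2 (Sum.inl x) = Sum.inl (c1 x) := fun x => rfl
  have CB : ∀ x, Equiv.sumCongr c1 c2 (Sum.inr x) = Sum.inr (c2 x) := fun x => rfl
  refine ⟨?_, ?_, ?_, ?_, ?_⟩
  · rintro (x | x)
    · simp [h1.b2]
    · simp [h2.b2]
  · rintro (x | x)
    · by_cases hx : x = i
      · rw [hx, si, sj]
      · rw [sA _ hx, sA _ (ni _ hx), h1.g2]
    · by_cases hx : x = j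
      · rw [hx, sj, si]
      · rw [sB _ hx, sB _ (nj _ hx), h2.g2]
  · rintro (x | x)
    · simp [h1.y5]
    · simp [h2.y5]
  · rintro (x | x)
    · rw [KA, CA, KA, CA, CA, KA, CA, KA, h1.rel]
    · rw [KB, CB, KB, CB, CB, KB, CB, KB, h2.rel]
  · refine join_tr (c1 * g1) (c2 * g2) i j h1.tr h2.tr _ ?_ ?_ ?_ ?_
    · intro x hx; rw [Equiv.Perm.mul_apply, sA x hx]; rfl
    · intro x hx; rw [Equiv.Perm.mul_apply, sB x hx]; rfl
    · rw [Equiv.Perm.mul_apply, si, Equiv.Perm.mul_apply, gj]; rfl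
    · rw [Equiv.Perm.mul_apply, sj, Equiv.Perm.mul_apply, gi]; rfl

lemma join_Bs {A B : Type} {c1 b1 g1 : Equiv.Perm A} {c2 b2 : Equiv.Perm B} {q i : A} {j : B}
    (h : Bs c1 b1 g1 q) (hs : Sf c1 g1 q i) (γ : Equiv.Perm (A ⊕ B))
    (sA : ∀ x, x ≠ i → γ (Sum.inl x) = Sum.inl (g1 x)) 
    (si : γ (Sum.inl i) = Sum.inr j) :
    Bs (Equiv.sumCongr c1 c2) (Equiv.sumCongr b1 b2) γ (Sum.inl q) := by
  obtain ⟨s1, s2, s3, s4⟩ := hs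
  have CA : ∀ x, Equiv.sumCongr c1 c2 (Sum.inl x) = Sum.inl (c1 x) := fun x => rfl
  have CA' : ∀ x, (Equiv.sumCongr c1 c2).symm (Sum.inl x) = Sum.inl (c1.symm x) := fun x => rfl
  have BA : ∀ x, Equiv.sumCongr b1 b2 (Sum.inl x) = Sum.inl (b1 x) := fun x => rfl
  refine ⟨?_, ?_, ?_, ?_, ?_, ?_⟩
  · rw [BA, h.bq]
  · rw [sA _ s1.symm, h.gq]
  · rw [CA]; simpa using h.cq
  · rw [CA, sA _ s2.symm, CA, BA, CA, h.yp]
  · rw [CA', sA _ s3.symm, CA, sA _ s4.symm, CA, BA, CA, BA, h.xq, CA]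
  · rw [CA, CA, sA _ s2.symm, CA]
    by_cases hx : c1 (c1 q) = i
    · rw [hx, si]; exact Sum.inr_ne_inl
    · rw [sA _ hx, CA, BA, CA, BA]
      simpa using h.xp

lemma join_fin {m n : ℕ} (h1 : HPc m) (h2 : EN n) : FIN (m + n) := by
  classical
  obtain ⟨A, _, e1, c1, b1, g1, p1, q, h, k, hh, s⟩ := h1
  obtain ⟨B, _, e2, c2, b2, g2, p2, h', hh'⟩ := h2
  obtain ⟨sA, sB, si, sj⟩ := join_swap g1 g2 h h'
  rw [hh.1] at sj
  rw [hh'.1] at si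
  exact ⟨A ⊕ B, inferInstance, by rw [Nat.card_sum, e1, e2], _, _, _, join_Pc p1 p2 hh hh' _ sA sB si sj,
    _, join_Bs k s _ sA si⟩

lemma join_du {m n : ℕ} (h1 : HPc m) (h2 : DU n) : HPc (m + n) := by
  classical
  obtain ⟨A, _, e1, c1, b1, g1, p1, q, h, k, hh, s⟩ := h1
  obtain ⟨B, _, e2, c2, b2, g2, p2, h', h'', hne, hh', hh''⟩ := h2
  obtain ⟨sA, sB, si, sj⟩ := join_swap g1 g2 h h'
  rw [hh.1] at sj
  rw [hh'.1] at si
  refine ⟨A ⊕ B, inferInstance, by rw [Nat.card_sum, e1, e2], _, _, _, join_Pc p1 p2 hh hh' _ sA sB si sj,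
    _, Sum.inr h'', join_Bs k s _ sA si, ⟨?_, ?_⟩, ?_, ?_, ?_, ?_⟩
  · rw [sB _ hne.symm, hh''.1]
  · simpa using hh''.2
  · simp
  · simp
  · simp
  · have : (Equiv.sumCongr c1 c2).symm (Sum.inl q) = Sum.inl (c1.symm q) := rfl
    rw [this, sA _ s.2.2.1.symm]
    simp

lemma hp_add {n : ℕ} (h : HPc n) (k : ℕ) : HPc (n + 10 * k) := by
  induction k with
  | zero => exact h
  | succ k ih => exact (join_du ih duD10 : HPc (n + 10 * k + 10))

lemma fin_odd (P : ℕ) (hP : 5 ≤ P) (h2 : P % 2 = 1) : FIN P := by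
  by_cases h : P < 11
  · interval_cases P <;> first | omega | exact finP5 | exact finP7 | exact finP9
  · have : P % 10 = 1 ∨ P % 10 = 3 ∨ P % 10 = 5 ∨ P % 10 = 7 ∨ P % 10 = 9 := by omega
    rcases this with e | e | e | e | e
    · have := join_fin (hp_add hpA10 ((P - 11) / 10)) enE1
      convert this using 1; omega
    · have := join_fin (hp_add hpA12 ((P - 13) / 10)) enE1
      convert this using 1; omega
    · have := join_fin (hp_add hpA10 ((P - 15) / 10)) enE5
      convert this using 1; omega
    · have := join_fin (hp_add hpA12 ((P - 17) / 10)) enE5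
      convert this using 1; omega
    · have := join_fin (hp_add hpA13 ((P - 19) / 10)) enE6
      convert this using 1; omega

lemma caseIII {P : ℕ} (hP : 5 ≤ P) (hP2 : P % 2 = 1) : ResiduallyFinite (Artin3 4 5 P) := by
  obtain ⟨Ω, _, hcard, c, β, γ, hp, q, hb⟩ := fin_odd P hP hP2
  classical
  have := Fintype.ofFinite Ω
  set Y : Equiv.Perm Ω := c * β with hY
  set Z : Equiv.Perm Ω := c * γ with hZ
  have bb : β * β = 1 := Equiv.ext hp.b2
  have gg : γ * γ = 1 := Equiv.ext hp.g2
  have binv : β⁻¹ = β := inv_eq_of_mul_eq_one_left bb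
  have ginv : γ⁻¹ = γ := inv_eq_of_mul_eq_one_left gg
  have Y5 : Y ^ 5 = 1 := Equiv.ext fun i => hp.y5 i
  have hcyc : Z.IsCycleOn ((Finset.univ : Finset Ω) : Set Ω) := by
    refine ⟨by simpa using Equiv.bijective Z, fun x _ y _ => ?_⟩
    obtain ⟨n, hn⟩ := hp.tr x y
    exact ⟨n, by simpa using hn⟩
  have hcard' : (Finset.univ : Finset Ω).card = P := by
    rw [← hcard, Nat.card_eq_fintype_card, Finset.card_univ]
  have hpow : ∀ x n, (Z ^ n) x = x ↔ P ∣ n := by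
    intro x n
    rw [hcyc.pow_apply_eq (Finset.mem_univ x), hcard']
  have ZP : Z ^ P = 1 := Equiv.ext fun x => (hpow x P).2 dvd_rfl
  have hne : ∀ i j, i < j → j < i + P → (Z ^ i) q ≠ (Z ^ j) q := by
    intro i j h1 h2 h
    obtain ⟨k, rfl⟩ := Nat.exists_eq_add_of_lt h1
    rw [show i + k + 1 = i + (k + 1) by ring, pow_add, Equiv.Perm.mul_apply] at h
    have h3 := (hpow _ _).1 ((Z ^ i).injective h).symm
    have := Nat.le_of_dvd (by omega) h3
    omega
  have ec : Z * γ = c := by rw [hZ, mul_assoc, gg, mul_one]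
  have ec' : Y * β = c := by rw [hY, mul_assoc, bb, mul_one]
  set b : Equiv.Perm Ω := β * c * β with hbdef
  set a : Equiv.Perm Ω := Z ^ 2 * c⁻¹ with ha
  have ey : c * b = Y ^ 2 := by rw [hbdef, hY, pow_two]; group
  have ez : a * c = Z ^ 2 := by rw [ha]; group
  set r := c q with hr
  have Zq : Z q = r := by rw [hZ, Equiv.Perm.mul_apply, hb.gq]
  have Yq : Y q = r := by rw [hY, Equiv.Perm.mul_apply, hb.bq]
  set p := Z r with hpdef
  have Yp : Y p = q := hb.yp
  have Zp : p = (Z ^ 2) q := by rw [pow_two, Equiv.Perm.mul_apply, Zq]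
  have bp : b p = q := by
    have : b p = β (Y p) := rfl
    rw [this, Yp, hb.bq]
  have ar : a r = p := by
    rw [Zp, ha, Equiv.Perm.mul_apply, hr]; simp
  have xq : (b * a) q = r := hb.xq
  have xr : (b * a) r = q := by rw [Equiv.Perm.mul_apply, ar, bp]
  have hqr : q ≠ r := fun h => hb.cq h.symm
  have hpq : p ≠ q := by
    intro h
    have := hne 0 2 (by omega) (by omega)
    rw [← Zp] at this
    exact this h.symm
  have hpr : p ≠ r := by
    intro h
    have := hne 1 2 (by omega) (by omega)
    rw [← Zp, pow_one, Zq] at this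
    exact this h.symm
  have xp : (b * a) p ≠ p := by
    have : (b * a) p = β (c (β (c (γ (c (c q)))))) := by
      rw [hbdef, ha, hZ]
      simp only [Equiv.Perm.mul_apply, pow_two]
      have : c⁻¹ p = γ r := by rw [Equiv.Perm.inv_eq_iff_eq]; rfl
      rw [this, hp.g2]
    rw [this]; exact hb.xp
  have h1 : Br a b 4 := by
    have hk : (c * (γ * c⁻¹ * β * c * β * c * γ)) ^ 2 = ((γ * c⁻¹ * β * c * β * c * γ) * c) ^ 2 := by
      refine Equiv.ext fun i => ?_
      simpa [pow_two] using hp.rel i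
    have e1 : a = (c * γ) * c * (c * γ)⁻¹ := by
      rw [ha, hZ, mul_inv_rev, ginv, pow_two]; group
    have e2 : b = (c * γ) * (γ * c⁻¹ * β * c * β * c * γ) * (c * γ)⁻¹ := by
      rw [hbdef, mul_inv_rev, ginv]
      calc β * c * β = (c * (1 * c⁻¹)) * β * c * β * c * 1 * c⁻¹ := by group
        _ = _ := by rw [← gg]; group
    have h0 : Br c (γ * c⁻¹ * β * c * β * c * γ) 4 := by
      rw [Br, if_pos (by norm_num)]; exact hk
    rw [e1, e2]
    exact h0.map (MulAut.conj (c * γ)).toMonoidHom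
  have hx2 : ((b * a) ^ 2) p = p := by
    have e := (Br_even (by norm_num)).1 h1
    have := congrArg (fun f : Equiv.Perm Ω => f p) e
    simp only [Equiv.Perm.mul_apply] at this
    apply b.injective
    rw [show (4 / 2 : ℕ) = 2 from rfl] at this
    rw [← this, bp, pow_two, Equiv.Perm.mul_apply, xq, xr]
  refine good_rf (M := 4) (N := 5) (P := P) (by norm_num) (by norm_num) (by omega) a b c h1 ?_ ?_ p q r hpq hqr hpr bp rfl ar ?_ ?_ ?_
  · rw [Br_odd (by norm_num), ey]
    have : (Y ^ 2) ^ 2 = Y⁻¹ := by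
      rw [eq_inv_iff_mul_eq_one, ← pow_mul, ← pow_succ]; exact Y5
    show (Y ^ 2) ^ 3 = c * (Y ^ 2) ^ 2 * c
    rw [this, ← pow_mul, show 2 * 3 = 5 + 1 from rfl, pow_succ, Y5, one_mul, hY, mul_inv_rev, binv]
    group
  · rw [Br_odd hP2, ez]
    have e : (Z ^ 2) ^ (P / 2) = Z⁻¹ := by
      rw [eq_inv_iff_mul_eq_one, ← pow_mul, ← pow_succ, show 2 * (P / 2) + 1 = P by omega, ZP]
    rw [pow_succ, e, ha]
    have : Z⁻¹ * c = γ := by rw [← ec]; group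
    have e3 : c⁻¹ = γ * Z⁻¹ := by rw [← ec, mul_inv_rev, ginv]
    rw [e3]
    calc Z⁻¹ * Z ^ 2 = Z ^ 2 * 1 * Z⁻¹ := by group
      _ = _ := by rw [← gg]; group
  · refine ⟨fun h => by norm_num at h, fun _ => ⟨hx2, ?_, by intro i h0 h1; omega⟩⟩
    intro i h0 h1
    obtain rfl : i = 1 := by omega
    rw [pow_one]
    exact ⟨xp, fun h => hpr ((b * a).injective (h.trans xr.symm)), fun h => hpq ((b * a).injective (h.trans xq.symm))⟩
  · rw [ey]
    have Yr : (Y ^ 4) r = q := by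
      rw [← Yq, ← Equiv.Perm.mul_apply, ← pow_succ, Y5]; rfl
    have Y5' : ∀ x, Y (Y (Y (Y (Y x)))) = x := fun x => hp.y5 x
    have n1 : Y q ≠ q := by rw [Yq]; exact hqr.symm
    have n2 : ∀ x, Y x ≠ x → Y (Y x) ≠ x := by
      intro x hx h
      apply hx
      have := Y5' x
      rwa [h, h] at this
    have n3 : ∀ x, Y x ≠ x → Y (Y (Y x)) ≠ x := by
      intro x hx h
      apply n2 x hx
      have := Y5' x
      rwa [h] at this
    have n4 : ∀ x, Y x ≠ x → Y (Y (Y (Y x))) ≠ x := by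
      intro x hx h
      apply hx
      have := Y5' x
      rwa [h] at this
    have n1' : Y p ≠ p := by rw [Yp]; exact hpq.symm
    have n1'' : Y r ≠ r := by
      rw [← Yq]; exact fun h => n1 (Y.injective h)
    refine ⟨fun _ => ⟨by rw [← pow_mul]; exact Yr, ?_⟩, fun h => by norm_num at h⟩
    intro i h0 h1
    obtain rfl : i = 1 := by omega
    rw [pow_one, pow_two]
    simp only [Equiv.Perm.mul_apply]
    refine ⟨⟨n2 q n1, ?_, ?_⟩, ⟨?_, n2 r n1'', ?_⟩⟩
    · rw [Yq, ← Yq]; exact fun h => n1 (Y.injective h)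
    · rw [← Yp]; exact n3 p n1'
    · rw [← Yq]; exact n3 q n1
    · rw [← Yq, ← Yp]; exact n4 p n1'
  · rw [ez]
    refine ⟨fun _ => ⟨?_, ?_⟩, fun h => by omega⟩
    · rw [Zp, ← Zq, ← pow_mul, ← Equiv.Perm.mul_apply, ← pow_add, show 2 * (P / 2) + 2 = P + 1 by omega, pow_succ, ZP]
      rfl
    intro i h0 h1
    have m1 : ((Z ^ 2) ^ i) r = (Z ^ (2 * i + 1)) q := by
      rw [← Zq, ← pow_mul, pow_succ]; rfl
    have m2 : ((Z ^ 2) ^ i) p = (Z ^ (2 * i + 2)) q := by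
      rw [Zp, ← pow_mul, pow_add]; rfl
    have k0 : (Z ^ 0) q = q := rfl
    have k1 : (Z ^ 1) q = r := by rw [pow_one, Zq]
    rw [m1, m2]
    refine ⟨⟨?_, ?_, ?_⟩, ⟨?_, ?_, ?_⟩⟩
    · rw [← k1]; exact (hne _ _ (by omega) (by omega)).symm
    · rw [Zp]; exact (hne _ _ (by omega) (by omega)).symm
    · nth_rw 2 [← k0]; exact (hne _ _ (by omega) (by omega)).symm
    · rw [← k1]; exact (hne _ _ (by omega) (by omega)).symm
    · rw [Zp]; exact (hne _ _ (by omega) (by omega)).symm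
    · nth_rw 2 [← k0]; exact (hne _ _ (by omega) (by omega)).symm

lemma ret_of_at {F : Type*} {M : ℕ} (hM : 4 ≤ M) (a b : Equiv.Perm F) (At : ℤ → F → Prop) (p q r : F)
    (ha : ∀ n f, At n f → At (-1 - n) (a f)) (hb : ∀ n f, At n f → At (1 - n) (b f))
    (hinj : ∀ n m f g, At n f → At m g → (f = g ↔ (M : ℤ) ∣ n - m))
    (h0 : At 0 p) (h1 : At 1 q) (h2 : At (-1) r) : Ret (b * a) p q r M := by
  have hx : ∀ (i : ℕ) n f, At n f → At (n + 2 * i) (((b * a) ^ i) f) := by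
    intro i
    induction i with
    | zero => intro n f h; simpa using h
    | succ i ih =>
      intro n f h
      rw [pow_succ', Equiv.Perm.mul_apply, Equiv.Perm.mul_apply]
      have := hb _ _ (ha _ _ (ih n f h))
      convert this using 1
      push_cast; ring
  have nd : ∀ d : ℤ, 0 < d → d < M → ¬ (M : ℤ) ∣ d := by
    intro d hd hd' h
    have := Int.le_of_dvd hd h
    omega
  have pi := fun i => hx i 0 p h0
  have qi := fun i => hx i 1 q h1
  refine ⟨fun h => ⟨?_, fun i hi hi' => ⟨⟨?_, ?_, ?_⟩, ⟨?_, ?_, ?_⟩⟩⟩, fun h => ⟨?_, fun i hi hi' => ⟨?_, ?_, ?_⟩, fun i hi hi' => ⟨?_, ?_, ?_⟩⟩⟩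
  · rw [hinj _ _ _ _ (qi _) h0]
    refine ⟨1, ?_⟩; omega
  · rw [Ne, hinj _ _ _ _ (pi _) h0]; apply nd <;> omega
  · rw [Ne, hinj _ _ _ _ (pi _) h1]; apply nd <;> omega
  · rw [Ne, hinj _ _ _ _ (pi _) h2]; apply nd <;> omega
  · rw [Ne, hinj _ _ _ _ (qi _) h0]; apply nd <;> omega
  · rw [Ne, hinj _ _ _ _ (qi _) h1]; apply nd <;> omega
  · rw [Ne, hinj _ _ _ _ (qi _) h2]; apply nd <;> omega
  · rw [hinj _ _ _ _ (pi _) h0]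
    refine ⟨1, ?_⟩; omega
  · rw [Ne, hinj _ _ _ _ (pi _) h0]; apply nd <;> omega
  · rw [Ne, hinj _ _ _ _ (pi _) h1]; apply nd <;> omega
  · rw [Ne, hinj _ _ _ _ (pi _) h2]; apply nd <;> omega
  · rw [Ne, hinj _ _ _ _ (qi _) h0]; apply nd <;> omega
  · rw [Ne, hinj _ _ _ _ (qi _) h1]; apply nd <;> omega
  · rw [Ne, hinj _ _ _ _ (qi _) h2]; apply nd <;> omega

/-- permutation action of linear automorphisms on sets of vectors -/
noncomputable def rho (K V : Type*) [Field K] [AddCommGroup V] [Module K V] :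
    (V ≃ₗ[K] V) →* Equiv.Perm (Set V) where
  toFun f := Equiv.Set.congr f.toEquiv
  map_one' := Equiv.ext fun s => by
    show Set.image (fun x => x) s = s
    simp
  map_mul' f g := Equiv.ext fun s => by
    show Set.image (fun x => f (g x)) s = Set.image f (Set.image g s)
    rw [Set.image_image]

/-- the pair of opposite vectors -/
def pm {V : Type*} [AddCommGroup V] (v : V) : Set V := {v, -v}

lemma pm_neg {V : Type*} [AddCommGroup V] (v : V) : pm (-v) = pm v := by
  rw [pm, pm, neg_neg, Set.pair_comm]

lemma rho_pm {K V : Type*} [Field K] [AddCommGroup V] [Module K V] (f : V ≃ₗ[K] V) (v : V) :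
    rho K V f (pm v) = pm (f v) := by
  show Set.image f {v, -v} = {f v, - f v}
  rw [Set.image_pair, map_neg]

lemma pm_eq {V : Type*} [AddCommGroup V] {v w : V} : pm v = pm w ↔ v = w ∨ v = -w := by
  constructor
  · intro h
    have : v ∈ pm w := h ▸ (by simp [pm] : v ∈ pm v)
    simpa [pm] using this
  · rintro (rfl | rfl)
    · rfl
    · exact pm_neg w

section
variable {K V Λ : Type*} [Field K] [AddCommGroup V] [Module K V] [AddCommGroup Λ] [Module K Λ]

/-- abstract dihedral pair -/
lemma dih {ι : Type*} {M : ℕ} (hM : 4 ≤ M) (a b : V ≃ₗ[K] V) (L L' : ι → V → K) (ψ : V → Λ) (ζ : ι → K)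
    (hinj : ∀ v w, (∀ j, L j v = L j w) → (∀ j, L' j v = L' j w) → ψ v = ψ w → v = w)
    (aa : ∀ v, a (a v) = v) (bb : ∀ v, b (b v) = v)
    (La : ∀ j v, L j (a v) = ζ j ^ 2 * L' j v) (La' : ∀ j v, ζ j ^ 2 * L' j (a v) = L j v)
    (Lb : ∀ j v, L j (b v) = L' j v) (Lb' : ∀ j v, L' j (b v) = L j v)
    (Ln : ∀ j v, L j (-v) = - L j v)
    (ψa : ∀ v, ψ (a v) = ψ v) (ψb : ∀ v, ψ (b v) = ψ v)
    (hz : ∀ j, ζ j ^ M = 1) (j0 j1 : ι) (hj0 : IsPrimitiveRoot (ζ j0) M) (hj1 : ζ j1 = ζ j0 ^ 2)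
    (h2 : (2 : K) ≠ 0) (y : ι → K) (y0 : y j0 ≠ 0) (y1 : y j1 ≠ 0)
    (hz0 : 1 + ζ j0 ≠ 0) (hz1 : 1 + ζ j1 ≠ 0)
    (p q r : V) (Lp : ∀ j, L j p = y j * (1 + ζ j)) (Lp' : ∀ j, ζ j * L' j p = y j * (1 + ζ j))
    (hq : b p = q ∨ b p = -q) (hr : a r = p ∨ a r = -p) :
    Br a b M ∧ Ret (rho K V b * rho K V a) (pm p) (pm q) (pm r) M := by
  have zne : ∀ j, ζ j ≠ 0 := by
    intro j h
    have := hz j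
    rw [h, zero_pow (by omega)] at this
    exact zero_ne_one this
  have Lx : ∀ (i : ℕ) j v, ζ j ^ (2 * i) * L j (((b * a) ^ i) v) = L j v := by
    intro i
    induction i with
    | zero => intro j v; simp
    | succ i ih =>
      intro j v
      rw [pow_succ', LinearEquiv.mul_apply, LinearEquiv.mul_apply, Lb, ← ih j v, ← La']
      ring
  have Lx' : ∀ (i : ℕ) j v, L' j (((b * a) ^ i) v) = ζ j ^ (2 * i) * L' j v := by
    intro i
    induction i with
    | zero => intro j v; simp
    | succ i ih =>
      intro j v
      rw [pow_succ', LinearEquiv.mul_apply, LinearEquiv.mul_apply, Lb', La, ih]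
      ring
  have ψx : ∀ (i : ℕ) v, ψ (((b * a) ^ i) v) = ψ v := by
    intro i
    induction i with
    | zero => intro v; simp
    | succ i ih =>
      intro v
      rw [pow_succ', LinearEquiv.mul_apply, LinearEquiv.mul_apply, ψb, ψa, ih]
  have xone : ∀ i : ℕ, (∀ j, ζ j ^ (2 * i) = 1) → (b * a) ^ i = 1 := by
    intro i h
    refine LinearEquiv.ext fun v => hinj _ _ (fun j => ?_) (fun j => ?_) (ψx i v)
    · have := Lx i j v
      rwa [h, one_mul] at this
    · have := Lx' i j v
      rwa [h, one_mul] at this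
  have aa' : a * a = 1 := LinearEquiv.ext aa
  have bb' : b * b = 1 := LinearEquiv.ext bb
  have ainv : a⁻¹ = a := inv_eq_of_mul_eq_one_left aa'
  have binv : b⁻¹ = b := inv_eq_of_mul_eq_one_left bb'
  constructor
  · rcases Nat.mod_two_eq_zero_or_one M with h | h
    · rw [Br_even h, xone (M / 2) (fun j => by rw [show 2 * (M / 2) = M by omega, hz])]
      simp
    · rw [Br_odd h]
      have e : b * (b * a) ^ (M / 2) * b = ((b * a) ^ (M / 2))⁻¹ := by
        have := map_pow (MulAut.conj b) (b * a) (M / 2)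
        simp only [MulAut.conj_apply, binv] at this
        rw [this, ← inv_pow, mul_inv_rev, ainv, binv, ← mul_assoc, bb', one_mul]
      rw [e, eq_inv_iff_mul_eq_one, ← pow_add, show M / 2 + 1 + M / 2 = M by omega]
      exact xone M (fun j => by rw [mul_comm, pow_mul, hz, one_pow])
  · let At : ℤ → V → Prop := fun n w => ψ w = ψ p ∧ ∀ j, L j w = y j * (1 + ζ j) * ζ j ^ (-n) ∧
      L' j w = y j * (1 + ζ j) * ζ j ^ (n - 1)
    have Ata : ∀ n w, At n w → At (-1 - n) (a w) := by
      rintro n w ⟨h1, h2⟩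
      refine ⟨by rw [ψa, h1], fun j => ⟨?_, ?_⟩⟩
      · rw [La, (h2 j).2, show -(-1 - n) = (n - 1) + 2 by ring, zpow_add₀ (zne j)]
        norm_cast; ring
      · apply mul_left_cancel₀ (pow_ne_zero 2 (zne j))
        rw [La', (h2 j).1, show -1 - n - 1 = -n + (-2) by ring, zpow_add₀ (zne j)]
        have := zne j
        have e : ζ j ^ (-2 : ℤ) = (ζ j ^ 2)⁻¹ := by rw [zpow_neg]; norm_cast
        rw [e]
        field_simp
    have Atb : ∀ n w, At n w → At (1 - n) (b w) := by
      rintro n w ⟨h1, h2⟩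
      refine ⟨by rw [ψb, h1], fun j => ⟨?_, ?_⟩⟩
      · rw [Lb, (h2 j).2]; congr 2; ring
      · rw [Lb', (h2 j).1]; congr 2; ring
    have At0 : At 0 p := by
      refine ⟨rfl, fun j => ⟨by simp [Lp], ?_⟩⟩
      rw [mul_assoc, ← mul_assoc, ← Lp', zero_sub, zpow_neg_one, mul_comm]
      field_simp [zne j]
    have hmod : ∀ n m : ℤ, (M : ℤ) ∣ n - m → ∀ j, ζ j ^ n = ζ j ^ m := by
      rintro n m ⟨t, ht⟩ j
      rw [show n = M * t + m by omega, zpow_add₀ (zne j), zpow_mul, zpow_natCast, hz, one_zpow, one_mul]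
    apply ret_of_at hM (rho K V a) (rho K V b) (fun n S => ∃ w, S = pm w ∧ At n w)
    · rintro n f ⟨w, rfl, h⟩
      exact ⟨a w, rho_pm _ _, Ata n w h⟩
    · rintro n f ⟨w, rfl, h⟩
      exact ⟨b w, rho_pm _ _, Atb n w h⟩
    · rintro n m f g ⟨w, rfl, h⟩ ⟨w', rfl, h'⟩
      constructor
      · intro hh
        rw [pm_eq] at hh
        have key : ∀ σ : K, (∀ j, L j w = σ * L j w') → (σ = 1 ∨ σ = -1) → (M : ℤ) ∣ n - m := by
          intro σ hσ hσ'
          have k1 : ∀ j, y j ≠ 0 → 1 + ζ j ≠ 0 → ζ j ^ (m - n) = σ := by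
            intro j hy hz
            have := hσ j
            rw [(h.2 j).1, (h'.2 j).1] at this
            have e : ζ j ^ (-n) = σ * ζ j ^ (-m) := by
              apply mul_left_cancel₀ (mul_ne_zero hy hz)
              rw [this]; ring
            rw [show m - n = -n + m by ring, zpow_add₀ (zne j), e, mul_assoc, ← zpow_add₀ (zne j)]
            simp
          have k0 := k1 j0 y0 hz0
          have k2 := k1 j1 y1 hz1
          rw [hj1, ← zpow_natCast, zpow_comm, k0] at k2
          have hs : σ = 1 := by
            rcases hσ' with h | h
            · exact h
            · rw [h] at k2
              norm_num at k2
              exact absurd (by linear_combination k2 : (2 : K) = 0) h2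
          rw [hs] at k0
          rw [hj0.zpow_eq_one_iff_dvd] at k0
          rw [← neg_sub, dvd_neg]; exact k0
        rcases hh with hh | hh
        · exact key 1 (fun j => by rw [hh, one_mul]) (Or.inl rfl)
        · exact key (-1) (fun j => by rw [hh, Ln]; ring) (Or.inr rfl)
      · intro hd
        congr 1
        refine hinj _ _ (fun j => ?_) (fun j => ?_) (h.1.trans h'.1.symm)
        · rw [(h.2 j).1, (h'.2 j).1, zpow_neg, zpow_neg, hmod n m hd]
        · rw [(h.2 j).2, (h'.2 j).2, hmod (n - 1) (m - 1) (by simpa using hd)]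
    · exact ⟨p, rfl, At0⟩
    · refine ⟨b p, ?_, by simpa using Atb 0 p At0⟩
      rcases hq with h | h <;> rw [h]
      exact (pm_neg _).symm
    · refine ⟨a p, ?_, by simpa using Ata 0 p At0⟩
      rcases hr with h | h
      · rw [← h, aa]
      · rw [← neg_eq_iff_eq_neg.mpr h, map_neg, aa, pm_neg]
end

section
variable {K V Λ : Type*} [Field K] [AddCommGroup V] [Module K V] [AddCommGroup Λ] [Module K Λ]

lemma pair {k : ℕ} {M : ℕ} (hM : 4 ≤ M) (a b : V ≃ₗ[K] V) (fa fb fc : V →ₗ[K] Λ)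
    (W : Λ ≃ₗ[K] (Fin k → K)) (T A B : Λ →ₗ[K] Λ) (ζ : Fin k → K)
    (hinj : ∀ v w, fa v = fa w → fb v = fb w → fc v = fc w → v = w)
    (aa : ∀ v, a (a v) = v) (bb : ∀ v, b (b v) = v)
    (a1 : ∀ v, fa (a v) = - fa v) (a2 : ∀ v, fb (a v) = fb v - T (fa v)) (a3 : ∀ v, fc (a v) = fc v - A (fa v))
    (b1 : ∀ v, fb (b v) = - fb v) (b2 : ∀ v, fa (b v) = fa v - T (fb v)) (b3 : ∀ v, fc (b v) = fc v - B (fb v))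
    (hT : ∀ l j, W (T l) j = - (ζ j + (ζ j)⁻¹) * W l j)
    (hz : ∀ j, ζ j ^ M = 1) (hz2 : ∀ j, ζ j ^ 2 ≠ 1)
    (j0 j1 : Fin k) (hj0 : IsPrimitiveRoot (ζ j0) M) (hj1 : ζ j1 = ζ j0 ^ 2)
    (h2 : (2 : K) ≠ 0) (u : Λ) (hu : ∀ j, W u j ≠ 0)
    (p q r : V) (pa : fa p = u) (pb : fb p = u)
    (hq : b p = q ∨ b p = -q) (hr : a r = p ∨ a r = -p) :
    Br a b M ∧ Ret (rho K V b * rho K V a) (pm p) (pm q) (pm r) M := by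
  have zne : ∀ j, ζ j ≠ 0 := by
    intro j h
    have := hz j
    rw [h, zero_pow (by omega)] at this
    exact zero_ne_one this
  have z1 : ∀ j, 1 + ζ j ≠ 0 := by
    intro j h
    apply hz2 j
    linear_combination (ζ j - 1) * h
  have finΛ : Module.Finite K Λ := Module.Finite.equiv W.symm
  let D : Λ →ₗ[K] Λ := (4 : K) • LinearMap.id - T ∘ₗ T
  have hD : ∀ l, D l = (4 : K) • l - T (T l) := fun l => rfl
  have Dinj : Function.Injective D := by
    rw [injective_iff_map_eq_zero]
    intro l hl
    apply W.injective
    ext j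
    have := congrFun (congrArg W hl) j
    rw [hD, map_sub, map_smul, map_zero] at this
    simp only [Pi.sub_apply, Pi.smul_apply, Pi.zero_apply, hT, smul_eq_mul] at this
    rw [map_zero, Pi.zero_apply]
    have e : (ζ j ^ 2 - 1) ^ 2 * W l j = 0 := by
      have hne := zne j
      field_simp at this
      linear_combination (-1) * this
    exact (mul_eq_zero.mp e).resolve_left (pow_ne_zero _ (sub_ne_zero.mpr (hz2 j)))
  let E := LinearEquiv.ofInjectiveEndo D Dinj
  have E1 : ∀ l, E l = D l := fun l => rfl
  have E2 : ∀ l, (4 : K) • E.symm l - T (T (E.symm l)) = l := by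
    intro l
    rw [← hD, ← E1, LinearEquiv.apply_symm_apply]
  have E3 : ∀ l, E.symm (T l) = T (E.symm l) := by
    intro l
    rw [LinearEquiv.symm_apply_eq, E1, hD]
    nth_rw 1 [← E2 l]
    simp only [map_sub, map_smul]
  let ψ : V → Λ := fun v => fc v + (-((2 : K) • A (E.symm (fa v))) + B (T (E.symm (fa v)))) +
    (-((2 : K) • B (E.symm (fb v))) + A (T (E.symm (fb v))))
  have hinj' : ∀ v w, fa v = fa w → fb v = fb w → ψ v = ψ w → v = w := by
    intro v w h1 h2 h3
    refine hinj v w h1 h2 ?_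
    simp only [ψ] at h3
    rw [h1, h2] at h3
    exact add_right_cancel (add_right_cancel h3)
  refine dih hM a b (fun j v => W (fa v) j + ζ j * W (fb v) j) (fun j v => W (fa v) j + (ζ j)⁻¹ * W (fb v) j)
    ψ ζ ?_ aa bb ?_ ?_ ?_ ?_ ?_ ?_ ?_ hz j0 j1 hj0 hj1 h2 (W u) (hu _) (hu _) (z1 _) (z1 _) p q r ?_ ?_ hq hr
  · intro v w h1 h2 h3
    have hb' : ∀ j, W (fb v) j = W (fb w) j := by
      intro j
      have e1 := h1 j
      have e2 := h2 j
      have hne := zne j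
      have e3 : (ζ j ^ 2 - 1) * (W (fb v) j - W (fb w) j) = 0 := by
        field_simp at e2
        linear_combination ζ j * e1 - e2
      exact sub_eq_zero.mp ((mul_eq_zero.mp e3).resolve_left (sub_ne_zero.mpr (hz2 j)))
    refine hinj' v w (W.injective (funext fun j => ?_)) (W.injective (funext hb')) h3
    have e1 := h1 j
    simp only [hb'] at e1
    exact add_right_cancel e1
  · intro j v
    simp only [a1, a2, map_neg, map_sub, Pi.neg_apply, Pi.sub_apply, hT]
    have hne := zne j
    field_simp
    ring
  · intro j v
    simp only [a1, a2, map_neg, map_sub, Pi.neg_apply, Pi.sub_apply, hT]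
    have hne := zne j
    field_simp
    ring
  · intro j v
    simp only [b1, b2, map_neg, map_sub, Pi.neg_apply, Pi.sub_apply, hT]
    have hne := zne j
    field_simp
    ring
  · intro j v
    simp only [b1, b2, map_neg, map_sub, Pi.neg_apply, Pi.sub_apply, hT]
    have hne := zne j
    field_simp
    ring
  · intro j v
    simp only [map_neg, Pi.neg_apply]
    ring
  · intro v
    have := congrArg A (E2 (fa v))
    simp only [map_sub, map_smul] at this
    simp only [ψ, a1, a2, a3, map_neg, map_sub, E3, smul_sub, smul_neg]
    rw [← this]
    module
  · intro v
    have := congrArg B (E2 (fb v))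
    simp only [map_sub, map_smul] at this
    simp only [ψ, b1, b2, b3, map_neg, map_sub, E3, smul_sub, smul_neg]
    rw [← this]
    module
  · intro j
    simp only [pa, pb]; ring
  · intro j
    simp only [pa, pb]
    have hne := zne j
    field_simp
    ring
end

lemma add_inv_ne {K : Type*} [Field K] {x y : K} (hx : x ≠ 0) (hy : y ≠ 0) (h1 : x ≠ y) (h2 : x * y ≠ 1) :
    -(x + x⁻¹) - -(y + y⁻¹) ≠ 0 := by
  intro h
  have : (x - y) * (x * y - 1) = 0 := by
    field_simp at h
    linear_combination -h
  rcases mul_eq_zero.mp this with h | h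
  · exact h1 (sub_eq_zero.mp h)
  · exact h2 (sub_eq_zero.mp h)

lemma prim_add_inv_ne {K : Type*} [Field K] {ζ : K} {M : ℕ} (h : IsPrimitiveRoot ζ M) {i j : ℕ} (hi : 0 < i)
    (hij : i < j) (hj : i + j < M) : -(ζ ^ i + (ζ ^ i)⁻¹) - -(ζ ^ j + (ζ ^ j)⁻¹) ≠ 0 := by
  have h0 : ζ ≠ 0 := h.ne_zero (by omega)
  apply add_inv_ne (pow_ne_zero _ h0) (pow_ne_zero _ h0)
  · intro e
    have := h.pow_inj (by omega) (by omega) e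
    omega
  · rw [← pow_add]
    exact h.pow_ne_one_of_pos_of_lt (by omega) hj

lemma diagC {K Λ : Type*} [Field K] [AddCommGroup Λ] [Module K Λ] {k : ℕ} (W : Λ ≃ₗ[K] (Fin k → K)) (c : Fin k → K) :
    ∃ C : Λ →ₗ[K] Λ, ∀ l j, W (C l) j = c j * W l j := by
  refine ⟨W.symm.toLinearMap ∘ₗ (LinearMap.pi fun j => c j • LinearMap.proj j) ∘ₗ W.toLinearMap, fun l j => ?_⟩
  simp

lemma eig2 {K : Type*} [Field K] {M : ℕ} (hM : 5 ≤ M) {ζ : K} (h : IsPrimitiveRoot ζ M) :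
    ∃ (W : (Fin 2 → K) ≃ₗ[K] (Fin 2 → K)) (C : (Fin 2 → K) →ₗ[K] (Fin 2 → K)),
      (∀ l (j : Fin 2), W (C l) j = -(ζ ^ (j.val + 1) + (ζ ^ (j.val + 1))⁻¹) * W l j) ∧
      (∀ j, W ![1, 0] j = 1) ∧ C ![1, 0] = ![0, 1] := by
  set c : Fin 2 → K := fun j => -(ζ ^ (j.val + 1) + (ζ ^ (j.val + 1))⁻¹) with hc
  let W0 : (Fin 2 → K) →ₗ[K] (Fin 2 → K) :=
    LinearMap.pi fun j => LinearMap.proj 0 + c j • LinearMap.proj 1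
  have hW0 : ∀ l j, W0 l j = l 0 + c j * l 1 := fun l j => rfl
  have hne : c 0 - c 1 ≠ 0 := by
    have := prim_add_inv_ne h (i := 1) (j := 2) (by omega) (by omega) (by omega)
    simpa [hc] using this
  have inj : Function.Injective W0 := by
    rw [injective_iff_map_eq_zero]
    intro l hl
    have e0 := congrFun hl 0
    have e1 := congrFun hl 1
    rw [hW0, Pi.zero_apply] at e0 e1
    have l1 : l 1 = 0 := by
      refine (mul_eq_zero.mp (?_ : (c 0 - c 1) * l 1 = 0)).resolve_left hne
      linear_combination e0 - e1
    have l0 : l 0 = 0 := by rw [l1] at e0; simpa using e0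
    ext j; fin_cases j
    · exact l0
    · exact l1
  let W := LinearEquiv.ofInjectiveEndo W0 inj
  have hW : ∀ l j, W l j = l 0 + c j * l 1 := fun l j => rfl
  obtain ⟨C, hC⟩ := diagC W c
  refine ⟨W, C, hC, fun j => by simp [hW], W.injective (funext fun j => ?_)⟩
  rw [hC, hW, hW]; simp

lemma eig3 {K : Type*} [Field K] {M : ℕ} (hM : 7 ≤ M) {ζ : K} (h : IsPrimitiveRoot ζ M) (α β g : K) (hg : g * g = 1) :
    ∃ (W : (Fin 3 → K) ≃ₗ[K] (Fin 3 → K)) (C : (Fin 3 → K) →ₗ[K] (Fin 3 → K)),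
      (∀ l (j : Fin 3), W (C l) j = -(ζ ^ (j.val + 1) + (ζ ^ (j.val + 1))⁻¹) * W l j) ∧
      (∀ j, W ![1, 0, 0] j = 1) ∧ C ![1, 0, 0] = ![0, 1, 0] ∧ C ![0, 1, 0] = ![- g * α, - g * β, g] := by
  set c : Fin 3 → K := fun j => -(ζ ^ (j.val + 1) + (ζ ^ (j.val + 1))⁻¹) with hc
  let W0 : (Fin 3 → K) →ₗ[K] (Fin 3 → K) :=
    LinearMap.pi fun j => LinearMap.proj 0 + c j • LinearMap.proj 1 + (α + β * c j + g * c j ^ 2) • LinearMap.proj 2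
  have hW0 : ∀ l j, W0 l j = l 0 + c j * l 1 + (α + β * c j + g * c j ^ 2) * l 2 := fun l j => rfl
  have hne : c 0 - c 1 ≠ 0 := by
    have := prim_add_inv_ne h (i := 1) (j := 2) (by omega) (by omega) (by omega)
    simpa [hc] using this
  have hne' : c 0 - c 2 ≠ 0 := by
    have := prim_add_inv_ne h (i := 1) (j := 3) (by omega) (by omega) (by omega)
    simpa [hc] using this
  have hne'' : c 1 - c 2 ≠ 0 := by
    have := prim_add_inv_ne h (i := 2) (j := 3) (by omega) (by omega) (by omega)
    simpa [hc] using this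
  have gne : g ≠ 0 := by rintro rfl; simp at hg
  have inj : Function.Injective W0 := by
    rw [injective_iff_map_eq_zero]
    intro l hl
    have e0 := congrFun hl 0
    have e1 := congrFun hl 1
    have e2 := congrFun hl 2
    rw [hW0, Pi.zero_apply] at e0 e1 e2
    have f1 : l 1 + β * l 2 + g * (c 0 + c 1) * l 2 = 0 := by
      refine (mul_eq_zero.mp (?_ : (c 0 - c 1) * _ = 0)).resolve_left hne
      linear_combination e0 - e1
    have f2 : l 1 + β * l 2 + g * (c 0 + c 2) * l 2 = 0 := by
      refine (mul_eq_zero.mp (?_ : (c 0 - c 2) * _ = 0)).resolve_left hne'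
      linear_combination e0 - e2
    have l2 : l 2 = 0 := by
      refine (mul_eq_zero.mp (?_ : (g * (c 1 - c 2)) * l 2 = 0)).resolve_left (mul_ne_zero gne hne'')
      linear_combination f1 - f2
    have l1 : l 1 = 0 := by rw [l2] at f1; simpa using f1
    have l0 : l 0 = 0 := by rw [l1, l2] at e0; simpa using e0
    ext j; fin_cases j
    · exact l0
    · exact l1
    · exact l2
  let W := LinearEquiv.ofInjectiveEndo W0 inj
  have hW : ∀ l j, W l j = l 0 + c j * l 1 + (α + β * c j + g * c j ^ 2) * l 2 := fun l j => rfl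
  obtain ⟨C, hC⟩ := diagC W c
  refine ⟨W, C, hC, fun j => by simp [hW], W.injective (funext fun j => ?_), W.injective (funext fun j => ?_)⟩
  · rw [hC, hW, hW]; simp
  · rw [hC, hW, hW]; simp
    linear_combination (-(c j) ^ 2) * hg

section
variable {K Λ : Type*} [Field K] [AddCommGroup Λ] [Module K Λ]

lemma mk_refl (C D : Λ →ₗ[K] Λ) : ∃ a : (Λ × Λ × Λ) ≃ₗ[K] (Λ × Λ × Λ),
    (∀ v, a v = (-v.1, v.2.1 - C v.1, v.2.2 - D v.1)) ∧ ∀ v, a (a v) = v := by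
  let f : (Λ × Λ × Λ) →ₗ[K] (Λ × Λ × Λ) :=
    { toFun := fun v => (-v.1, v.2.1 - C v.1, v.2.2 - D v.1)
      map_add' := by
        intro v w
        simp only [Prod.fst_add, Prod.snd_add, map_add, Prod.mk_add_mk, Prod.mk.injEq]
        refine ⟨?_, ?_, ?_⟩ <;> abel
      map_smul' := by
        intro t v
        simp [smul_sub] }
  have hf : ∀ v, f v = (-v.1, v.2.1 - C v.1, v.2.2 - D v.1) := fun v => rfl
  have ff : ∀ v, f (f v) = v := by
    intro v; simp [hf]
  exact ⟨LinearEquiv.ofInvolutive f ff, hf, ff⟩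

lemma mk_refl2 (C D : Λ →ₗ[K] Λ) : ∃ a : (Λ × Λ × Λ) ≃ₗ[K] (Λ × Λ × Λ),
    (∀ v, a v = (v.1 - C v.2.1, -v.2.1, v.2.2 - D v.2.1)) ∧ ∀ v, a (a v) = v := by
  let f : (Λ × Λ × Λ) →ₗ[K] (Λ × Λ × Λ) :=
    { toFun := fun v => (v.1 - C v.2.1, -v.2.1, v.2.2 - D v.2.1)
      map_add' := by
        intro v w
        simp only [Prod.fst_add, Prod.snd_add, map_add, Prod.mk_add_mk, Prod.mk.injEq]
        refine ⟨?_, ?_, ?_⟩ <;> abel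
      map_smul' := by
        intro t v
        simp [smul_sub] }
  have hf : ∀ v, f v = (v.1 - C v.2.1, -v.2.1, v.2.2 - D v.2.1) := fun v => rfl
  have ff : ∀ v, f (f v) = v := by
    intro v; simp [hf]
  exact ⟨LinearEquiv.ofInvolutive f ff, hf, ff⟩

lemma mk_refl3 (C D : Λ →ₗ[K] Λ) : ∃ a : (Λ × Λ × Λ) ≃ₗ[K] (Λ × Λ × Λ),
    (∀ v, a v = (v.1 - C v.2.2, v.2.1 - D v.2.2, -v.2.2)) ∧ ∀ v, a (a v) = v := by
  let f : (Λ × Λ × Λ) →ₗ[K] (Λ × Λ × Λ) :=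
    { toFun := fun v => (v.1 - C v.2.2, v.2.1 - D v.2.2, -v.2.2)
      map_add' := by
        intro v w
        simp only [Prod.fst_add, Prod.snd_add, map_add, Prod.mk_add_mk, Prod.mk.injEq]
        refine ⟨?_, ?_, ?_⟩ <;> abel
      map_smul' := by
        intro t v
        simp [smul_sub] }
  have hf : ∀ v, f v = (v.1 - C v.2.2, v.2.1 - D v.2.2, -v.2.2) := fun v => rfl
  have ff : ∀ v, f (f v) = v := by
    intro v; simp [hf]
  exact ⟨LinearEquiv.ofInvolutive f ff, hf, ff⟩
end

section
variable {K Λ : Type*} [Field K] [AddCommGroup Λ] [Module K Λ]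

/-- eigenvalue data of an operator -/
def Eig (C : Λ →ₗ[K] Λ) (u : Λ) (M : ℕ) : Prop :=
  ∃ (k : ℕ) (W : Λ ≃ₗ[K] (Fin k → K)) (ζ : Fin k → K),
    (∀ l j, W (C l) j = - (ζ j + (ζ j)⁻¹) * W l j) ∧ (∀ j, ζ j ^ M = 1) ∧ (∀ j, ζ j ^ 2 ≠ 1) ∧
    (∃ j0 j1, IsPrimitiveRoot (ζ j0) M ∧ ζ j1 = ζ j0 ^ 2) ∧ ∀ j, W u j ≠ 0

lemma pairE {V : Type*} [AddCommGroup V] [Module K V] {M : ℕ} (hM : 4 ≤ M) (a b : V ≃ₗ[K] V) (fa fb fc : V →ₗ[K] Λ)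
    (T A B : Λ →ₗ[K] Λ) (u : Λ) (he : Eig T u M)
    (hinj : ∀ v w, fa v = fa w → fb v = fb w → fc v = fc w → v = w)
    (aa : ∀ v, a (a v) = v) (bb : ∀ v, b (b v) = v)
    (a1 : ∀ v, fa (a v) = - fa v) (a2 : ∀ v, fb (a v) = fb v - T (fa v)) (a3 : ∀ v, fc (a v) = fc v - A (fa v))
    (b1 : ∀ v, fb (b v) = - fb v) (b2 : ∀ v, fa (b v) = fa v - T (fb v)) (b3 : ∀ v, fc (b v) = fc v - B (fb v))
    (h2 : (2 : K) ≠ 0)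
    (p q r : V) (pa : fa p = u) (pb : fb p = u)
    (hq : b p = q ∨ b p = -q) (hr : a r = p ∨ a r = -p) :
    Br a b M ∧ Ret (rho K V b * rho K V a) (pm p) (pm q) (pm r) M := by
  obtain ⟨k, W, ζ, hT, hz, hz2, ⟨j0, j1, hj0, hj1⟩, hu⟩ := he
  exact pair hM a b fa fb fc W T A B ζ hinj aa bb a1 a2 a3 b1 b2 b3 hT hz hz2 j0 j1 hj0 hj1 h2 u hu p q r pa pb hq hr

lemma Eig.neg {C : Λ →ₗ[K] Λ} {u : Λ} {M : ℕ} (h : Eig C u M) : Eig C (-u) M := by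
  obtain ⟨k, W, ζ, h1, h2, h3, h4, h5⟩ := h
  exact ⟨k, W, ζ, h1, h2, h3, h4, fun j => by simpa using h5 j⟩

lemma lin_rf [Finite Λ] {M N P : ℕ} (hM : 4 ≤ M) (hN : 4 ≤ N) (hP : 4 ≤ P) (C1 C2 C3 : Λ →ₗ[K] Λ) (u v : Λ)
    (h2 : (2 : K) ≠ 0) (u0 : u ≠ 0) (v0 : v ≠ 0) (vu : v - u ≠ u)
    (c1 : C1 u = v) (c2 : C2 u = v) (c3 : C3 u = v) (e2 : Eig C2 u N) (e3 : Eig C3 u P)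
    (H : ∀ a b : (Λ × Λ × Λ) ≃ₗ[K] (Λ × Λ × Λ), (∀ v, a (a v) = v) → (∀ v, b (b v) = v) →
      (∀ v, a v = (-v.1, v.2.1 - C1 v.1, v.2.2 - C3 v.1)) →
      (∀ v, b v = (v.1 - C1 v.2.1, -v.2.1, v.2.2 - C2 v.2.1)) →
      b (u, u, v - u) = (u - v, -u, -u) → a (u, v - u, u) = - (u, u, v - u) →
      Br a b M ∧ Ret (rho K _ b * rho K _ a) (pm (u, u, v - u)) (pm (u - v, -u, -u)) (pm (u, v - u, u)) M) :
    ResiduallyFinite (Artin3 M N P) := by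
  obtain ⟨a, ha, aa⟩ := mk_refl C1 C3
  obtain ⟨b, hb, bb⟩ := mk_refl2 C1 C2
  obtain ⟨c, hc, cc⟩ := mk_refl3 C3 C2
  have bp : b (u, u, v - u) = (u - v, -u, -u) := by
    rw [hb]; simp [c1, c2]
  have cq : c (u - v, -u, -u) = (u, v - u, u) := by
    rw [hc]; simp [c2, c3]; abel
  have ar : a (u, v - u, u) = - (u, u, v - u) := by
    rw [ha]; simp [c1, c3]
  have uu : u ≠ -u := by
    intro h
    have : (2 : K) • u = 0 := by
      rw [two_smul]; nth_rw 1 [h]; simp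
    exact (smul_ne_zero h2 u0) this
  have uv : u - v ≠ u := by
    intro h; apply v0; simpa using h
  let f1 : (Λ × Λ × Λ) →ₗ[K] Λ := LinearMap.fst K _ _
  let f2 : (Λ × Λ × Λ) →ₗ[K] Λ := LinearMap.fst K _ _ ∘ₗ LinearMap.snd K _ _
  let f3 : (Λ × Λ × Λ) →ₗ[K] Λ := LinearMap.snd K _ _ ∘ₗ LinearMap.snd K _ _
  have ext3 : ∀ x y : Λ × Λ × Λ, f1 x = f1 y → f2 x = f2 y → f3 x = f3 y → x = y :=
    fun x y h1 h2 h3 => Prod.ext h1 (Prod.ext h2 h3)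
  obtain ⟨B1, R1⟩ := H a b aa bb ha hb bp ar
  obtain ⟨B2, R2⟩ := pairE hN b c f2 f3 f1 C2 C1 C3 (-u) e2.neg
    (fun x y h1 h2 h3 => ext3 x y h3 h1 h2) bb cc
    (fun x => by rw [hb]; rfl) (fun x => by rw [hb]; rfl) (fun x => by rw [hb]; rfl)
    (fun x => by rw [hc]; rfl) (fun x => by rw [hc]; rfl) (fun x => by rw [hc]; rfl) h2
    (u - v, -u, -u) (u, v - u, u) (u, u, v - u) rfl rfl (Or.inl cq) (Or.inl bp)
  obtain ⟨B3, R3⟩ := pairE hP c a f3 f1 f2 C3 C2 C1 u e3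
    (fun x y h1 h2 h3 => ext3 x y h2 h3 h1) cc aa
    (fun x => by rw [hc]; rfl) (fun x => by rw [hc]; rfl) (fun x => by rw [hc]; rfl)
    (fun x => by rw [ha]; rfl) (fun x => by rw [ha]; rfl) (fun x => by rw [ha]; rfl) h2
    (u, v - u, u) (u, u, v - u) (u - v, -u, -u) rfl rfl (Or.inr ar) (Or.inl cq)
  refine good_rf hM hN hP (rho K _ a) (rho K _ b) (rho K _ c) (B1.map _) (B2.map _) (B3.map _) 
    (pm (u, u, v - u)) (pm (u - v, -u, -u)) (pm (u, v - u, u)) ?_ ?_ ?_ ?_ ?_ ?_ R1 R2 R3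
  · rw [Ne, pm_eq]
    rintro (h | h)
    · exact uv (congrArg Prod.fst h).symm
    · apply vu
      have := congrArg (fun x => x.2.2) h
      simpa using this
  · rw [Ne, pm_eq]
    rintro (h | h)
    · exact uv (congrArg Prod.fst h)
    · apply vu
      have := congrArg (fun x => x.2.1) h
      have h' : u - v = -u := by simpa using this.symm
      rw [← neg_sub, h', neg_neg]
  · rw [Ne, pm_eq]
    rintro (h | h)
    · exact vu (congrArg (fun x => x.2.2) h)
    · exact uu (congrArg Prod.fst h)
  · rw [rho_pm, bp]
  · rw [rho_pm, cq]
  · rw [rho_pm, ar, pm_neg]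
end

lemma field3 (M N P : ℕ) (hM : 0 < M) (hN : 0 < N) (hP : 0 < P) : ∃ (l : ℕ) (_ : Fact l.Prime), 2 < l ∧
    ∃ x y z : ZMod l, IsPrimitiveRoot x M ∧ IsPrimitiveRoot y N ∧ IsPrimitiveRoot z P := by
  have hpos : 0 < M * N * P := by positivity
  obtain ⟨l, hl, hB, w, hw⟩ := exists_field (M * N * P) 2 hpos.ne'
  exact ⟨l, ⟨hl⟩, hB, w ^ (N * P), w ^ (M * P), w ^ (M * N),
    hw.pow hpos (by ring), hw.pow hpos (by ring), hw.pow hpos (by ring)⟩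

lemma eig2' {K : Type*} [Field K] {M : ℕ} (hM : 5 ≤ M) {ζ : K} (h : IsPrimitiveRoot ζ M) :
    ∃ (C : (Fin 2 → K) →ₗ[K] (Fin 2 → K)), C ![1, 0] = ![0, 1] ∧ Eig C ![1, 0] M := by
  obtain ⟨W, C, h1, h2, h3⟩ := eig2 hM h
  refine ⟨C, h3, 2, W, fun j => ζ ^ (j.val + 1), h1, fun j => ?_, fun j => ?_, ⟨0, 1, ?_, ?_⟩, fun j => ?_⟩
  · rw [pow_right_comm, h.pow_eq_one, one_pow]
  · rw [← pow_mul]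
    exact h.pow_ne_one_of_pos_of_lt (by omega) (by have := j.2; omega)
  · simpa using h
  · simp
  · rw [h2]; exact one_ne_zero

lemma eig3' {K : Type*} [Field K] {M : ℕ} (hM : 7 ≤ M) {ζ : K} (h : IsPrimitiveRoot ζ M) (α β g : K) (hg : g * g = 1) :
    ∃ (C : (Fin 3 → K) →ₗ[K] (Fin 3 → K)), C ![1, 0, 0] = ![0, 1, 0] ∧ C ![0, 1, 0] = ![- g * α, - g * β, g] ∧
      Eig C ![1, 0, 0] M := by
  obtain ⟨W, C, h1, h2, h3, h4⟩ := eig3 hM h α β g hg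
  refine ⟨C, h3, h4, 3, W, fun j => ζ ^ (j.val + 1), h1, fun j => ?_, fun j => ?_, ⟨0, 1, ?_, ?_⟩, fun j => ?_⟩
  · rw [pow_right_comm, h.pow_eq_one, one_pow]
  · rw [← pow_mul]
    exact h.pow_ne_one_of_pos_of_lt (by omega) (by have := j.2; omega)
  · simpa using h
  · simp
  · rw [h2]; exact one_ne_zero

lemma two_ne {l : ℕ} [Fact l.Prime] (h : 2 < l) : (2 : ZMod l) ≠ 0 := by
  have : Fact (2 < l) := ⟨h⟩
  exact Ring.two_ne_zero (by rw [ZMod.ringChar_zmod_n]; omega)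

lemma caseI {M N P : ℕ} (hM : 5 ≤ M) (hN : 5 ≤ N) (hP : 5 ≤ P) : ResiduallyFinite (Artin3 M N P) := by
  obtain ⟨l, _, hl, x, y, z, hx, hy, hz⟩ := field3 M N P (by omega) (by omega) (by omega)
  obtain ⟨C1, c1, e1⟩ := eig2' hM hx
  obtain ⟨C2, c2, e2⟩ := eig2' hN hy
  obtain ⟨C3, c3, e3⟩ := eig2' hP hz
  refine lin_rf (K := ZMod l) (by omega) (by omega) (by omega) C1 C2 C3 _ _ (two_ne hl) ?_ ?_ ?_ c1 c2 c3 e2 e3 ?_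
  · intro h; simpa using congrFun h 0
  · intro h; simpa using congrFun h 1
  · intro h; simpa using congrFun h 1
  · intro a b aa bb ha hb bp ar
    exact pairE (by omega) a b (LinearMap.fst _ _ _) (LinearMap.fst _ _ _ ∘ₗ LinearMap.snd _ _ _)
      (LinearMap.snd _ _ _ ∘ₗ LinearMap.snd _ _ _) C1 C3 C2 _ e1
      (fun x y h1 h2 h3 => Prod.ext h1 (Prod.ext h2 h3)) aa bb
      (fun x => by rw [ha]; rfl) (fun x => by rw [ha]; rfl) (fun x => by rw [ha]; rfl)
      (fun x => by rw [hb]; rfl) (fun x => by rw [hb]; rfl) (fun x => by rw [hb]; rfl) (two_ne hl)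
      _ _ _ rfl rfl (Or.inl bp) (Or.inr ar)

lemma caseII {N P : ℕ} (hN : 7 ≤ N) (hP : 7 ≤ P) : ResiduallyFinite (Artin3 4 N P) := by
  obtain ⟨l, _, hl, x, y, z, hx, hy, hz⟩ := field3 4 N P (by omega) (by omega) (by omega)
  obtain ⟨C2, c2, c2', e2⟩ := eig3' hN hy 2 2 (-1) (by ring)
  obtain ⟨C3, c3, c3', e3⟩ := eig3' hP hz 0 0 1 (by ring)
  let C1 : (Fin 3 → ZMod l) →ₗ[ZMod l] (Fin 3 → ZMod l) :=
    LinearMap.pi ![2 • LinearMap.proj 1, LinearMap.proj 0, 0]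
  have hC1 : ∀ t, C1 t = ![2 * t 1, t 0, 0] := by
    intro t; ext j; fin_cases j <;> simp [C1]
  have hT : ∀ t, C1 (C1 (C1 t)) = (2 : ZMod l) • C1 t := by
    intro t; simp [hC1]
  have h2 := two_ne hl
  refine lin_rf (K := ZMod l) (by omega) (by omega) (by omega) C1 C2 C3 ![1, 0, 0] ![0, 1, 0] h2 ?_ ?_ ?_ (by simp [hC1]) c2 c3 e2 e3 ?_
  · intro h; simpa using congrFun h 0
  · intro h; simpa using congrFun h 1
  · intro h; simpa using congrFun h 1
  · intro a b aa bb ha hb bp ar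
    set u : Fin 3 → ZMod l := ![1, 0, 0] with hu
    set v : Fin 3 → ZMod l := ![0, 1, 0] with hv
    set w : Fin 3 → ZMod l := ![0, 0, 1] with hw
    have d2 : C2 v = (2 : ZMod l) • u + (2 : ZMod l) • v - w := by
      rw [c2']; ext j; fin_cases j <;> simp [hu, hv, hw]
    have d3 : C3 v = w := by
      rw [c3']; ext j; fin_cases j <;> simp [hw]
    have d1 : C1 v = (2 : ZMod l) • u := by
      rw [hC1]; ext j; fin_cases j <;> simp [hu, hv]
    have d0 : C1 u = v := by
      rw [hC1]; ext j; fin_cases j <;> simp [hu, hv]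
    have xp : (b * a) (u, u, v - u) = (u - v, v - u, u + v - w) := by
      rw [LinearEquiv.mul_apply, ha, hb]
      simp only [map_sub, map_neg, d0, d1, d2, c2, c3, Prod.mk.injEq]
      refine ⟨?_, ?_, ?_⟩ <;> module
    have xxp : (b * a) (u - v, v - u, u + v - w) = - (u, u, v - u) := by
      rw [LinearEquiv.mul_apply, ha, hb]
      simp only [map_sub, map_neg, d0, d1, d2, d3, c2, c3, Prod.mk.injEq, Prod.neg_mk, map_smul]
      refine ⟨?_, ?_, ?_⟩ <;> module
    constructor
    · rw [Br, if_pos (by norm_num)]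
      refine LinearEquiv.ext fun t => ?_
      show a (b (a (b t))) = b (a (b (a t)))
      obtain ⟨t1, t2, t3⟩ := t
      simp only [ha, hb, map_sub, map_neg, hT, Prod.mk.injEq, neg_sub, neg_neg, map_smul]
      refine ⟨?_, ?_, ?_⟩ <;> module
    · rw [← map_mul]
      refine ⟨fun h => by norm_num at h, fun _ => ⟨?_, ?_, by intro i h0 h1; omega⟩⟩
      · show ((rho _ _ (b * a)) ^ 2) _ = _
        rw [pow_two, Equiv.Perm.mul_apply, rho_pm, rho_pm, xp, xxp, pm_neg]
      · intro i h0 h1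
        obtain rfl : i = 1 := by omega
        rw [pow_one, rho_pm, xp]
        have w2 : ∀ t s1 s2 : Fin 3 → ZMod l, t 2 = 0 → pm (u - v, v - u, u + v - w) ≠ pm (s1, s2, t) := by
          intro t s1 s2 ht h
          rw [pm_eq] at h
          rcases h with h | h
          · have := congrFun (congrArg (fun x => x.2.2) h) 2
            simp [hu, hv, hw, ht] at this
          · have := congrFun (congrArg (fun x => x.2.2) h) 2
            simp [hu, hv, hw, ht] at this
        refine ⟨w2 _ _ _ ?_, w2 _ _ _ ?_, w2 _ _ _ ?_⟩ <;> simp [hu, hv]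


lemma case4 {N P : ℕ} (hN : 4 ≤ N) (hP : 4 ≤ P) (h1 : ¬ (N = 4 ∧ P % 2 = 1))
    (h2 : ¬ (P = 4 ∧ N % 2 = 1)) : ResiduallyFinite (Artin3 4 N P) := by
  rcases Nat.mod_two_eq_zero_or_one N with n | n <;>
    rcases Nat.mod_two_eq_zero_or_one P with p | p
  · exact caseV hN hP n p
  · exact rf_swap (caseIV (by omega) (by omega) p n)
  · exact caseIV (by omega) (by omega) n p
  · by_cases hN5 : N = 5
    · subst hN5
      exact caseIII (by omega) p
    by_cases hP5 : P = 5
    · subst hP5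
      exact rf_swap (caseIII (by omega) n)
    exact caseII (by omega) (by omega)

theorem artin3_residuallyFinite (M N P : ℕ) (hM : 4 ≤ M) (hN : 4 ≤ N) (hP : 4 ≤ P)
    (h : ¬ ((Odd M ∧ N = 4 ∧ P = 4) ∨ (Odd N ∧ M = 4 ∧ P = 4) ∨ (Odd P ∧ M = 4 ∧ N = 4))) :
    ResiduallyFinite (Artin3 M N P) := by
  simp only [Nat.odd_iff] at h
  by_cases m : M = 4
  · subst m
    exact case4 hN hP (by omega) (by omega)
  by_cases n : N = 4
  · subst n
    exact rf_rot (case4 hP hM (by omega) (by omega))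
  by_cases p : P = 4
  · subst p
    exact rf_rot (rf_rot (case4 hM hN (by omega) (by omega)))
  exact caseI (by omega) (by omega) (by omega)
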